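/- Let r ≥ 1 be an integer, 0 < a ≤ 1, and let σ satisfy r − 1 < σ < r − 1/2. Then, as T → ∞, ∫_1^T |ζ_r(σ+it, a, 𝟏)|² dt = (1/((r−1)!)²) · ((2π)^{2σ−2r+1}/(2r−2σ)) · ζ(2r−2σ) · T^{2r−2σ} + (Σ_{0 ≤ k,l ≤ r−1} p_{r,k}(a) p_{r,l}(a) ζ_H(2σ−k−l, a)) · T + O(T^{r−σ} log T), where ζ denotes the Riemann zeta function and the value ζ_H(2σ−k−l, a) is taken via the meromorphic continuation of the Hurwitz zeta function when 2σ−k−l ≤ 1. -/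

import Mathlib

open Complex Filter Finset MeasureTheory

/-- The Hurwitz zeta function `ζ_H(s,a)` (meromorphic continuation of
`∑ m, (m+a)^{-s}`). -/
noncomputable def hzeta (a : ℝ) (s : ℂ) : ℂ := HurwitzZeta.hurwitzZeta (a : UnitAddCircle) s

/-- `p_{r,j}(a)`: the coefficient of `X^j` in `(1/(r-1)!) ∏_{i=1}^{r-1} (X + i - a)`. -/
noncomputable def pCoeff (r : ℕ) (a : ℝ) (j : ℕ) : ℝ :=
  ((Nat.factorial (r - 1) : ℝ)⁻¹ •
    ∏ i ∈ Finset.range (r - 1), (Polynomial.X + Polynomial.C ((i : ℝ) + 1 - a))).coeff j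

/-- The Hurwitz multiple zeta function `ζ_r(s,a,𝟏) = ∑_{j=0}^{r-1} p_{r,j}(a) ζ_H(s-j,a)`. -/
noncomputable def zetaR (r : ℕ) (a : ℝ) (s : ℂ) : ℂ :=
  ∑ j ∈ Finset.range r, (pCoeff r a j : ℂ) * hzeta a (s - j)

/-- The shifted integers `m + a`. -/
noncomputable def xpt (a : ℝ) (m : ℕ) : ℝ := m + a

/-- The midpoints `K + a - 1/2`. -/
noncomputable def mpt (a : ℝ) (K : ℕ) : ℝ := K + a - 1 / 2

lemma xpt_pos {a : ℝ} (ha : 0 < a) (m : ℕ) : 0 < xpt a m := by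
  unfold xpt; positivity

lemma mpt_pos {a : ℝ} (ha : 0 < a) {m : ℕ} (hm : 1 ≤ m) : 0 < mpt a m := by
  have : (1 : ℝ) ≤ m := by exact_mod_cast hm
  unfold mpt; linarith

/-- The Euler–Maclaurin (midpoint) error term, multiplied by `s - 1`. -/
noncomputable def emTerm (a : ℝ) (m : ℕ) (s : ℂ) : ℂ :=
  (s - 1) * (xpt a m : ℂ) ^ (-s) + (mpt a (m + 1) : ℂ) ^ (1 - s) - (mpt a m : ℂ) ^ (1 - s)

lemma norm_cpow_sub_cpow_le {A x u : ℝ} (hA : 0 < A) (hx : A ≤ x) (hu : A ≤ u) {s : ℂ}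
    (hs : 0 < s.re) :
    ‖(x : ℂ) ^ (-s) - (u : ℂ) ^ (-s)‖ ≤ ‖s‖ * A ^ (-s.re - 1) * |x - u| := by
  have key := Convex.norm_image_sub_le_of_norm_hasDerivWithin_le (𝕜 := ℝ)
    (f := fun y : ℝ => (y : ℂ) ^ (-s)) (f' := fun y : ℝ => (-s) * (y : ℂ) ^ (-s - 1))
    (s := Set.Ici A) (x := u) (y := x) (C := ‖s‖ * A ^ (-s.re - 1)) ?_ ?_ (convex_Ici A) hu hx
  · simpa using key
  · intro y hy
    have hy0 : 0 < y := hA.trans_le hy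
    have h1 : HasDerivAt (fun z : ℂ => z ^ (-s)) ((-s) * (y : ℂ) ^ (-s - 1)) (y : ℂ) := by
      simpa using (hasDerivAt_id (y : ℂ)).cpow_const (c := -s) (by simp [slitPlane, hy0])
    exact h1.comp_ofReal.hasDerivWithinAt
  · intro y hy
    have hy0 : 0 < y := hA.trans_le hy
    rw [norm_mul, norm_neg, norm_cpow_eq_rpow_re_of_pos hy0]
    refine mul_le_mul_of_nonneg_left ?_ (norm_nonneg _)
    simp only [sub_re, neg_re, one_re]
    exact Real.rpow_le_rpow_of_nonpos hA hy (by linarith)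

lemma norm_emTerm_le {a : ℝ} (ha : 0 < a) {m : ℕ} (hm : 1 ≤ m) {s : ℂ} (hs : 0 < s.re) :
    ‖emTerm a m s‖ ≤ ‖s - 1‖ * ‖s‖ * mpt a m ^ (-s.re - 1) := by
  have hX := mpt_pos ha hm
  have hxm : mpt a m ≤ xpt a m := by unfold mpt xpt; linarith
  have hmm : mpt a (m + 1) = mpt a m + 1 := by unfold mpt; push_cast; ring
  have key := Convex.norm_image_sub_le_of_norm_hasDerivWithin_le (𝕜 := ℝ)
    (f := fun y : ℝ => (s - 1) * (xpt a m : ℂ) ^ (-s) * (y : ℂ) + (y : ℂ) ^ (1 - s))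
    (f' := fun y : ℝ => (s - 1) * (xpt a m : ℂ) ^ (-s) + (1 - s) * (y : ℂ) ^ (1 - s - 1))
    (s := Set.Icc (mpt a m) (mpt a (m + 1))) (x := mpt a m) (y := mpt a (m + 1))
    (C := ‖s - 1‖ * ‖s‖ * mpt a m ^ (-s.re - 1)) ?_ ?_ (convex_Icc _ _)
    ⟨le_rfl, by rw [hmm]; linarith⟩ ⟨by rw [hmm]; linarith, le_rfl⟩
  · have h2 : ‖mpt a (m + 1) - mpt a m‖ = 1 := by rw [hmm]; simp
    rw [h2, mul_one] at key
    refine le_trans (le_of_eq ?_) key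
    unfold emTerm
    congr 1
    rw [hmm]; push_cast; ring
  · intro y hy
    have hy0 : 0 < y := hX.trans_le hy.1
    have h1 : HasDerivAt (fun z : ℂ => z ^ (1 - s)) ((1 - s) * (y : ℂ) ^ (1 - s - 1)) (y : ℂ) := by
      simpa using (hasDerivAt_id (y : ℂ)).cpow_const (c := 1 - s) (by simp [slitPlane, hy0])
    have h2 : HasDerivAt (fun z : ℂ => (s - 1) * (xpt a m : ℂ) ^ (-s) * z)
        ((s - 1) * (xpt a m : ℂ) ^ (-s)) (y : ℂ) := by
      simpa using (hasDerivAt_id (y : ℂ)).const_mul ((s - 1) * (xpt a m : ℂ) ^ (-s))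
    exact (h2.add h1).comp_ofReal.hasDerivWithinAt
  · intro y hy
    have hy0 : 0 < y := hX.trans_le hy.1
    have e1 : (s - 1) * (xpt a m : ℂ) ^ (-s) + (1 - s) * (y : ℂ) ^ (1 - s - 1)
      = (s - 1) * ((xpt a m : ℂ) ^ (-s) - (y : ℂ) ^ (-s)) := by
      rw [show 1 - s - 1 = -s by ring]; ring
    rw [e1, norm_mul, mul_assoc]
    refine mul_le_mul_of_nonneg_left ?_ (norm_nonneg _)
    refine (norm_cpow_sub_cpow_le hX hxm hy.1 hs).trans ?_
    refine mul_le_of_le_one_right (by positivity) ?_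
    have := hy.2; have := hy.1
    rw [abs_le]; unfold mpt xpt at *; push_cast at *
    constructor <;> linarith

lemma mpt_rpow_telescope {a : ℝ} (ha : 0 < a) {m : ℕ} (hm : 1 ≤ m) {σ : ℝ} (hσ : 0 < σ) :
    mpt a (m + 1) ^ (-σ - 1) ≤ σ⁻¹ * (mpt a m ^ (-σ) - mpt a (m + 1) ^ (-σ)) := by
  have hX := mpt_pos ha hm
  have hmm : mpt a (m + 1) = mpt a m + 1 := by unfold mpt; push_cast; ring
  have hlt : mpt a m < mpt a (m + 1) := by rw [hmm]; linarith
  obtain ⟨c, hc, hc'⟩ := exists_hasDerivAt_eq_slope (fun y : ℝ => y ^ (-σ))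
    (fun y : ℝ => (-σ) * y ^ (-σ - 1)) hlt
    (fun y hy => (Real.continuousAt_rpow_const _ _
      (Or.inl (hX.trans_le hy.1).ne')).continuousWithinAt)
    (fun y hy => Real.hasDerivAt_rpow_const (Or.inl (hX.trans hy.1).ne'))
  have h1 : mpt a (m + 1) - mpt a m = 1 := by rw [hmm]; ring
  rw [h1, div_one] at hc'
  have h2 : mpt a m ^ (-σ) - mpt a (m + 1) ^ (-σ) = σ * c ^ (-σ - 1) := by linarith
  rw [h2, ← mul_assoc, inv_mul_cancel₀ hσ.ne', one_mul]
  exact Real.rpow_le_rpow_of_nonpos (hX.trans hc.1) hc.2.le (by linarith)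

lemma sum_mpt_rpow_le {a : ℝ} (ha : 0 < a) {N : ℕ} (hN : 2 ≤ N) {σ : ℝ} (hσ : 0 < σ) (n : ℕ) :
    ∑ m ∈ range n, mpt a (m + N) ^ (-σ - 1) ≤ σ⁻¹ * mpt a (N - 1) ^ (-σ) := by
  have h : ∀ n : ℕ, ∑ m ∈ range n, mpt a (m + N) ^ (-σ - 1)
      ≤ σ⁻¹ * (mpt a (N - 1) ^ (-σ) - mpt a (N - 1 + n) ^ (-σ)) := by
    intro n
    induction n with
    | zero => simp
    | succ k ih =>
      rw [sum_range_succ]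
      have := mpt_rpow_telescope ha (m := N - 1 + k) (by omega) hσ
      rw [show N - 1 + k + 1 = k + N by omega] at this
      rw [show N - 1 + (k + 1) = k + N by omega]
      have e : σ⁻¹ * (mpt a (N - 1) ^ (-σ) - mpt a (k + N) ^ (-σ)) =
        σ⁻¹ * (mpt a (N - 1) ^ (-σ) - mpt a (N - 1 + k) ^ (-σ)) +
        σ⁻¹ * (mpt a (N - 1 + k) ^ (-σ) - mpt a (k + N) ^ (-σ)) := by ring
      rw [e]; linarith
  refine (h n).trans (mul_le_mul_of_nonneg_left ?_ (by positivity))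
  have := Real.rpow_nonneg (mpt_pos ha (m := N - 1 + n) (by omega)).le (-σ)
  linarith

lemma summable_mpt_rpow {a : ℝ} (ha : 0 < a) {N : ℕ} (hN : 2 ≤ N) {σ : ℝ} (hσ : 0 < σ) :
    Summable fun m : ℕ => mpt a (m + N) ^ (-σ - 1) :=
  summable_of_sum_range_le (fun m => Real.rpow_nonneg (mpt_pos ha (by omega)).le _)
    (sum_mpt_rpow_le ha hN hσ)

lemma sum_emTerm (a : ℝ) (s : ℂ) (N n : ℕ) :
    ∑ m ∈ range n, emTerm a (m + N) s = (s - 1) * ∑ m ∈ range n, (xpt a (m + N) : ℂ) ^ (-s)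
      + (mpt a (n + N) : ℂ) ^ (1 - s) - (mpt a N : ℂ) ^ (1 - s) := by
  induction n with
  | zero => simp
  | succ k ih =>
    rw [sum_range_succ, ih, sum_range_succ, emTerm]
    rw [show k + 1 + N = k + N + 1 by ring]; ring

lemma differentiable_emTerm {a : ℝ} (ha : 0 < a) {m : ℕ} (hm : 1 ≤ m) :
    Differentiable ℂ (emTerm a m) := by
  have h1 := xpt_pos ha m
  have h2 := mpt_pos ha hm
  have h3 := mpt_pos ha (m := m + 1) (by omega)
  unfold emTerm
  refine Differentiable.sub (Differentiable.add (Differentiable.mul (by fun_prop) ?_) ?_) ?_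
  all_goals
    refine Differentiable.const_cpow (by fun_prop) (Or.inl ?_)
    simp only [ne_eq, ofReal_eq_zero]; positivity

lemma differentiableAt_tsum_emTerm {a : ℝ} (ha : 0 < a) {s : ℂ} (hs : 0 < s.re) :
    DifferentiableAt ℂ (fun z => ∑' m : ℕ, emTerm a (m + 2) z) s := by
  set U : Set ℂ := {z | s.re / 2 < z.re} ∩ Metric.ball 0 (‖s‖ + 1) with hU
  have hUo : IsOpen U := (isOpen_lt continuous_const continuous_re).inter Metric.isOpen_ball
  have hsU : s ∈ U := ⟨by simp only [Set.mem_ofPred_eq]; linarith, by simp⟩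
  refine (differentiableOn_tsum_of_summable_norm
    (u := fun m : ℕ => (‖s‖ + 2) * (‖s‖ + 1) * mpt a (m + 2) ^ (-(s.re / 2) - 1))
    ((summable_mpt_rpow ha le_rfl (half_pos hs)).mul_left _) ?_ hUo ?_).differentiableAt
    (hUo.mem_nhds hsU)
  · intro m; exact (differentiable_emTerm ha (by omega)).differentiableOn
  · intro m w hw
    have hw1 : s.re / 2 < w.re := hw.1
    have hw2 : ‖w‖ < ‖s‖ + 1 := by simpa using hw.2
    have hX : 1 ≤ mpt a (m + 2) := by
      unfold mpt; push_cast; have : (0:ℝ) ≤ m := by positivity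
      linarith
    refine (norm_emTerm_le ha (by omega) (by linarith)).trans ?_
    have h3 : ‖w - 1‖ ≤ ‖s‖ + 2 := by
      refine (norm_sub_le _ _).trans ?_
      rw [norm_one]; linarith
    gcongr

lemma hzeta_identity {a : ℝ} (ha : 0 < a) (ha1 : a ≤ 1) {s : ℂ} (hs : 0 < s.re) (hs1 : s ≠ 1) :
    (s - 1) * hzeta a s = (s - 1) * ∑ m ∈ range 2, (xpt a m : ℂ) ^ (-s)
      + (mpt a 2 : ℂ) ^ (1 - s) + ∑' m : ℕ, emTerm a (m + 2) s := by
  set U : Set ℂ := {z | 0 < z.re} with hU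
  have hUo : IsOpen U := isOpen_lt continuous_const continuous_re
  have hUc : IsPreconnected U := (convex_halfSpace_re_gt 0).isPreconnected
  set f : ℂ → ℂ := Function.update (fun z => (z - 1) * hzeta a z) 1 1 with hf
  set g : ℂ → ℂ := fun s => (s - 1) * ∑ m ∈ range 2, (xpt a m : ℂ) ^ (-s)
      + (mpt a 2 : ℂ) ^ (1 - s) + ∑' m : ℕ, emTerm a (m + 2) s with hg
  have hfd : Differentiable ℂ f := by
    have hoff : ∀ z : ℂ, z ≠ 1 → DifferentiableAt ℂ f z := by
      intro z hz
      have : DifferentiableAt ℂ (fun z => (z - 1) * hzeta a z) z :=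
        ((differentiableAt_id).sub_const 1).mul
          (HurwitzZeta.differentiableAt_hurwitzZeta _ hz)
      refine this.congr_of_eventuallyEq ?_
      filter_upwards [isOpen_ne.mem_nhds hz] with y hy
      rw [hf, Function.update_of_ne hy]
    intro z
    by_cases hz : z = 1
    · subst hz
      have hcont : ContinuousAt f 1 := by
        rw [hf, continuousAt_update_same]
        exact HurwitzZeta.hurwitzZeta_residue_one _
      refine (analyticAt_of_differentiable_on_punctured_nhds_of_continuousAt ?_
        hcont).differentiableAt
      filter_upwards [self_mem_nhdsWithin] with y hy using hoff y hy
    · exact hoff z hz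
  have hgd : DifferentiableOn ℂ g U := by
    intro z hz
    refine DifferentiableAt.differentiableWithinAt ?_
    refine DifferentiableAt.add (DifferentiableAt.add (DifferentiableAt.mul (by fun_prop) ?_) ?_)
      (differentiableAt_tsum_emTerm ha hz)
    · refine DifferentiableAt.fun_sum fun m _ => ?_
      refine DifferentiableAt.const_cpow (by fun_prop) (Or.inl ?_)
      simpa using (xpt_pos ha m).ne'
    · refine DifferentiableAt.const_cpow (by fun_prop) (Or.inl ?_)
      simpa using (mpt_pos ha (m := 2) (by omega)).ne'
  have hev : f =ᶠ[nhds 2] g := by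
    have hV : {z : ℂ | 1 < z.re} ∈ nhds (2 : ℂ) :=
      (isOpen_lt continuous_const continuous_re).mem_nhds (by simp)
    filter_upwards [hV] with z hz
    have hz : 1 < z.re := hz
    have hz1 : z ≠ 1 := by rintro rfl; simp at hz
    rw [hf, Function.update_of_ne hz1]
    have hsum := HurwitzZeta.hasSum_hurwitzZeta_of_one_lt_re (a := a) ⟨ha.le, ha1⟩ hz
    have hsum' : HasSum (fun m : ℕ => (xpt a m : ℂ) ^ (-z)) (hzeta a z) := by
      have e : (fun m : ℕ => (xpt a m : ℂ) ^ (-z)) = fun m : ℕ => 1 / ((m : ℂ) + a) ^ z := by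
        ext m; rw [cpow_neg, one_div]; simp [xpt]
      rw [e]; exact hsum
    have h2 := ((hasSum_nat_add_iff' 2).mpr hsum').tendsto_sum_nat
    have h3 : Tendsto (fun n : ℕ => (mpt a (n + 2) : ℂ) ^ (1 - z)) atTop (nhds 0) := by
      rw [tendsto_zero_iff_norm_tendsto_zero]
      have : ∀ n : ℕ, ‖(mpt a (n + 2) : ℂ) ^ (1 - z)‖ = mpt a (n + 2) ^ (-(z.re - 1)) := by
        intro n
        rw [norm_cpow_eq_rpow_re_of_pos (mpt_pos ha (by omega))]; simp
      simp_rw [this]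
      refine (tendsto_rpow_neg_atTop (by linarith)).comp ?_
      unfold mpt
      refine tendsto_atTop_mono (f := fun n : ℕ => (n : ℝ)) (fun n => ?_)
        tendsto_natCast_atTop_atTop
      push_cast; linarith
    have h4 := ((h2.const_mul (z - 1)).add h3).sub_const ((mpt a 2 : ℂ) ^ (1 - z))
    have h5 : Tendsto (fun n => ∑ m ∈ range n, emTerm a (m + 2) z) atTop
        (nhds (∑' m : ℕ, emTerm a (m + 2) z)) := by
      refine (Summable.of_norm_bounded
        (g := fun m : ℕ => ‖z - 1‖ * ‖z‖ * mpt a (m + 2) ^ (-z.re - 1))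
        ((summable_mpt_rpow ha le_rfl (by linarith)).mul_left _) ?_).hasSum.tendsto_sum_nat
      intro m
      exact norm_emTerm_le ha (by omega) (by linarith)
    simp_rw [sum_emTerm] at h5
    have := tendsto_nhds_unique h5 h4
    simp only [hg, this]; ring
  have := (hfd.differentiableOn.analyticOnNhd hUo).eqOn_of_preconnected_of_eventuallyEq
    (hgd.analyticOnNhd hUo) hUc (by simp [hU] : (2 : ℂ) ∈ U) hev hs
  rw [hf, Function.update_of_ne hs1] at this
  exact this

theorem hzeta_approx {a : ℝ} (ha : 0 < a) (ha1 : a ≤ 1) {s : ℂ} (hs : 0 < s.re) (hs1 : s ≠ 1) :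
    ∃ C : ℝ, 0 ≤ C ∧ ∀ N : ℕ, 2 ≤ N → ‖hzeta a s - ∑ m ∈ range N, (xpt a m : ℂ) ^ (-s)
      - (mpt a N : ℂ) ^ (1 - s) / (s - 1)‖ ≤ C * mpt a N ^ (-s.re) := by
  have hs1' : s - 1 ≠ 0 := sub_ne_zero.mpr hs1
  refine ⟨‖s‖ * (s.re)⁻¹ * 3 ^ s.re, by positivity, fun N hN => ?_⟩
  have hsummable : ∀ {M : ℕ}, 2 ≤ M → Summable fun m : ℕ => emTerm a (m + M) s := by
    intro M hM
    refine Summable.of_norm_bounded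
        (g := fun m : ℕ => ‖s - 1‖ * ‖s‖ * mpt a (m + M) ^ (-s.re - 1))
        ((summable_mpt_rpow ha hM hs).mul_left _) fun m => norm_emTerm_le ha (by omega) hs
  have h1 := hzeta_identity ha ha1 hs hs1
  have h2 := (hsummable le_rfl).sum_add_tsum_nat_add (N - 2)
  have h3 : (∑' m : ℕ, emTerm a (m + (N - 2) + 2) s) = ∑' m : ℕ, emTerm a (m + N) s := by
    congr 1; ext m; congr 1; omega
  rw [h3, sum_emTerm, show N - 2 + 2 = N by omega] at h2
  have h4 : ∑ m ∈ range N, (xpt a m : ℂ) ^ (-s) = ∑ m ∈ range 2, (xpt a m : ℂ) ^ (-s)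
      + ∑ m ∈ range (N - 2), (xpt a (m + 2) : ℂ) ^ (-s) := by
    conv_lhs => rw [show N = 2 + (N - 2) by omega, sum_range_add]
    simp_rw [add_comm 2]
  have h5 : hzeta a s - ∑ m ∈ range N, (xpt a m : ℂ) ^ (-s)
      - (mpt a N : ℂ) ^ (1 - s) / (s - 1) = (∑' m : ℕ, emTerm a (m + N) s) / (s - 1) := by
    rw [← h2] at h1
    field_simp
    rw [h4]
    linear_combination h1
  rw [h5, norm_div, div_le_iff₀ (norm_pos_iff.mpr hs1')]
  have h6 : ‖∑' m : ℕ, emTerm a (m + N) s‖ ≤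
      ‖s - 1‖ * ‖s‖ * ((s.re)⁻¹ * mpt a (N - 1) ^ (-s.re)) := by
    refine tsum_of_norm_bounded (g := fun m : ℕ => ‖s - 1‖ * ‖s‖ * mpt a (m + N) ^ (-s.re - 1))
      (((summable_mpt_rpow ha hN hs).mul_left _).hasSum) (fun m => norm_emTerm_le ha (by omega) hs)
      |>.trans ?_
    rw [tsum_mul_left]
    refine mul_le_mul_of_nonneg_left ?_ (by positivity)
    exact Real.tsum_le_of_sum_range_le (fun m => Real.rpow_nonneg (mpt_pos ha (by omega)).le _)
      (sum_mpt_rpow_le ha hN hs)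
  refine h6.trans ?_
  have hN' : (2 : ℝ) ≤ N := by exact_mod_cast hN
  have h7 : mpt a N / 3 ≤ mpt a (N - 1) := by
    unfold mpt; rw [Nat.cast_sub (by omega)]; push_cast; linarith
  have h8 : mpt a (N - 1) ^ (-s.re) ≤ 3 ^ s.re * mpt a N ^ (-s.re) := by
    have hXN := mpt_pos ha (m := N) (by omega)
    refine (Real.rpow_le_rpow_of_nonpos (by positivity) h7 (by linarith)).trans (le_of_eq ?_)
    rw [div_eq_mul_inv, Real.mul_rpow hXN.le (by norm_num), Real.inv_rpow (by norm_num),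
      Real.rpow_neg (by norm_num : (0:ℝ) ≤ 3), inv_inv, mul_comm]
  have hr : 0 < (s.re)⁻¹ := by positivity
  calc _ ≤ ‖s - 1‖ * ‖s‖ * ((s.re)⁻¹ * (3 ^ s.re * mpt a N ^ (-s.re))) := by gcongr
    _ = _ := by ring

/-- The integral of `f` over the boundary of the rectangle `[x₀, x₁] × [y₀, y₁]`. -/
noncomputable def rectInt (f : ℂ → ℂ) (x₀ x₁ y₀ y₁ : ℝ) : ℂ :=
  (∫ x in x₀..x₁, f (x + y₀ * I)) - (∫ x in x₀..x₁, f (x + y₁ * I))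
    + I * (∫ y in y₀..y₁, f (x₁ + y * I)) - I * ∫ y in y₀..y₁, f (x₀ + y * I)

lemma rectInt_eq_zero {f : ℂ → ℂ} {x₀ x₁ y₀ y₁ : ℝ}
    (hf : DifferentiableOn ℂ f (Set.uIcc x₀ x₁ ×ℂ Set.uIcc y₀ y₁)) :
    rectInt f x₀ x₁ y₀ y₁ = 0 := by
  have := Complex.integral_boundary_rect_eq_zero_of_differentiableOn f (x₀ + y₀ * I) (x₁ + y₁ * I)
    (by simpa using hf)
  simpa [rectInt] using this

lemma rectInt_add {f g : ℂ → ℂ} {x₀ x₁ y₀ y₁ : ℝ} (hx : x₀ ≤ x₁) (hy : y₀ ≤ y₁)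
    (h1f : ContinuousOn f {z : ℂ | z.re ∈ Set.Icc x₀ x₁ ∧ z.im ∈ Set.Icc y₀ y₁ ∧
      (z.re = x₀ ∨ z.re = x₁ ∨ z.im = y₀ ∨ z.im = y₁)})
    (h1g : ContinuousOn g {z : ℂ | z.re ∈ Set.Icc x₀ x₁ ∧ z.im ∈ Set.Icc y₀ y₁ ∧
      (z.re = x₀ ∨ z.re = x₁ ∨ z.im = y₀ ∨ z.im = y₁)}) :
    rectInt (fun z => f z + g z) x₀ x₁ y₀ y₁ = rectInt f x₀ x₁ y₀ y₁ + rectInt g x₀ x₁ y₀ y₁ := by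
  have H : ∀ {f : ℂ → ℂ}, ContinuousOn f {z : ℂ | z.re ∈ Set.Icc x₀ x₁ ∧ z.im ∈ Set.Icc y₀ y₁ ∧
      (z.re = x₀ ∨ z.re = x₁ ∨ z.im = y₀ ∨ z.im = y₁)} →
      (IntervalIntegrable (fun x : ℝ => f (x + y₀ * I)) volume x₀ x₁ ∧
      IntervalIntegrable (fun x : ℝ => f (x + y₁ * I)) volume x₀ x₁) ∧
      IntervalIntegrable (fun y : ℝ => f (x₀ + y * I)) volume y₀ y₁ ∧
      IntervalIntegrable (fun y : ℝ => f (x₁ + y * I)) volume y₀ y₁ := by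
    intro f hf
    refine ⟨⟨?_, ?_⟩, ?_, ?_⟩
    all_goals
      refine ContinuousOn.intervalIntegrable ?_
      refine hf.comp (by fun_prop) ?_
      intro t ht
      first
        | rw [Set.uIcc_of_le hx] at ht
        | rw [Set.uIcc_of_le hy] at ht
      simp [ht.1, ht.2, hx, hy]
  obtain ⟨⟨a1, a2⟩, a3, a4⟩ := H h1f
  obtain ⟨⟨b1, b2⟩, b3, b4⟩ := H h1g
  unfold rectInt
  rw [intervalIntegral.integral_add a1 b1, intervalIntegral.integral_add a2 b2,
    intervalIntegral.integral_add a3 b3, intervalIntegral.integral_add a4 b4]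
  ring

lemma rectInt_inv {x₀ x₁ y₀ y₁ : ℝ} (hx0 : x₀ < 0) (hx1 : 0 < x₁) (hy0 : y₀ < 0) (hy1 : 0 < y₁) :
    rectInt (fun z => z⁻¹) x₀ x₁ y₀ y₁ = 2 * Real.pi * I := by
  have hor : ∀ y : ℝ, y ≠ 0 → ∫ x in x₀..x₁, ((x : ℂ) + y * I)⁻¹ =
      log (x₁ + y * I) - log (x₀ + y * I) := by
    intro y hy
    have hne : ∀ x : ℝ, (x : ℂ) + y * I ∈ slitPlane := fun x => Or.inr (by simpa using hy)
    refine intervalIntegral.integral_eq_sub_of_hasDerivAt (f := fun x : ℝ => log (x + y * I))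
      (fun x _ => ?_) ?_
    · have h1 : HasDerivAt (fun z : ℂ => log (z + y * I)) (1 / (x + y * I)) (x : ℂ) :=
        ((hasDerivAt_id (x : ℂ)).add_const (y * I)).clog (hne x)
      simpa using h1.comp_ofReal
    · refine ContinuousOn.intervalIntegrable (ContinuousOn.inv₀ (by fun_prop) fun x _ => ?_)
      exact slitPlane_ne_zero (hne x)
  have right : I * ∫ y in y₀..y₁, ((x₁ : ℂ) + y * I)⁻¹ =
      log (x₁ + y₁ * I) - log (x₁ + y₀ * I) := by
    have hne : ∀ y : ℝ, (x₁ : ℂ) + y * I ∈ slitPlane := fun y => Or.inl (by simpa using hx1)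
    rw [← intervalIntegral.integral_const_mul]
    refine intervalIntegral.integral_eq_sub_of_hasDerivAt (f := fun y : ℝ => log (x₁ + y * I))
      (fun y _ => ?_) ?_
    · have h1 : HasDerivAt (fun z : ℂ => log (x₁ + z * I)) (1 * I / (x₁ + y * I)) (y : ℂ) :=
        (((hasDerivAt_id (y : ℂ)).mul_const I).const_add (x₁ : ℂ)).clog (hne y)
      simpa [div_eq_mul_inv] using h1.comp_ofReal
    · refine ContinuousOn.intervalIntegrable
        (continuousOn_const.mul (ContinuousOn.inv₀ (by fun_prop) fun y _ => ?_))
      exact slitPlane_ne_zero (hne y)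
  have left : I * ∫ y in y₀..y₁, ((x₀ : ℂ) + y * I)⁻¹ =
      log (-(x₀ + y₁ * I)) - log (-(x₀ + y₀ * I)) := by
    have hne : ∀ y : ℝ, -((x₀ : ℂ) + y * I) ∈ slitPlane := fun y => Or.inl (by simpa using hx0)
    rw [← intervalIntegral.integral_const_mul]
    refine intervalIntegral.integral_eq_sub_of_hasDerivAt (f := fun y : ℝ => log (-(x₀ + y * I)))
      (fun y _ => ?_) ?_
    · have h1 : HasDerivAt (fun z : ℂ => log (-(x₀ + z * I))) (-(1 * I) / (-(x₀ + y * I))) (y : ℂ) :=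
        (((hasDerivAt_id (y : ℂ)).mul_const I).const_add (x₀ : ℂ)).neg.clog (hne y)
      have := h1.comp_ofReal
      rwa [neg_div_neg_eq, one_mul, div_eq_mul_inv] at this
    · refine ContinuousOn.intervalIntegrable
        (continuousOn_const.mul (ContinuousOn.inv₀ (by fun_prop) fun y _ => ?_))
      exact neg_ne_zero.mp (slitPlane_ne_zero (hne y))
  have l1 : log ((x₀ : ℂ) + y₁ * I) - log (-((x₀ : ℂ) + y₁ * I)) = Real.pi * I := by
    simp only [log, norm_neg]
    rw [arg_neg_eq_arg_sub_pi_of_im_pos (by simpa using hy1)]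
    push_cast; ring
  have l2 : log ((x₀ : ℂ) + y₀ * I) - log (-((x₀ : ℂ) + y₀ * I)) = -(Real.pi * I) := by
    simp only [log, norm_neg]
    rw [arg_neg_eq_arg_add_pi_of_im_neg (by simpa using hy0)]
    push_cast; ring
  unfold rectInt
  rw [hor y₀ hy0.ne, hor y₁ hy1.ne', right, left]
  linear_combination l1 - l2

/-- Cauchy's integral formula on a rectangle. -/
theorem rectInt_div_sub {k : ℂ → ℂ} {U : Set ℂ} (hU : IsOpen U) (hk : DifferentiableOn ℂ k U)
    {x₀ x₁ y₀ y₁ : ℝ} {z₀ : ℂ} (hsub : Set.uIcc x₀ x₁ ×ℂ Set.uIcc y₀ y₁ ⊆ U)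
    (hx0 : x₀ < z₀.re) (hx1 : z₀.re < x₁) (hy0 : y₀ < z₀.im) (hy1 : z₀.im < y₁) :
    rectInt (fun z => k z / (z - z₀)) x₀ x₁ y₀ y₁ = 2 * Real.pi * I * k z₀ := by
  have hx : x₀ ≤ x₁ := (hx0.trans hx1).le
  have hy : y₀ ≤ y₁ := (hy0.trans hy1).le
  have hz₀ : z₀ ∈ U := hsub ⟨by simp [Set.uIcc_of_le hx, hx0.le, hx1.le],
    by simp [Set.uIcc_of_le hy, hy0.le, hy1.le]⟩
  have hd : DifferentiableOn ℂ (dslope k z₀) U :=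
    (differentiableOn_dslope (hU.mem_nhds hz₀)).mpr hk
  set B : Set ℂ := {z : ℂ | z.re ∈ Set.Icc x₀ x₁ ∧ z.im ∈ Set.Icc y₀ y₁ ∧
      (z.re = x₀ ∨ z.re = x₁ ∨ z.im = y₀ ∨ z.im = y₁)} with hB
  have hBne : ∀ z ∈ B, z - z₀ ≠ 0 := by
    rintro z ⟨-, -, h⟩ h0
    rw [sub_eq_zero.mp h0] at h
    rcases h with h | h | h | h <;> linarith
  have hBU : B ⊆ U := by
    rintro z ⟨h1, h2, -⟩
    exact hsub ⟨by simpa [Set.uIcc_of_le hx] using h1, by simpa [Set.uIcc_of_le hy] using h2⟩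
  have e : ∀ z ∈ B, k z / (z - z₀) = dslope k z₀ z + k z₀ * (z - z₀)⁻¹ := by
    intro z hz
    have := hBne z hz
    rw [dslope_of_ne _ (sub_ne_zero.mp this), slope_def_field]
    field_simp
    ring
  have hcong : rectInt (fun z => k z / (z - z₀)) x₀ x₁ y₀ y₁ =
      rectInt (fun z => dslope k z₀ z + k z₀ * (z - z₀)⁻¹) x₀ x₁ y₀ y₁ := by
    unfold rectInt
    congr 1
    · congr 1
      · congr 1
        · refine intervalIntegral.integral_congr fun t ht => e _ ?_
          rw [Set.uIcc_of_le hx] at ht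
          simp [hB, ht.1, ht.2, hy]
        · refine intervalIntegral.integral_congr fun t ht => e _ ?_
          rw [Set.uIcc_of_le hx] at ht
          simp [hB, ht.1, ht.2, hy]
      · congr 1
        refine intervalIntegral.integral_congr fun t ht => e _ ?_
        rw [Set.uIcc_of_le hy] at ht
        simp [hB, ht.1, ht.2, hx]
    · congr 1
      refine intervalIntegral.integral_congr fun t ht => e _ ?_
      rw [Set.uIcc_of_le hy] at ht
      simp [hB, ht.1, ht.2, hx]
  rw [hcong, rectInt_add (g := fun z => k z₀ * (z - z₀)⁻¹) hx hy (hd.continuousOn.mono hBU)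
    (continuousOn_const.mul (ContinuousOn.inv₀ (by fun_prop) hBne)),
    rectInt_eq_zero (hd.mono hsub), zero_add]
  have hinv := rectInt_inv (x₀ := x₀ - z₀.re) (x₁ := x₁ - z₀.re) (y₀ := y₀ - z₀.im)
    (y₁ := y₁ - z₀.im) (by linarith) (by linarith) (by linarith) (by linarith)
  rw [mul_comm, ← hinv]
  unfold rectInt
  simp only [intervalIntegral.integral_const_mul]
  have s1 : ∀ y : ℝ, ∫ x in x₀..x₁, ((x : ℂ) + y * I - z₀)⁻¹ =
      ∫ x in (x₀ - z₀.re)..(x₁ - z₀.re), ((x : ℂ) + (y - z₀.im : ℝ) * I)⁻¹ := by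
    intro y
    rw [← intervalIntegral.integral_comp_sub_right
      (fun x : ℝ => ((x : ℂ) + (y - z₀.im : ℝ) * I)⁻¹) z₀.re]
    congr 1; ext x; congr 1
    conv_lhs => rw [← re_add_im z₀]
    push_cast; ring
  have s2 : ∀ x : ℝ, ∫ y in y₀..y₁, ((x : ℂ) + y * I - z₀)⁻¹ =
      ∫ y in (y₀ - z₀.im)..(y₁ - z₀.im), (((x - z₀.re : ℝ) : ℂ) + y * I)⁻¹ := by
    intro x
    rw [← intervalIntegral.integral_comp_sub_right
      (fun y : ℝ => (((x - z₀.re : ℝ) : ℂ) + y * I)⁻¹) z₀.im]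
    congr 1; ext y; congr 1
    conv_lhs => rw [← re_add_im z₀]
    push_cast; ring
  rw [s1, s1, s2, s2]
  ring

/-- `e(z) = exp(2πiz)`. -/
noncomputable def ex (z : ℂ) : ℂ := cexp (2 * Real.pi * I * z)

lemma norm_ex (z : ℂ) : ‖ex z‖ = Real.exp (-(2 * Real.pi * z.im)) := by
  rw [ex, norm_exp]; congr 1; simp

lemma ex_add (z w : ℂ) : ex (z + w) = ex z * ex w := by
  simp only [ex, ← Complex.exp_add]; congr 1; ring

lemma ex_nat (n : ℕ) : ex n = 1 := by
  rw [ex, Complex.exp_eq_one_iff]; exact ⟨n, by push_cast; ring⟩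

lemma ex_natMul (n : ℕ) (z : ℂ) : ex (n * z) = ex z ^ n := by
  rw [ex, ex, ← Complex.exp_nat_mul]; congr 1; ring

lemma differentiable_ex : Differentiable ℂ ex := by
  unfold ex; fun_prop

@[fun_prop]
lemma continuous_ex : Continuous ex := differentiable_ex.continuous

lemma hasDerivAt_ex (z : ℂ) : HasDerivAt ex (2 * Real.pi * I * ex z) z := by
  have := ((hasDerivAt_id z).const_mul (2 * Real.pi * I : ℂ)).cexp
  simp only [mul_one, id] at this
  rw [mul_comm]; exact this

/-- The kernel with simple poles at the points `m + a`. -/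
noncomputable def kap (a : ℝ) (s w : ℂ) : ℂ := w ^ (-s) * (ex (w - a) / (ex (w - a) - 1))

/-- The half-line through `X` of slope one, starting at `X (1 - i) / 2`. -/
noncomputable def wL (X u : ℝ) : ℂ := (1 + I) * ((u : ℂ) + ((-X / 2 : ℝ) : ℂ) * I)

lemma wL_re (X u : ℝ) : (wL X u).re = u + X / 2 := by simp [wL]; ring

lemma wL_im (X u : ℝ) : (wL X u).im = u - X / 2 := by simp [wL]; ring

lemma rectInt_kap {a : ℝ} (ha : 0 < a) (s : ℂ) {K : ℕ} (hK : 1 ≤ K) {Y : ℝ}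
    (hY : xpt a K / 2 < Y) :
    rectInt (fun z => kap a s ((1 + I) * z) * (1 + I)) 0 Y (-mpt a (K + 1) / 2) (-mpt a K / 2) =
      (xpt a K : ℂ) ^ (-s) := by
  have hX := mpt_pos ha hK
  have hx := xpt_pos ha K
  have h1I : (1 + I : ℂ) ≠ 0 := by intro h; simpa using congrArg re h
  have hpi : (2 * Real.pi * I : ℂ) ≠ 0 := two_pi_I_ne_zero
  set z₀ : ℂ := (xpt a K / 2 : ℝ) * (1 - I) with hz₀
  have hwz : (1 + I) * z₀ = xpt a K := by
    have : (1 + I) * (1 - I) = (2 : ℂ) := by ring_nf; simp; norm_num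
    rw [hz₀, mul_left_comm, this]; push_cast; ring
  set D : ℂ → ℂ := fun z => ex ((1 + I) * z - a) - 1 with hD
  have hDd : ∀ z, HasDerivAt D (2 * Real.pi * I * ex ((1 + I) * z - a) * (1 + I)) z := by
    intro z
    have h1 : HasDerivAt (fun z : ℂ => (1 + I) * z - a) (1 + I) z := by
      simpa using ((hasDerivAt_id z).const_mul (1 + I)).sub_const (a : ℂ)
    exact ((hasDerivAt_ex _).comp z h1).sub_const 1
  have hexz : ex ((1 + I) * z₀ - a) = 1 := by
    rw [hwz, ← ex_nat K]; congr 1; simp [xpt]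
  have hDz : D z₀ = 0 := by simp only [hD, hexz, sub_self]
  have hDdiff : Differentiable ℂ D := fun z => (hDd z).differentiableAt
  have hds : Differentiable ℂ (dslope D z₀) := by
    have := (differentiableOn_dslope (f := D) (c := z₀) (s := Set.univ) univ_mem).mpr
      hDdiff.differentiableOn
    exact differentiableOn_univ.mp this
  have hds0 : dslope D z₀ z₀ = 2 * Real.pi * I * (1 + I) := by
    rw [dslope_same, (hDd z₀).deriv, hexz, mul_one]
  set U : Set ℂ := {z | 0 < ((1 + I) * z).re} ∩ {z | dslope D z₀ z ≠ 0} with hU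
  have hUo : IsOpen U := (isOpen_lt continuous_const (by fun_prop)).inter
    (isOpen_ne_fun hds.continuous continuous_const)
  set k : ℂ → ℂ := fun z => ((1 + I) * z) ^ (-s) * ex ((1 + I) * z - a) * (1 + I) / dslope D z₀ z
    with hk
  have hkd : DifferentiableOn ℂ k U := by
    intro z hz
    refine DifferentiableAt.differentiableWithinAt ?_
    refine DifferentiableAt.div (DifferentiableAt.mul (DifferentiableAt.mul ?_ ?_) (by fun_prop))
      (hds z) hz.2
    · exact DifferentiableAt.cpow_const (by fun_prop) (Or.inl hz.1)
    · exact (differentiable_ex _).comp z (by fun_prop)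
  have hfun : (fun z => kap a s ((1 + I) * z) * (1 + I)) = fun z => k z / (z - z₀) := by
    ext z
    by_cases hz : z = z₀
    · rw [hz]; simp [kap, hexz]
    · have hzz : z - z₀ ≠ 0 := sub_ne_zero.mpr hz
      simp only [hk, kap]
      rw [dslope_of_ne _ hz, slope_def_field, hDz, sub_zero, div_div, div_mul_cancel₀ _ hzz]
      simp only [hD]; ring
  have hmm : mpt a (K + 1) = mpt a K + 1 := by unfold mpt; push_cast; ring
  have hxm : xpt a K = mpt a K + 1 / 2 := by unfold mpt xpt; ring
  have hre : z₀.re = xpt a K / 2 := by simp [hz₀]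
  have him : z₀.im = -(xpt a K / 2) := by simp [hz₀]
  have hsub : Set.uIcc 0 Y ×ℂ Set.uIcc (-mpt a (K + 1) / 2) (-mpt a K / 2) ⊆ U := by
    rintro z ⟨h1, h2⟩
    rw [Set.uIcc_of_le (by linarith)] at h1
    rw [Set.uIcc_of_le (by linarith)] at h2
    simp only [Set.mem_preimage, Set.mem_Icc] at h1 h2
    refine ⟨by simp; linarith, ?_⟩
    by_cases hz : z = z₀
    · simp only [hz, Set.mem_ofPred_eq, hds0]
      exact mul_ne_zero hpi h1I
    · simp only [Set.mem_ofPred_eq]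
      rw [dslope_of_ne _ hz, slope_def_field, hDz, sub_zero]
      refine div_ne_zero ?_ (sub_ne_zero.mpr hz)
      intro h0
      have h3 : ex ((1 + I) * z - a) = 1 := sub_eq_zero.mp h0
      obtain ⟨n, hn⟩ := Complex.exp_eq_one_iff.mp h3
      have h4 : (1 + I) * z - a = n := by
        have : (2 * Real.pi * I : ℂ) * ((1 + I) * z - a) = 2 * Real.pi * I * n := by
          rw [hn]; ring
        exact mul_left_cancel₀ hpi this
      have h5 := congrArg re h4
      have h6 := congrArg im h4
      simp at h5 h6
      have h7 : (n : ℝ) + a = -2 * z.im := by linarith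
      have h8 : (n : ℝ) < (K : ℝ) + 1 := by unfold mpt at *; linarith
      have h9 : (K : ℝ) - 1 < (n : ℝ) := by unfold mpt at *; linarith
      have h10 : n = (K : ℤ) := by
        have a1 : n < (K : ℤ) + 1 := by exact_mod_cast h8
        have a2 : (K : ℤ) - 1 < n := by exact_mod_cast h9
        omega
      apply hz
      have h11 : (n : ℝ) = K := by rw [h10]; simp
      apply Complex.ext
      · rw [hre]; unfold xpt; linarith
      · rw [him]; unfold xpt; linarith
  rw [hfun, rectInt_div_sub hUo hkd hsub (by rw [hre]; linarith) (by rw [hre]; exact hY)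
    (by rw [him]; linarith) (by rw [him]; linarith)]
  simp only [hk]
  rw [hds0, hexz, hwz]
  field_simp

lemma wL_sub_ex {a : ℝ} (K : ℕ) (u : ℝ) : ex (wL (mpt a K) u - a) =
    -(Real.exp (-(2 * Real.pi * (u - mpt a K / 2))) *
      cexp ((2 * Real.pi * (u - mpt a K / 2) : ℝ) * I)) := by
  have h : wL (mpt a K) u - a = (K : ℂ) + (-1 / 2 + (1 + I) * ((u - mpt a K / 2 : ℝ) : ℂ)) := by
    simp only [wL, mpt]; push_cast; ring_nf; simp; ring
  have h2 : ex (-1 / 2) = -1 := by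
    rw [ex, show (2 * Real.pi * I * (-1 / 2) : ℂ) = -(Real.pi * I) by ring, Complex.exp_neg,
      Complex.exp_pi_mul_I]; norm_num
  rw [h, ex_add, ex_nat, one_mul, ex_add, h2, ex, ofReal_exp, ← Complex.exp_add, neg_one_mul]
  congr 2
  push_cast; ring_nf; simp; ring

lemma ex_sub_one_lower {a : ℝ} (K : ℕ) (u : ℝ) :
    1 / 2 ≤ ‖ex (wL (mpt a K) u - a) - 1‖ ∧
    Real.exp (-(2 * Real.pi * (u - mpt a K / 2))) / 2 ≤ ‖ex (wL (mpt a K) u - a) - 1‖ := by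
  rw [wL_sub_ex]
  set d := u - mpt a K / 2
  have hn : ‖-(Real.exp (-(2 * Real.pi * d)) * cexp ((2 * Real.pi * d : ℝ) * I)) - 1‖ =
      ‖1 + Real.exp (-(2 * Real.pi * d)) * cexp ((2 * Real.pi * d : ℝ) * I)‖ := by
    rw [← norm_neg]; congr 1; ring
  rw [hn]
  set E := Real.exp (-(2 * Real.pi * d)) with hE
  have hE0 : 0 < E := Real.exp_pos _
  have hnE : ‖(E : ℂ) * cexp ((2 * Real.pi * d : ℝ) * I)‖ = E := by
    rw [norm_mul, norm_exp_ofReal_mul_I, mul_one, norm_real, Real.norm_of_nonneg hE0.le]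
  have hpi := Real.pi_gt_three
  rcases le_total |d| (1 / 4) with hd | hd
  · have hcos : 0 ≤ Real.cos (2 * Real.pi * d) := by
      rw [abs_le] at hd
      apply Real.cos_nonneg_of_neg_pi_div_two_le_of_le <;> nlinarith
    have hsq : ‖1 + (E : ℂ) * cexp ((2 * Real.pi * d : ℝ) * I)‖ ^ 2 =
        1 + 2 * E * Real.cos (2 * Real.pi * d) + E ^ 2 := by
      rw [Complex.sq_norm, normSq_apply]
      simp only [add_re, one_re, re_ofReal_mul, exp_ofReal_mul_I_re, add_im, one_im, zero_add,
        im_ofReal_mul, exp_ofReal_mul_I_im]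
      have := Real.sin_sq_add_cos_sq (2 * Real.pi * d)
      linear_combination E ^ 2 * this
    have hn0 := norm_nonneg (1 + (E : ℂ) * cexp ((2 * Real.pi * d : ℝ) * I))
    have : 0 ≤ E * Real.cos (2 * Real.pi * d) := mul_nonneg hE0.le hcos
    constructor
    · nlinarith
    · nlinarith
  · have h1 := norm_sub_norm_le (1 : ℂ) (-((E : ℂ) * cexp ((2 * Real.pi * d : ℝ) * I)))
    have h2 := norm_sub_norm_le ((E : ℂ) * cexp ((2 * Real.pi * d : ℝ) * I)) (-1 : ℂ)
    rw [norm_neg, hnE, norm_one, sub_neg_eq_add] at h1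
    rw [norm_neg, hnE, norm_one, sub_neg_eq_add, add_comm _ (1 : ℂ)] at h2
    rcases le_abs'.mp hd with h | h
    · have : 2 ≤ E := by
        have := Real.add_one_le_exp (-(2 * Real.pi * d))
        nlinarith
      constructor <;> linarith
    · have : E ≤ 1 / 2 := by
        have h3 : (2 : ℝ) ≤ Real.exp (2 * Real.pi * d) := by
          have := Real.add_one_le_exp (2 * Real.pi * d)
          nlinarith
        rw [hE, Real.exp_neg, inv_eq_one_div]
        exact one_div_le_one_div_of_le (by norm_num) h3
      constructor <;> linarith

lemma arg_le_div {w : ℂ} (hw : 0 < w.re) : arg w = Real.arctan (w.im / w.re) := by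
  rw [← tan_arg, Real.arctan_tan]
  · exact (abs_lt.mp (abs_arg_lt_pi_div_two_iff.mpr (Or.inl hw))).1
  · exact (abs_lt.mp (abs_arg_lt_pi_div_two_iff.mpr (Or.inl hw))).2

lemma norm_cpow_neg {w : ℂ} (hw : w ≠ 0) (s : ℂ) :
    ‖w ^ (-s)‖ = ‖w‖ ^ (-s.re) * Real.exp (s.im * arg w) := by
  rw [norm_cpow_of_ne_zero hw, neg_re, neg_im, div_eq_mul_inv, ← Real.exp_neg]
  congr 2; ring

lemma norm_cpow_neg_le {w : ℂ} {A : ℝ} (hA : 0 < A) (hw : A ≤ w.re) {s : ℂ} (hs : 0 ≤ s.re) :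
    ‖w ^ (-s)‖ ≤ A ^ (-s.re) * Real.exp (s.im * arg w) := by
  have hwn : A ≤ ‖w‖ := hw.trans (re_le_norm w)
  rw [norm_cpow_neg (by rintro rfl; simp at hw; linarith)]
  gcongr ?_ * _
  exact Real.rpow_le_rpow_of_nonpos hA hwn (by linarith)

lemma arctan_le_self {x : ℝ} (hx : 0 ≤ x) : Real.arctan x ≤ x := by
  simpa [Real.tan_arctan] using
    Real.le_tan (Real.arctan_nonneg.mpr hx) (Real.arctan_lt_pi_div_two x)

lemma exp_mul_arg_le {w : ℂ} {t : ℝ} (ht : 0 ≤ t) :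
    Real.exp (t * arg w) ≤ Real.exp (t * Real.pi) := by
  have := arg_le_pi w
  gcongr

lemma wL_mem_slitPlane {X u : ℝ} (hX : 0 < X) (hu : 0 ≤ u) : wL X u ∈ slitPlane :=
  Or.inl (by rw [wL_re]; linarith)

@[fun_prop]
lemma continuous_wL (X : ℝ) : Continuous (wL X) := by unfold wL; fun_prop

lemma norm_cpow_wL_le {X u : ℝ} (hX : 0 < X) (hu : 0 ≤ u) {s : ℂ} (hs : 0 ≤ s.re) :
    ‖wL X u ^ (-s)‖ ≤ (X / 2) ^ (-s.re) * Real.exp (s.im * arg (wL X u)) :=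
  norm_cpow_neg_le (by positivity) (by rw [wL_re]; linarith) hs

lemma continuousOn_cpow_wL {X : ℝ} (hX : 0 < X) (s : ℂ) :
    ContinuousOn (fun u : ℝ => wL X u ^ s) (Set.Ici 0) :=
  ContinuousOn.cpow_const (by fun_prop) fun _ hu => wL_mem_slitPlane hX hu

lemma ex_wL_ne (a : ℝ) (K : ℕ) (u : ℝ) : ex (wL (mpt a K) u - a) - 1 ≠ 0 := by
  have := (ex_sub_one_lower (a := a) K u).1
  exact norm_pos_iff.mp (by linarith)

lemma norm_ex_wL (a : ℝ) (K : ℕ) (u : ℝ) : ‖ex (wL (mpt a K) u - a)‖ =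
    Real.exp (-(2 * Real.pi * (u - mpt a K / 2))) := by
  rw [norm_ex]; simp [wL_im]

lemma norm_ex_div_le (a : ℝ) (K : ℕ) (u : ℝ) :
    ‖ex (wL (mpt a K) u - a) / (ex (wL (mpt a K) u - a) - 1)‖ ≤
      2 * Real.exp (-(2 * Real.pi * (u - mpt a K / 2))) := by
  rw [norm_div, norm_ex_wL, div_le_iff₀ (by have := (ex_sub_one_lower (a := a) K u).1; linarith)]
  have := (ex_sub_one_lower (a := a) K u).1
  have h2 := Real.exp_pos (-(2 * Real.pi * (u - mpt a K / 2)))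
  nlinarith

lemma norm_inv_ex_le (a : ℝ) (K : ℕ) (u : ℝ) :
    ‖(ex (wL (mpt a K) u - a) - 1)⁻¹‖ ≤ 2 * Real.exp (2 * Real.pi * (u - mpt a K / 2)) := by
  rw [norm_inv, inv_eq_one_div,
    div_le_iff₀ (by have := (ex_sub_one_lower (a := a) K u).1; linarith)]
  have := (ex_sub_one_lower (a := a) K u).2
  have h2 := Real.exp_pos ((2 * Real.pi * (u - mpt a K / 2)))
  rw [Real.exp_neg] at this
  calc (1 : ℝ) = 2 * Real.exp (2 * Real.pi * (u - mpt a K / 2)) *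
        ((Real.exp (2 * Real.pi * (u - mpt a K / 2)))⁻¹ / 2) := by field_simp
    _ ≤ _ := by gcongr

lemma continuousOn_kap_wL {a : ℝ} (ha : 0 < a) (s : ℂ) {K : ℕ} (hK : 1 ≤ K) :
    ContinuousOn (fun u : ℝ => kap a s (wL (mpt a K) u) * (1 + I)) (Set.Ici 0) := by
  unfold kap
  refine ContinuousOn.mul (ContinuousOn.mul (continuousOn_cpow_wL (mpt_pos ha hK) _)
    (ContinuousOn.div (by fun_prop) (by fun_prop) fun u _ => ex_wL_ne a K u)) (by fun_prop)

lemma integrableOn_exp_lin (b c d : ℝ) (hc : 0 < c) :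
    IntegrableOn (fun u : ℝ => d * Real.exp (-(c * (u - b)))) (Set.Ioi 0) := by
  have h := (integrableOn_exp_mul_Ioi (a := -c) (by linarith) 0).const_mul (d * Real.exp (c * b))
  refine IntegrableOn.congr_fun h (fun u _ => ?_) measurableSet_Ioi
  rw [mul_assoc, ← Real.exp_add]; congr 2; ring

lemma norm_one_add_I_le : ‖(1 + I : ℂ)‖ ≤ 2 := by
  refine (norm_add_le _ _).trans ?_
  rw [norm_one, norm_I]; norm_num

lemma integrableOn_kap_wL {a : ℝ} (ha : 0 < a) {s : ℂ} (hs : 0 ≤ s.re) (ht : 0 ≤ s.im) {K : ℕ}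
    (hK : 1 ≤ K) :
    IntegrableOn (fun u : ℝ => kap a s (wL (mpt a K) u) * (1 + I)) (Set.Ioi 0) := by
  have hX := mpt_pos ha hK
  refine Integrable.mono' (integrableOn_exp_lin (mpt a K / 2) (2 * Real.pi)
    ((mpt a K / 2) ^ (-s.re) * Real.exp (s.im * Real.pi) * 2 * 2) (by positivity))
    ((continuousOn_kap_wL ha s hK).mono Set.Ioi_subset_Ici_self |>.aestronglyMeasurable
      measurableSet_Ioi) ?_
  refine (ae_restrict_iff' measurableSet_Ioi).mpr (ae_of_all _ fun u hu => ?_)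
  have hu : 0 < u := hu
  rw [norm_mul, kap, norm_mul]
  have h1 := (norm_cpow_wL_le hX hu.le hs).trans
    (mul_le_mul_of_nonneg_left (exp_mul_arg_le (w := wL (mpt a K) u) ht) (by positivity))
  have h2 := norm_ex_div_le a K u
  calc _ ≤ ((mpt a K / 2) ^ (-s.re) * Real.exp (s.im * Real.pi)) *
        (2 * Real.exp (-(2 * Real.pi * (u - mpt a K / 2)))) * 2 := by
        gcongr; exact norm_one_add_I_le
    _ = _ := by ring

lemma kap_right_tendsto {a : ℝ} {s : ℂ} (hs : 0 ≤ s.re) (ht : 0 ≤ s.im)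
    {y₀ y₁ : ℝ} (hy : y₀ ≤ y₁) (hy1 : y₁ < 0) :
    Tendsto (fun Y : ℝ => ∫ y in y₀..y₁, kap a s ((1 + I) * ((Y : ℂ) + y * I)) * (1 + I)) atTop
      (nhds 0) := by
  have hlim : Tendsto (fun Y : ℝ => (-y₁) ^ (-s.re) * Real.exp (s.im * Real.pi) *
      (2 * Real.exp (-(2 * Real.pi * (Y + y₀)))) * 2 * |y₁ - y₀|) atTop (nhds 0) := by
    have h1 : Tendsto (fun Y : ℝ => Real.exp (-(2 * Real.pi * (Y + y₀)))) atTop (nhds 0) := by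
      refine Real.tendsto_exp_neg_atTop_nhds_zero.comp ?_
      exact (tendsto_atTop_add_const_right _ _ tendsto_id).const_mul_atTop (by positivity)
    have := (((h1.const_mul 2).const_mul ((-y₁) ^ (-s.re) * Real.exp (s.im * Real.pi))).mul_const
      2).mul_const (|y₁ - y₀|)
    simpa using this
  refine squeeze_zero_norm' ?_ hlim
  filter_upwards [eventually_ge_atTop (1 - y₀), eventually_ge_atTop 0] with Y hY hY0
  refine intervalIntegral.norm_integral_le_of_norm_le_const fun y hyy => ?_
  rw [Set.uIoc_of_le hy] at hyy
  have hre : ((1 + I) * ((Y : ℂ) + y * I)).re = Y - y := by simp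
  have him : ((1 + I) * ((Y : ℂ) + y * I)).im = Y + y := by simp; ring
  have hnex : ‖ex ((1 + I) * ((Y : ℂ) + y * I) - a)‖ = Real.exp (-(2 * Real.pi * (Y + y))) := by
    rw [norm_ex]; congr 2; rw [sub_im, him, ofReal_im, sub_zero]
  have hpi := Real.pi_gt_three
  have hle : Real.exp (-(2 * Real.pi * (Y + y))) ≤ Real.exp (-(2 * Real.pi * (Y + y₀))) := by
    rw [Real.exp_le_exp]; nlinarith [hyy.1]
  have hhalf : Real.exp (-(2 * Real.pi * (Y + y₀))) ≤ 1 / 2 := by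
    rw [Real.exp_neg, inv_eq_one_div]
    refine one_div_le_one_div_of_le (by norm_num) ?_
    have := Real.add_one_le_exp (2 * Real.pi * (Y + y₀))
    nlinarith
  have hden : 1 / 2 ≤ ‖ex ((1 + I) * ((Y : ℂ) + y * I) - a) - 1‖ := by
    have := norm_sub_norm_le (1 : ℂ) (ex ((1 + I) * ((Y : ℂ) + y * I) - a))
    rw [norm_sub_rev, norm_one, hnex] at this
    linarith
  have h1 : ‖((1 + I) * ((Y : ℂ) + y * I)) ^ (-s)‖ ≤ (-y₁) ^ (-s.re) * Real.exp (s.im * Real.pi) :=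
    (norm_cpow_neg_le (by linarith) (by rw [hre]; linarith [hyy.2]) hs).trans
      (mul_le_mul_of_nonneg_left (exp_mul_arg_le ht) (Real.rpow_nonneg (by linarith) _))
  rw [norm_mul, kap, norm_mul, norm_div, hnex]
  have hy1' : 0 ≤ (-y₁) ^ (-s.re) := Real.rpow_nonneg (by linarith) _
  gcongr
  · rw [div_le_iff₀ (by linarith)]
    have := Real.exp_pos (-(2 * Real.pi * (Y + y₀)))
    nlinarith
  · exact norm_one_add_I_le

/-- The integral of the kernel along the half-line through the midpoint `K + a - 1/2`. -/
noncomputable def wInt (a : ℝ) (s : ℂ) (K : ℕ) : ℂ :=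
  ∫ u in Set.Ioi (0 : ℝ), kap a s (wL (mpt a K) u) * (1 + I)

lemma wInt_succ {a : ℝ} (ha : 0 < a) {s : ℂ} (hs : 0 ≤ s.re) (ht : 0 ≤ s.im) {K : ℕ}
    (hK : 1 ≤ K) : wInt a s (K + 1) - wInt a s K +
      (1 - I) * (∫ v in (mpt a K / 2)..(mpt a (K + 1) / 2), kap a s ((1 - I) * v)) =
      (xpt a K : ℂ) ^ (-s) := by
  have hX := mpt_pos ha hK
  have hmm : mpt a (K + 1) = mpt a K + 1 := by unfold mpt; push_cast; ring
  have hlim : ∀ {K : ℕ}, 1 ≤ K → Tendsto (fun Y : ℝ => ∫ x in (0 : ℝ)..Y,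
      kap a s ((1 + I) * ((x : ℂ) + ((-mpt a K / 2 : ℝ) : ℂ) * I)) * (1 + I)) atTop
      (nhds (wInt a s K)) := fun {K} hK =>
    intervalIntegral_tendsto_integral_Ioi 0 (integrableOn_kap_wL ha hs ht hK) tendsto_id
  have hR := (((hlim (K := K + 1) (by omega)).sub (hlim hK)).add
    ((kap_right_tendsto (a := a) (y₀ := -mpt a (K + 1) / 2) (y₁ := -mpt a K / 2) hs ht
      (by linarith) (by linarith)).const_mul I)).sub_const
    (I * ∫ y in (-mpt a (K + 1) / 2)..(-mpt a K / 2),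
      kap a s ((1 + I) * (((0 : ℝ) : ℂ) + y * I)) * (1 + I))
  have hc : Tendsto (fun Y : ℝ => rectInt (fun z => kap a s ((1 + I) * z) * (1 + I)) 0 Y
      (-mpt a (K + 1) / 2) (-mpt a K / 2)) atTop (nhds ((xpt a K : ℂ) ^ (-s))) := by
    refine tendsto_const_nhds.congr' ?_
    filter_upwards [eventually_gt_atTop (xpt a K / 2)] with Y hY
    exact (rectInt_kap ha s hK hY).symm
  have := tendsto_nhds_unique hc hR
  rw [this]
  have e : (∫ y in (-mpt a (K + 1) / 2)..(-mpt a K / 2),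
      kap a s ((1 + I) * (((0 : ℝ) : ℂ) + y * I)) * (1 + I)) =
      (1 + I) * ∫ v in (mpt a K / 2)..(mpt a (K + 1) / 2), kap a s ((1 - I) * v) := by
    rw [neg_div, neg_div, ← intervalIntegral.integral_comp_neg, intervalIntegral.integral_mul_const,
      mul_comm]
    congr 1
    refine intervalIntegral.integral_congr fun v _ => ?_
    congr 1
    push_cast; ring_nf; simp
  rw [e]
  ring_nf; simp

/-- The integrand along the ray of argument `-π/4`. -/
noncomputable def rayf (a : ℝ) (s : ℂ) (v : ℝ) : ℂ :=
  ((1 - I) * v) ^ (-s) * (ex ((1 - I) * v - a) - 1)⁻¹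

lemma ray_mem_slitPlane {v : ℝ} (hv : 0 < v) : (1 - I) * (v : ℂ) ∈ slitPlane :=
  Or.inl (by simpa using hv)

lemma arg_one_sub_I_mul {v : ℝ} (hv : 0 < v) : arg ((1 - I) * v) = -(Real.pi / 4) := by
  rw [arg_le_div (by simpa using hv)]
  have : ((1 - I) * (v : ℂ)).im / ((1 - I) * (v : ℂ)).re = -1 := by
    simp [hv.ne']
  rw [this, Real.arctan_neg, Real.arctan_one]

lemma norm_ex_ray (a v : ℝ) : ‖ex ((1 - I) * v - a)‖ = Real.exp (2 * Real.pi * v) := by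
  rw [norm_ex]; simp

lemma ex_ray_ne {a v : ℝ} (hv : 0 < v) : ex ((1 - I) * v - a) - 1 ≠ 0 := by
  intro h
  have h1 := norm_ex_ray a v
  rw [sub_eq_zero.mp h, norm_one] at h1
  have h2 := Real.add_one_lt_exp (x := 2 * Real.pi * v) (by positivity)
  have : 0 < 2 * Real.pi * v := by positivity
  linarith

lemma norm_cpow_ray_le {v : ℝ} (hv : 0 < v) {s : ℂ} (hs : 0 ≤ s.re) :
    ‖((1 - I) * (v : ℂ)) ^ (-s)‖ ≤ v ^ (-s.re) * Real.exp (-(Real.pi / 4) * s.im) := by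
  refine (norm_cpow_neg_le hv (by simp) hs).trans (le_of_eq ?_)
  rw [arg_one_sub_I_mul hv, mul_comm s.im]

lemma norm_rayf_le {a v : ℝ} (hv : 1 / 4 ≤ v) {s : ℂ} (hs : 0 ≤ s.re) :
    ‖rayf a s v‖ ≤ v ^ (-s.re) * Real.exp (-(Real.pi / 4) * s.im) *
      (2 * Real.exp (-(2 * Real.pi * v))) := by
  have hv0 : 0 < v := by linarith
  rw [rayf, norm_mul]
  gcongr
  · exact norm_cpow_ray_le hv0 hs
  · have h1 := norm_sub_norm_le (ex ((1 - I) * v - a)) 1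
    rw [norm_ex_ray, norm_one] at h1
    have h2 := Real.add_one_le_exp (2 * Real.pi * v)
    have hpi := Real.pi_gt_three
    have h3 : 2 ≤ Real.exp (2 * Real.pi * v) := by nlinarith
    rw [norm_inv, Real.exp_neg, inv_eq_one_div, ← div_eq_mul_inv,
      div_le_div_iff₀ (by linarith) (by linarith)]
    linarith

lemma continuousOn_rayf {a : ℝ} (s : ℂ) : ContinuousOn (rayf a s) (Set.Ioi 0) := by
  unfold rayf
  refine ContinuousOn.mul (ContinuousOn.cpow_const (by fun_prop) fun v hv => ray_mem_slitPlane hv)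
    (ContinuousOn.inv₀ (by fun_prop) fun v hv => ex_ray_ne hv)

lemma integrableOn_rayf {a c : ℝ} (hc : 1 / 4 ≤ c) {s : ℂ} (hs : 0 ≤ s.re) :
    IntegrableOn (rayf a s) (Set.Ioi c) := by
  have hc0 : 0 < c := by linarith
  refine Integrable.mono' ((integrableOn_exp_lin 0 (2 * Real.pi)
    (c ^ (-s.re) * Real.exp (-(Real.pi / 4) * s.im) * 2) (by positivity)).mono_set
    (Set.Ioi_subset_Ioi hc0.le))
    ((continuousOn_rayf s).mono (Set.Ioi_subset_Ioi hc0.le) |>.aestronglyMeasurable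
      measurableSet_Ioi) ?_
  refine (ae_restrict_iff' measurableSet_Ioi).mpr (ae_of_all _ fun v hv => ?_)
  have hv : c < v := hv
  refine (norm_rayf_le (by linarith) hs).trans ?_
  rw [sub_zero, mul_assoc _ 2]
  gcongr ?_ * _ * _
  exact Real.rpow_le_rpow_of_nonpos hc0 hv.le (by linarith)

lemma kap_ray {a v : ℝ} (hv : 0 < v) (s : ℂ) :
    kap a s ((1 - I) * v) = ((1 - I) * (v : ℂ)) ^ (-s) + rayf a s v := by
  have := ex_ray_ne (a := a) hv
  rw [kap, rayf]
  field_simp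
  ring

lemma integral_cpow_segment {b c : ℂ} {x₀ x₁ : ℝ} (hx : x₀ ≤ x₁) {s : ℂ} (hs1 : s ≠ 1)
    (h : ∀ x : ℝ, x₀ ≤ x → x ≤ x₁ → b + c * x ∈ slitPlane) :
    c * (∫ x in x₀..x₁, (b + c * x) ^ (-s)) =
      ((b + c * x₁) ^ (1 - s) - (b + c * x₀) ^ (1 - s)) / (1 - s) := by
  have hs : (1 : ℂ) - s ≠ 0 := sub_ne_zero.mpr hs1.symm
  rw [← intervalIntegral.integral_const_mul, sub_div]
  refine intervalIntegral.integral_eq_sub_of_hasDerivAt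
    (f := fun x : ℝ => (b + c * x) ^ (1 - s) / (1 - s)) (fun x hx' => ?_) ?_
  · rw [Set.uIcc_of_le hx] at hx'
    have h1 : HasDerivAt (fun z : ℂ => (b + c * z) ^ (1 - s) / (1 - s))
        ((1 - s) * (b + c * x) ^ (1 - s - 1) * c / (1 - s)) (x : ℂ) := by
      have h2 : HasDerivAt (fun z : ℂ => b + c * z) c (x : ℂ) := by
        simpa using ((hasDerivAt_id (x : ℂ)).const_mul c).const_add b
      exact (h2.cpow_const (h x hx'.1 hx'.2)).div_const _
    have h3 := h1.comp_ofReal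
    have e : (1 - s) * (b + c * x) ^ (1 - s - 1) * c / (1 - s) = c * (b + c * x) ^ (-s) := by
      rw [show 1 - s - 1 = -s by ring]
      field_simp
    rwa [e] at h3
  · refine ContinuousOn.intervalIntegrable (continuousOn_const.mul
      (ContinuousOn.cpow_const (by fun_prop) fun x hx' => ?_))
    rw [Set.uIcc_of_le hx] at hx'
    exact h x hx'.1 hx'.2

lemma mpt_half_ge {a : ℝ} (ha : 0 < a) {K : ℕ} (hK : 1 ≤ K) : 1 / 4 ≤ mpt a K / 2 := by
  have : (1 : ℝ) ≤ K := by exact_mod_cast hK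
  unfold mpt; linarith

lemma mpt_mono {a : ℝ} {K N : ℕ} (h : K ≤ N) : mpt a K ≤ mpt a N := by
  have : (K : ℝ) ≤ N := by exact_mod_cast h
  unfold mpt; linarith

lemma sum_xpt_contour {a : ℝ} (ha : 0 < a) {s : ℂ} (hs : 0 ≤ s.re) (ht : 0 ≤ s.im) (hs1 : s ≠ 1)
    {K : ℕ} (hK : 1 ≤ K) (n : ℕ) :
    ∑ m ∈ range n, (xpt a (K + m) : ℂ) ^ (-s) = wInt a s (K + n) - wInt a s K
      + (((1 - I) * ((mpt a (K + n) / 2 : ℝ) : ℂ)) ^ (1 - s)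
        - ((1 - I) * ((mpt a K / 2 : ℝ) : ℂ)) ^ (1 - s)) / (1 - s)
      + (1 - I) * ∫ v in (mpt a K / 2)..(mpt a (K + n) / 2), rayf a s v := by
  induction n with
  | zero => simp
  | succ n ih =>
    rw [sum_range_succ, ih, ← wInt_succ ha hs ht (K := K + n) (by omega)]
    have hKn := mpt_half_ge ha hK
    have h1 : mpt a K / 2 ≤ mpt a (K + n) / 2 := by have := mpt_mono (a := a) (show K ≤ K + n by omega); linarith
    have h2 : mpt a (K + n) / 2 ≤ mpt a (K + n + 1) / 2 := by
      have := mpt_mono (a := a) (show K + n ≤ K + n + 1 by omega); linarith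
    have hint : ∀ {x y : ℝ}, 1 / 4 ≤ x → x ≤ y → IntervalIntegrable (rayf a s) volume x y := by
      intro x y hx hxy
      refine ((continuousOn_rayf s).mono ?_).intervalIntegrable
      rw [Set.uIcc_of_le hxy]
      intro z hz
      exact lt_of_lt_of_le (by linarith) hz.1
    rw [show K + (n + 1) = K + n + 1 from rfl, ← intervalIntegral.integral_add_adjacent_intervals (hint hKn h1)
      (hint (hKn.trans h1) h2)]
    have h3 : (∫ v in (mpt a (K + n) / 2)..(mpt a (K + n + 1) / 2), kap a s ((1 - I) * v)) =
        (∫ v in (mpt a (K + n) / 2)..(mpt a (K + n + 1) / 2), (0 + (1 - I) * (v : ℂ)) ^ (-s)) +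
        ∫ v in (mpt a (K + n) / 2)..(mpt a (K + n + 1) / 2), rayf a s v := by
      rw [← intervalIntegral.integral_add _ (hint (hKn.trans h1) h2)]
      · refine intervalIntegral.integral_congr fun v hv => ?_
        rw [Set.uIcc_of_le h2] at hv
        simp only [zero_add]
        exact kap_ray (by linarith [hv.1]) s
      · refine ContinuousOn.intervalIntegrable
          (ContinuousOn.cpow_const (by fun_prop) fun v hv => ?_)
        rw [Set.uIcc_of_le h2] at hv
        rw [zero_add]; exact ray_mem_slitPlane (by linarith [hv.1])
    have h4 := integral_cpow_segment (b := 0) (c := 1 - I) h2 hs1 (fun v hv _ => by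
        rw [zero_add]; exact ray_mem_slitPlane (by linarith))
    rw [h3, mul_add, h4]
    simp only [zero_add]
    ring

lemma wL_eq_affine (X u : ℝ) : wL X u = (1 - I) * ((X / 2 : ℝ) : ℂ) + (1 + I) * u := by
  unfold wL; push_cast; ring_nf; simp; ring

lemma exp_integral_Ioi_le (c b : ℝ) (hc : 0 < c) :
    ∫ u in Set.Ioi b, Real.exp (-(c * (u - b))) = c⁻¹ := by
  have h := integral_exp_mul_Ioi (neg_lt_zero.mpr hc) b
  have e : ∀ u : ℝ, Real.exp (-(c * (u - b))) = Real.exp (c * b) * Real.exp (-c * u) := by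
    intro u; rw [← Real.exp_add]; congr 1; ring
  simp_rw [e]
  rw [integral_const_mul, h]
  have : Real.exp (c * b) * Real.exp (-c * b) = 1 := by
    rw [← Real.exp_add]; simp
  rw [neg_div_neg_eq, ← mul_div_assoc, this, one_div]

lemma wL_half (X : ℝ) : wL X (X / 2) = X := by
  apply Complex.ext
  · rw [wL_re]; simp
  · rw [wL_im]; simp

lemma wL_zero (X : ℝ) : wL X 0 = (1 - I) * ((X / 2 : ℝ) : ℂ) := by
  rw [wL_eq_affine]; simp

lemma arg_wL_nonpos {X u : ℝ} (hX : 0 < X) (hu : 0 ≤ u) (hu1 : u ≤ X / 2) :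
    arg (wL X u) ≤ 0 := by
  rw [arg_le_div (by rw [wL_re]; linarith), ← Real.arctan_zero]
  refine Real.arctan_strictMono.monotone ?_
  rw [wL_im, wL_re]
  exact div_nonpos_of_nonpos_of_nonneg (by linarith) (by linarith)

lemma arg_wL_le {X u : ℝ} (hX : 0 < X) (hu1 : X / 2 ≤ u) :
    arg (wL X u) ≤ (u - X / 2) / X := by
  rw [arg_le_div (by rw [wL_re]; linarith), wL_im, wL_re]
  refine (arctan_le_self (div_nonneg (by linarith) (by linarith))).trans ?_
  exact div_le_div_of_nonneg_left (by linarith) hX (by linarith)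

lemma norm_wInt_sub_le {a : ℝ} (ha : 0 < a) {s : ℂ} (hs : 0 ≤ s.re) (ht : 0 ≤ s.im) (hs1 : s ≠ 1)
    {K : ℕ} (hK : 1 ≤ K) (htX : s.im ≤ Real.pi * mpt a K) :
    ‖wInt a s K - ((mpt a K : ℂ) ^ (1 - s)
      - ((1 - I) * ((mpt a K / 2 : ℝ) : ℂ)) ^ (1 - s)) / (1 - s)‖ ≤
      2 * (mpt a K / 2) ^ (-s.re) := by
  have hX := mpt_pos ha hK
  have hi := integrableOn_kap_wL ha hs ht hK
  have hc := continuousOn_kap_wL ha s hK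
  set X := mpt a K with hXdef
  have hh : 0 < X / 2 := by linarith
  have hA : 0 < (X / 2) ^ (-s.re) := Real.rpow_pos_of_pos hh _
  have hii : IntervalIntegrable (fun u : ℝ => kap a s (wL X u) * (1 + I)) volume 0 (X / 2) := by
    refine (hc.mono ?_).intervalIntegrable
    rw [Set.uIcc_of_le hh.le]; exact Set.Icc_subset_Ici_self
  have hpow : IntervalIntegrable (fun u : ℝ => wL X u ^ (-s) * (1 + I)) volume 0 (X / 2) := by
    refine (((continuousOn_cpow_wL hX (-s)).mono ?_).mul continuousOn_const).intervalIntegrable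
    rw [Set.uIcc_of_le hh.le]; exact Set.Icc_subset_Ici_self
  have hseg : ∫ u in (0 : ℝ)..(X / 2), wL X u ^ (-s) * (1 + I) =
      ((X : ℂ) ^ (1 - s) - ((1 - I) * ((X / 2 : ℝ) : ℂ)) ^ (1 - s)) / (1 - s) := by
    have h4 := integral_cpow_segment (b := (1 - I) * ((X / 2 : ℝ) : ℂ)) (c := 1 + I) hh.le hs1
      (fun v hv _ => by rw [← wL_eq_affine]; exact wL_mem_slitPlane hX hv)
    simp only [← wL_eq_affine] at h4
    rw [wL_half, wL_zero] at h4
    rw [intervalIntegral.integral_mul_const, mul_comm, h4]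
  rw [wInt, ← intervalIntegral.integral_interval_add_Ioi hi (hi.mono_set (Set.Ioi_subset_Ioi hh.le)),
    ← hseg]
  rw [add_sub_right_comm, ← intervalIntegral.integral_sub hii hpow]
  have b1 : ‖∫ u in (0 : ℝ)..(X / 2), (kap a s (wL X u) * (1 + I) - wL X u ^ (-s) * (1 + I))‖ ≤
      (X / 2) ^ (-s.re) * (2 / Real.pi) := by
    have hb : ∀ u ∈ Set.Ioc (0 : ℝ) (X / 2),
        ‖kap a s (wL X u) * (1 + I) - wL X u ^ (-s) * (1 + I)‖ ≤
        (X / 2) ^ (-s.re) * 4 * Real.exp (2 * Real.pi * (u - X / 2)) := by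
      intro u hu
      have e : kap a s (wL X u) * (1 + I) - wL X u ^ (-s) * (1 + I) =
          wL X u ^ (-s) * (ex (wL X u - a) - 1)⁻¹ * (1 + I) := by
        have : ex (wL X u - a) - 1 ≠ 0 := ex_wL_ne a K u
        rw [kap]; field_simp; ring
      rw [e, norm_mul, norm_mul]
      have h1 := norm_cpow_wL_le hX hu.1.le hs
      have h2 : Real.exp (s.im * arg (wL X u)) ≤ 1 :=
        Real.exp_le_one_iff.mpr (mul_nonpos_of_nonneg_of_nonpos ht (arg_wL_nonpos hX hu.1.le hu.2))
      have h3 := norm_inv_ex_le a K u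
      have h4 := norm_one_add_I_le
      calc _ ≤ ((X / 2) ^ (-s.re) * 1) * (2 * Real.exp (2 * Real.pi * (u - X / 2))) * 2 := by
            gcongr
            exact h1.trans (by gcongr)
        _ = _ := by ring
    refine (intervalIntegral.norm_integral_le_of_norm_le hh.le
      (Filter.Eventually.of_forall hb)
      (by apply Continuous.intervalIntegrable; fun_prop)).trans ?_
    have hd : ∀ u ∈ Set.uIcc 0 (X / 2), HasDerivAt
        (fun u : ℝ => (X / 2) ^ (-s.re) * 4 * (Real.exp (2 * Real.pi * (u - X / 2)) / (2 * Real.pi)))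
        ((X / 2) ^ (-s.re) * 4 * Real.exp (2 * Real.pi * (u - X / 2))) u := by
      intro u _
      have h1 : HasDerivAt (fun u : ℝ => 2 * Real.pi * (u - X / 2)) (2 * Real.pi) u := by
        simpa using ((hasDerivAt_id u).sub_const (X / 2)).const_mul (2 * Real.pi)
      have h2 := (h1.exp.div_const (2 * Real.pi)).const_mul ((X / 2) ^ (-s.re) * 4)
      have e : Real.exp (2 * Real.pi * (u - X / 2)) * (2 * Real.pi) / (2 * Real.pi) =
        Real.exp (2 * Real.pi * (u - X / 2)) := by field_simp
      rwa [e] at h2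
    rw [intervalIntegral.integral_eq_sub_of_hasDerivAt hd (by apply Continuous.intervalIntegrable; fun_prop)]
    have := Real.exp_pos (2 * Real.pi * (0 - X / 2))
    rw [sub_self, mul_zero, Real.exp_zero]
    have h5 : 0 ≤ (X / 2) ^ (-s.re) * 4 * (Real.exp (2 * Real.pi * (0 - X / 2)) / (2 * Real.pi)) := by
      positivity
    have h6 : (X / 2) ^ (-s.re) * 4 * (1 / (2 * Real.pi)) = (X / 2) ^ (-s.re) * (2 / Real.pi) := by
      field_simp; norm_num
    linarith
  have b2 : ‖∫ u in Set.Ioi (X / 2), kap a s (wL X u) * (1 + I)‖ ≤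
      (X / 2) ^ (-s.re) * (4 / Real.pi) := by
    have hb : ∀ u ∈ Set.Ioi (X / 2), ‖kap a s (wL X u) * (1 + I)‖ ≤
        (X / 2) ^ (-s.re) * 4 * Real.exp (-(Real.pi * (u - X / 2))) := by
      intro u hu
      have hu' : X / 2 < u := hu
      rw [kap, norm_mul, norm_mul]
      have h1 := norm_cpow_wL_le hX (hh.le.trans hu'.le) hs
      have h2 : s.im * arg (wL X u) ≤ Real.pi * (u - X / 2) := by
        calc s.im * arg (wL X u) ≤ s.im * ((u - X / 2) / X) := by
              gcongr; exact arg_wL_le hX hu'.le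
          _ ≤ Real.pi * X * ((u - X / 2) / X) := by
              gcongr
          _ = _ := by field_simp
      have h3 := norm_ex_div_le a K u
      have h4 := norm_one_add_I_le
      calc _ ≤ ((X / 2) ^ (-s.re) * Real.exp (Real.pi * (u - X / 2))) *
            (2 * Real.exp (-(2 * Real.pi * (u - X / 2)))) * 2 := by
            gcongr
            exact h1.trans (by gcongr)
        _ = (X / 2) ^ (-s.re) * 4 * (Real.exp (Real.pi * (u - X / 2)) *
            Real.exp (-(2 * Real.pi * (u - X / 2)))) := by ring
        _ = _ := by rw [← Real.exp_add]; congr 2; ring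
    refine (norm_integral_le_of_norm_le (((integrableOn_exp_lin (X / 2) Real.pi
      ((X / 2) ^ (-s.re) * 4) Real.pi_pos).mono_set (Set.Ioi_subset_Ioi hh.le)))
      (ae_restrict_of_forall_mem measurableSet_Ioi hb)).trans (le_of_eq ?_)
    rw [integral_const_mul, exp_integral_Ioi_le _ _ Real.pi_pos]
    ring
  refine (norm_add_le _ _).trans ((add_le_add b1 b2).trans ?_)
  rw [← mul_add, mul_comm]
  gcongr
  rw [← add_div, div_le_iff₀ Real.pi_pos]
  linarith [Real.pi_gt_three]

lemma norm_cpow_one_sub_div_le {X : ℝ} (hX : 0 < X) {s : ℂ} (ht : 0 < s.im) :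
    ‖(X : ℂ) ^ (1 - s) / (1 - s)‖ ≤ X ^ (1 - s.re) / s.im := by
  rw [norm_div, norm_cpow_eq_rpow_re_of_pos hX]
  have : s.im ≤ ‖1 - s‖ := by
    refine le_trans ?_ (abs_im_le_norm _)
    simp [abs_of_pos ht]
  simp only [sub_re, one_re]
  gcongr

lemma norm_integral_rayf_le {a c : ℝ} (hc : 1 / 4 ≤ c) {s : ℂ} (hs : 0 ≤ s.re) :
    ‖∫ v in Set.Ioi c, rayf a s v‖ ≤ c ^ (-s.re) * Real.exp (-(Real.pi / 4) * s.im) *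
      Real.exp (-(2 * Real.pi * c)) := by
  have hc0 : 0 < c := by linarith
  have hA : 0 < c ^ (-s.re) := Real.rpow_pos_of_pos hc0 _
  have hb : ∀ v ∈ Set.Ioi c, ‖rayf a s v‖ ≤ (c ^ (-s.re) * Real.exp (-(Real.pi / 4) * s.im) *
      Real.exp (-(2 * Real.pi * c)) * 2) * Real.exp (-(2 * Real.pi * (v - c))) := by
    intro v hv
    have hv' : c < v := hv
    refine (norm_rayf_le (by linarith) hs).trans ?_
    have h1 : v ^ (-s.re) ≤ c ^ (-s.re) :=
      Real.rpow_le_rpow_of_nonpos hc0 hv'.le (by linarith)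
    calc _ ≤ c ^ (-s.re) * Real.exp (-(Real.pi / 4) * s.im) *
      (2 * Real.exp (-(2 * Real.pi * v))) := by gcongr
      _ = c ^ (-s.re) * Real.exp (-(Real.pi / 4) * s.im) * 2 *
        (Real.exp (-(2 * Real.pi * c)) * Real.exp (-(2 * Real.pi * (v - c)))) := by
          rw [← Real.exp_add]
          rw [show -(2 * Real.pi * c) + -(2 * Real.pi * (v - c)) = -(2 * Real.pi * v) by ring]
          ring
      _ = _ := by ring
  refine (norm_integral_le_of_norm_le ((integrableOn_exp_lin c (2 * Real.pi) _
    (by positivity)).mono_set (Set.Ioi_subset_Ioi hc0.le))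
    (ae_restrict_of_forall_mem measurableSet_Ioi hb)).trans ?_
  rw [integral_const_mul, exp_integral_Ioi_le _ _ (by positivity), mul_assoc]
  have : 2 * (2 * Real.pi)⁻¹ ≤ 1 := by
    rw [mul_inv, ← mul_assoc]; norm_num
    exact inv_le_one_of_one_le₀ (by linarith [Real.pi_gt_three])
  refine mul_le_of_le_one_right (by positivity) this

theorem hzeta_contour {a : ℝ} (ha : 0 < a) (ha1 : a ≤ 1) {s : ℂ} (hs : 0 < s.re) (ht : 0 ≤ s.im)
    (hs1 : s ≠ 1) {K : ℕ} (hK : 1 ≤ K) :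
    hzeta a s = ∑ m ∈ range K, (xpt a m : ℂ) ^ (-s) - wInt a s K
      - ((1 - I) * ((mpt a K / 2 : ℝ) : ℂ)) ^ (1 - s) / (1 - s)
      + (1 - I) * ∫ v in Set.Ioi (mpt a K / 2), rayf a s v := by
  have hmt : Tendsto (fun n : ℕ => mpt a (K + n)) atTop atTop := by
    unfold mpt
    have : Tendsto (fun n : ℕ => ((K + n : ℕ) : ℝ)) atTop atTop :=
      tendsto_natCast_atTop_atTop.comp (tendsto_add_atTop_nat K |>.congr fun n => by omega)
    exact (this.atTop_add (tendsto_const_nhds (x := a))).atTop_add (tendsto_const_nhds (x := -(1/2)))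
      |>.congr fun n => by ring
  have hpow : Tendsto (fun n : ℕ => (mpt a (K + n)) ^ (-s.re)) atTop (nhds 0) :=
    (tendsto_rpow_neg_atTop hs).comp hmt
  have hpow2 : Tendsto (fun n : ℕ => 2 * (mpt a (K + n) / 2) ^ (-s.re)) atTop (nhds 0) := by
    have := (tendsto_rpow_neg_atTop hs).comp (hmt.atTop_div_const (by norm_num : (0 : ℝ) < 2))
    simpa using this.const_mul 2
  obtain ⟨C, hC, hap⟩ := hzeta_approx ha ha1 hs hs1
  have l1 : Tendsto (fun n : ℕ => hzeta a s - ∑ m ∈ range (K + n), (xpt a m : ℂ) ^ (-s)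
      - (mpt a (K + n) : ℂ) ^ (1 - s) / (s - 1)) atTop (nhds 0) := by
    refine squeeze_zero_norm' ?_ (by simpa using hpow.const_mul C)
    filter_upwards [eventually_ge_atTop 2] with n hn
    exact hap (K + n) (by omega)
  have l2 : Tendsto (fun n : ℕ => wInt a s (K + n) - ((mpt a (K + n) : ℂ) ^ (1 - s)
      - ((1 - I) * ((mpt a (K + n) / 2 : ℝ) : ℂ)) ^ (1 - s)) / (1 - s)) atTop (nhds 0) := by
    refine squeeze_zero_norm' ?_ hpow2
    filter_upwards [(hmt.const_mul_atTop Real.pi_pos).eventually_ge_atTop s.im] with n hn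
    exact norm_wInt_sub_le ha hs.le ht hs1 (by omega) hn
  have l3 : Tendsto (fun n : ℕ => ∫ v in (mpt a K / 2)..(mpt a (K + n) / 2), rayf a s v) atTop
      (nhds (∫ v in Set.Ioi (mpt a K / 2), rayf a s v)) :=
    intervalIntegral_tendsto_integral_Ioi _ (integrableOn_rayf (mpt_half_ge ha hK) hs.le)
      (hmt.atTop_div_const (by norm_num : (0 : ℝ) < 2))
  have l4 := (l1.add l2).add (l3.const_mul (1 - I))
  have hs2 : s - 1 ≠ 0 := sub_ne_zero.mpr hs1
  have hs3 : 1 - s ≠ 0 := sub_ne_zero.mpr hs1.symm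
  have key : ∀ n : ℕ, hzeta a s - ∑ m ∈ range (K + n), (xpt a m : ℂ) ^ (-s)
      - (mpt a (K + n) : ℂ) ^ (1 - s) / (s - 1) + (wInt a s (K + n) - ((mpt a (K + n) : ℂ) ^ (1 - s)
      - ((1 - I) * ((mpt a (K + n) / 2 : ℝ) : ℂ)) ^ (1 - s)) / (1 - s)) +
      (1 - I) * ∫ v in (mpt a K / 2)..(mpt a (K + n) / 2), rayf a s v =
      hzeta a s - ∑ m ∈ range K, (xpt a m : ℂ) ^ (-s) + wInt a s K
      + ((1 - I) * ((mpt a K / 2 : ℝ) : ℂ)) ^ (1 - s) / (1 - s) := by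
    intro n
    rw [sum_range_add, sum_xpt_contour ha hs.le ht hs1 hK n, show s - 1 = -(1 - s) by ring, div_neg]
    ring
  simp only [key] at l4
  have := tendsto_nhds_unique l4 tendsto_const_nhds
  linear_combination -this

theorem hzeta_crude {a : ℝ} (ha : 0 < a) (ha1 : a ≤ 1) {s : ℂ} (hs : 0 < s.re) (ht : 0 < s.im)
    {K : ℕ} (hK : 1 ≤ K) (htX : s.im ≤ Real.pi * mpt a K) :
    ‖hzeta a s - ∑ m ∈ range K, (xpt a m : ℂ) ^ (-s)‖ ≤
      4 * (mpt a K / 2) ^ (-s.re) + mpt a K ^ (1 - s.re) / s.im := by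
  have hs1 : s ≠ 1 := by rintro rfl; simp at ht
  have hX := mpt_pos ha hK
  have h1 := norm_wInt_sub_le ha hs.le ht.le hs1 hK htX
  have h2 := norm_cpow_one_sub_div_le hX ht
  have h3 := norm_integral_rayf_le (a := a) (mpt_half_ge ha hK) hs.le
  have hA : 0 < (mpt a K / 2) ^ (-s.re) := Real.rpow_pos_of_pos (by linarith) _
  have h4 : ‖(1 - I) * ∫ v in Set.Ioi (mpt a K / 2), rayf a s v‖ ≤ 2 * (mpt a K / 2) ^ (-s.re) := by
    rw [norm_mul]
    have : ‖(1 - I : ℂ)‖ ≤ 2 := (norm_sub_le _ _).trans (by rw [norm_one, norm_I]; norm_num)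
    gcongr
    refine h3.trans ?_
    rw [mul_assoc, ← Real.exp_add]
    refine mul_le_of_le_one_right hA.le (Real.exp_le_one_iff.mpr ?_)
    have := mul_pos Real.pi_pos ht
    have := mul_pos Real.pi_pos hX
    nlinarith
  rw [hzeta_contour ha ha1 hs ht.le hs1 hK]
  have e : ∑ m ∈ range K, (xpt a m : ℂ) ^ (-s) - wInt a s K
      - ((1 - I) * ((mpt a K / 2 : ℝ) : ℂ)) ^ (1 - s) / (1 - s)
      + (1 - I) * (∫ v in Set.Ioi (mpt a K / 2), rayf a s v) - ∑ m ∈ range K, (xpt a m : ℂ) ^ (-s) =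
      -(wInt a s K - ((mpt a K : ℂ) ^ (1 - s)
      - ((1 - I) * ((mpt a K / 2 : ℝ) : ℂ)) ^ (1 - s)) / (1 - s)) - (mpt a K : ℂ) ^ (1 - s) / (1 - s)
      + (1 - I) * ∫ v in Set.Ioi (mpt a K / 2), rayf a s v := by ring
  rw [e]
  refine (norm_add_le _ _).trans ?_
  have := (norm_sub_le (-(wInt a s K - ((mpt a K : ℂ) ^ (1 - s)
      - ((1 - I) * ((mpt a K / 2 : ℝ) : ℂ)) ^ (1 - s)) / (1 - s))) ((mpt a K : ℂ) ^ (1 - s) / (1 - s)))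
  rw [norm_neg] at this
  linarith

lemma integrableOn_rpow_mul_exp_neg {p b : ℝ} (hp : -1 < p) (hb : 0 < b) :
    IntegrableOn (fun x : ℝ => x ^ p * Real.exp (-(b * x))) (Set.Ioi 0) := by
  have h := integrableOn_rpow_mul_exp_neg_mul_rpow (p := 1) hp one_pos hb
  refine IntegrableOn.congr_fun h (fun x _ => ?_) measurableSet_Ioi
  simp

lemma norm_cpow_mul_exp_eq {z r : ℂ} {x : ℝ} (hx : 0 < x) :
    ‖(x : ℂ) ^ z * cexp (-(r * x))‖ = x ^ z.re * Real.exp (-(r.re * x)) := by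
  rw [norm_mul, norm_cpow_eq_rpow_re_of_pos hx, norm_exp]
  simp

lemma continuousOn_cpow_mul_exp (z r : ℂ) :
    ContinuousOn (fun x : ℝ => (x : ℂ) ^ z * cexp (-(r * x))) (Set.Ioi 0) := by
  refine ContinuousOn.mul (ContinuousOn.cpow_const (by fun_prop) fun x hx => ?_) (by fun_prop)
  exact Or.inl (by simpa using hx)

lemma integrableOn_cpow_mul_exp {z r : ℂ} (hz : -1 < z.re) (hr : 0 < r.re) :
    IntegrableOn (fun x : ℝ => (x : ℂ) ^ z * cexp (-(r * x))) (Set.Ioi 0) := by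
  refine Integrable.mono' (integrableOn_rpow_mul_exp_neg hz hr)
    ((continuousOn_cpow_mul_exp z r).aestronglyMeasurable measurableSet_Ioi) ?_
  exact ae_restrict_of_forall_mem measurableSet_Ioi fun x hx => (norm_cpow_mul_exp_eq hx).le

lemma integral_cpow_mul_exp_complex {z r : ℂ} (hz : 0 < z.re) (hr : 0 < r.re) :
    ∫ x in Set.Ioi (0 : ℝ), (x : ℂ) ^ (z - 1) * cexp (-(r * x)) = (1 / r) ^ z * Gamma z := by
  set U : Set ℂ := {w : ℂ | 0 < w.re} with hU
  have hUo : IsOpen U := isOpen_lt continuous_const continuous_re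
  have hz1 : -1 < (z - 1).re := by simp; linarith
  have hd : ∀ r₀ ∈ U, DifferentiableAt ℂ
      (fun r : ℂ => ∫ x in Set.Ioi (0 : ℝ), (x : ℂ) ^ (z - 1) * cexp (-(r * x))) r₀ := by
    intro r₀ hr₀
    have hr₀' : 0 < r₀.re := hr₀
    have hs : {w : ℂ | r₀.re / 2 < w.re} ∈ nhds r₀ :=
      (isOpen_lt continuous_const continuous_re).mem_nhds (by simp; linarith)
    refine (hasDerivAt_integral_of_dominated_loc_of_deriv_le
      (μ := volume.restrict (Set.Ioi (0 : ℝ)))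
      (F := fun (r : ℂ) (x : ℝ) => (x : ℂ) ^ (z - 1) * cexp (-(r * x)))
      (F' := fun (r : ℂ) (x : ℝ) => (x : ℂ) ^ (z - 1) * (cexp (-(r * x)) * (-x)))
      (bound := fun x => x ^ z.re * Real.exp (-(r₀.re / 2 * x))) hs ?_
      (integrableOn_cpow_mul_exp hz1 hr₀') ?_ ?_
      (integrableOn_rpow_mul_exp_neg (by linarith) (by linarith)) ?_).2.differentiableAt
    · exact Eventually.of_forall fun r =>
        (continuousOn_cpow_mul_exp (z - 1) r).aestronglyMeasurable measurableSet_Ioi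
    · refine ContinuousOn.aestronglyMeasurable ?_ measurableSet_Ioi
      have := (continuousOn_cpow_mul_exp (z - 1) r₀).mul
        (show ContinuousOn (fun x : ℝ => (-x : ℂ)) (Set.Ioi 0) by fun_prop)
      exact this.congr fun x _ => (mul_assoc _ _ _).symm
    · refine ae_restrict_of_forall_mem measurableSet_Ioi fun x hx r hr => ?_
      have hx' : 0 < x := hx
      have hr' : r₀.re / 2 < r.re := hr
      rw [← mul_assoc, norm_mul, norm_cpow_mul_exp_eq hx', norm_neg, norm_real, Real.norm_eq_abs,
        abs_of_pos hx', mul_right_comm]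
      have : x ^ (z - 1).re * x = x ^ z.re := by
        rw [sub_re, one_re, Real.rpow_sub_one hx'.ne']; field_simp
      rw [this]
      gcongr
    · refine ae_restrict_of_forall_mem measurableSet_Ioi fun x hx r hr => ?_
      have h1 : HasDerivAt (fun r : ℂ => -(r * x)) (-(x : ℂ)) r := by
        have := ((hasDerivAt_id' r).mul_const (x : ℂ)).neg
        rw [one_mul] at this
        exact this
      exact h1.cexp.const_mul _
  have hf : AnalyticOnNhd ℂ
      (fun r : ℂ => ∫ x in Set.Ioi (0 : ℝ), (x : ℂ) ^ (z - 1) * cexp (-(r * x))) U :=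
    DifferentiableOn.analyticOnNhd (fun r₀ hr₀ => (hd r₀ hr₀).differentiableWithinAt) hUo
  have hg : AnalyticOnNhd ℂ (fun r : ℂ => (1 / r) ^ z * Gamma z) U := by
    refine DifferentiableOn.analyticOnNhd (fun r₀ hr₀ => ?_) hUo
    have hr₀' : 0 < r₀.re := hr₀
    have hne : r₀ ≠ 0 := by rintro rfl; simp at hr₀'
    have hsl : (1 / r₀) ∈ slitPlane := by
      refine Or.inl ?_
      rw [one_div, inv_re]
      exact div_pos hr₀' (normSq_pos.mpr hne)
    exact (((differentiableAt_const _).div differentiableAt_id hne).cpow_const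
      hsl |>.mul_const _).differentiableWithinAt
  refine hf.eqOn_of_preconnected_of_frequently_eq (z₀ := 1) hg
    ((convex_halfSpace_re_gt 0).isPreconnected) (by simp [hU]) ?_ hr
  have ht : Tendsto (fun n : ℕ => (1 : ℂ) + ((1 / ((n : ℝ) + 1) : ℝ) : ℂ)) atTop
      (nhdsWithin 1 {1}ᶜ) := by
    refine tendsto_nhdsWithin_iff.mpr ⟨?_, Eventually.of_forall fun n => ?_⟩
    · have := (continuous_ofReal.tendsto 0).comp tendsto_one_div_add_atTop_nhds_zero_nat
      simpa using this.const_add (1 : ℂ)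
    · simp only [Set.mem_compl_iff, Set.mem_singleton_iff, add_eq_left, ofReal_eq_zero]
      positivity
  refine ht.frequently (Frequently.of_forall fun n => ?_)
  have h := integral_cpow_mul_exp_neg_mul_Ioi hz (r := 1 + 1 / ((n : ℝ) + 1)) (by positivity)
  push_cast at h ⊢
  exact h

/-- The factor in the functional equation of the Hurwitz zeta function. -/
noncomputable def gam (s : ℂ) : ℂ :=
  (2 * Real.pi : ℂ) ^ (s - 1) * cexp (I * Real.pi * (1 - s) / 2) * Gamma (1 - s)

/-- The integrand `w^{-s} e(ν w)` along the direction `1 + i`. -/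
noncomputable def dirf (s : ℂ) (ν : ℝ) (z : ℂ) : ℂ :=
  ((1 + I) * z) ^ (-s) * ex (ν * ((1 + I) * z)) * (1 + I)

lemma ofReal_mul_cpow {x : ℝ} (hx : 0 < x) {z : ℂ} (hz : z ≠ 0) (w : ℂ) :
    ((x : ℂ) * z) ^ w = (x : ℂ) ^ w * z ^ w := by
  have hx0 : (x : ℂ) ≠ 0 := by exact_mod_cast hx.ne'
  rw [cpow_def_of_ne_zero (mul_ne_zero hx0 hz), cpow_def_of_ne_zero hx0, cpow_def_of_ne_zero hz,
    log_ofReal_mul hx hz, ofReal_log hx.le, add_mul, Complex.exp_add]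

lemma log_one_add_I : log (1 + I) = (Real.log 2 / 2 : ℝ) + (Real.pi / 4 : ℝ) * I := by
  apply Complex.ext
  · rw [log_re]
    have : ‖(1 + I : ℂ)‖ = Real.sqrt 2 := by
      rw [Complex.norm_def]; congr 1; simp [normSq_apply]; norm_num
    rw [this, Real.log_sqrt (by norm_num)]
    simp only [add_re, ofReal_re, mul_re, I_re, ofReal_im, I_im]; ring
  · rw [log_im, arg_le_div (by simp)]
    simp only [add_im, ofReal_re, mul_im, I_re, ofReal_im, I_im, one_im, one_re, add_re]
    simp

lemma log_inv_scaled {ν : ℝ} (hν : 0 < ν) : log (1 / (2 * Real.pi * ν * (1 - I))) =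
    -(Real.log (2 * Real.pi * ν)) - (Real.log 2 / 2 : ℝ) + (Real.pi / 4 : ℝ) * I := by
  have h1 : 1 / (2 * Real.pi * ν * (1 - I)) = (((2 * Real.pi * ν * 2)⁻¹ : ℝ) : ℂ) * (1 + I) := by
    have h2 : (1 - I : ℂ) ≠ 0 := by
      intro h; have := congrArg Complex.re h; simp at this
    have h3 : (2 * Real.pi * ν : ℂ) ≠ 0 := by
      have := Real.pi_ne_zero; have := hν.ne'; simp [*]
    push_cast
    field_simp
    ring_nf; simp; ring
  have hpos : 0 < 2 * Real.pi * ν := by positivity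
  rw [h1, log_ofReal_mul (by positivity) (by
    intro h; have := congrArg Complex.re h; simp at this), log_one_add_I, Real.log_inv,
    Real.log_mul hpos.ne' (by norm_num)]
  push_cast; ring

lemma integral_dirf {s : ℂ} (hs1 : s.re < 1) {ν : ℝ} (hν : 0 < ν) :
    ∫ x in Set.Ioi (0 : ℝ), dirf s ν x = gam s * (ν : ℂ) ^ (s - 1) := by
  have h0 : (1 + I : ℂ) ≠ 0 := by
    intro h; have := congrArg Complex.re h; simp at this
  have h1 : ∀ x ∈ Set.Ioi (0 : ℝ), dirf s ν x =
      (1 + I) ^ (1 - s) * ((x : ℂ) ^ ((1 - s) - 1) * cexp (-((2 * Real.pi * ν * (1 - I)) * x))) := by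
    intro x hx
    have hx' : 0 < x := hx
    rw [dirf, mul_comm (1 + I : ℂ) (x : ℂ), ofReal_mul_cpow hx' h0,
      show (1 : ℂ) - s = 1 + -s by ring, cpow_add _ _ h0, cpow_one, ex]
    have : (2 * Real.pi * I * (ν * (x * (1 + I))) : ℂ) = -((2 * Real.pi * ν * (1 - I)) * x) := by
      ring_nf; simp; ring
    rw [this]; ring_nf
  have hr : 0 < (2 * Real.pi * ν * (1 - I) : ℂ).re := by
    have : (2 * Real.pi * ν * (1 - I) : ℂ).re = 2 * Real.pi * ν := by simp
    rw [this]; positivity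
  rw [setIntegral_congr_fun measurableSet_Ioi h1, integral_const_mul,
    integral_cpow_mul_exp_complex (by simp; linarith) hr, gam, ← mul_assoc]
  have hr0 : (1 / (2 * Real.pi * ν * (1 - I)) : ℂ) ≠ 0 := by
    refine one_div_ne_zero ?_
    intro h; rw [h] at hr; simp at hr
  have hpi : (2 * Real.pi : ℂ) ≠ 0 := by simp [Real.pi_ne_zero]
  have hν0 : (ν : ℂ) ≠ 0 := by exact_mod_cast hν.ne'
  rw [mul_right_comm _ (Gamma _), cpow_def_of_ne_zero h0, cpow_def_of_ne_zero hr0,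
    cpow_def_of_ne_zero hpi, cpow_def_of_ne_zero hν0, ← Complex.exp_add, ← Complex.exp_add,
    ← Complex.exp_add, log_one_add_I, log_inv_scaled hν]
  congr 2
  have e1 : log (2 * Real.pi : ℂ) = (Real.log (2 * Real.pi) : ℂ) := by
    rw [ofReal_log (by positivity)]; push_cast; rfl
  rw [e1, ← ofReal_log hν.le, Real.log_mul (by positivity) hν.ne']
  push_cast; ring

lemma re_dir (x y : ℝ) : ((1 + I) * ((x : ℂ) + y * I)).re = x - y := by simp

lemma im_dir (x y : ℝ) : ((1 + I) * ((x : ℂ) + y * I)).im = x + y := by simp; ring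

lemma norm_dirf_le {s : ℂ} (hs : 0 ≤ s.re) (ht : 0 ≤ s.im) {ν A x y : ℝ} (hA : 0 < A)
    (hA1 : A ≤ x - y) : ‖dirf s ν (x + y * I)‖ ≤
      A ^ (-s.re) * Real.exp (s.im * Real.pi) * Real.exp (-(2 * Real.pi * ν * (x + y))) * 2 := by
  rw [dirf, norm_mul, norm_mul]
  have h1 := norm_cpow_neg_le (w := (1 + I) * ((x : ℂ) + y * I)) hA (by rw [re_dir]; exact hA1) hs
  have h2 : ‖ex (ν * ((1 + I) * ((x : ℂ) + y * I)))‖ = Real.exp (-(2 * Real.pi * ν * (x + y))) := by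
    rw [norm_ex, im_ofReal_mul, im_dir]; congr 2; ring
  rw [h2]
  have h3 := exp_mul_arg_le (w := (1 + I) * ((x : ℂ) + y * I)) ht
  have h4 := norm_one_add_I_le
  have : 0 < A ^ (-s.re) := Real.rpow_pos_of_pos hA _
  gcongr
  exact h1.trans (by gcongr)

lemma differentiableOn_dirf (s : ℂ) (ν : ℝ) :
    DifferentiableOn ℂ (dirf s ν) {z : ℂ | z.im < z.re} := by
  intro z hz
  have hz' : z.im < z.re := hz
  have hsl : (1 + I) * z ∈ slitPlane := Or.inl (by simp; linarith)
  have h1 : DifferentiableAt ℂ (fun z : ℂ => (1 + I) * z) z := by fun_prop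
  have h2 : DifferentiableAt ℂ (fun z : ℂ => ex (ν * ((1 + I) * z))) z :=
    (differentiable_ex _).comp z (by fun_prop)
  exact (((h1.cpow_const hsl).mul h2).mul_const _).differentiableWithinAt

lemma dirf_line_continuousOn (s : ℂ) (ν : ℝ) {y : ℝ} (hy : y < 0) :
    ContinuousOn (fun x : ℝ => dirf s ν (x + y * I)) (Set.Ici 0) := by
  refine (differentiableOn_dirf s ν).continuousOn.comp (by fun_prop) fun x hx => ?_
  have : (0 : ℝ) ≤ x := hx
  simp; linarith

lemma integrableOn_dirf {s : ℂ} (hs : 0 ≤ s.re) (ht : 0 ≤ s.im) {ν y : ℝ} (hν : 0 < ν)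
    (hy : y < 0) : IntegrableOn (fun x : ℝ => dirf s ν (x + y * I)) (Set.Ioi 0) := by
  refine Integrable.mono' (integrableOn_exp_lin (-y) (2 * Real.pi * ν)
    ((-y) ^ (-s.re) * Real.exp (s.im * Real.pi) * 2) (by positivity))
    ((dirf_line_continuousOn s ν hy).mono Set.Ioi_subset_Ici_self |>.aestronglyMeasurable
      measurableSet_Ioi) ?_
  refine ae_restrict_of_forall_mem measurableSet_Ioi fun x hx => ?_
  have hx' : 0 < x := hx
  refine (norm_dirf_le (A := -y) hs ht (by linarith) (by linarith)).trans (le_of_eq ?_)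
  rw [sub_neg_eq_add]; ring

lemma dirf_right_tendsto {s : ℂ} (hs : 0 ≤ s.re) (ht : 0 ≤ s.im) {ν y₀ y₁ : ℝ} (hν : 0 < ν)
    (hy : y₀ ≤ y₁) (hy1 : y₁ < 0) :
    Tendsto (fun Y : ℝ => ∫ y in y₀..y₁, dirf s ν (Y + y * I)) atTop (nhds 0) := by
  have hlim : Tendsto (fun Y : ℝ => (-y₁) ^ (-s.re) * Real.exp (s.im * Real.pi) *
      Real.exp (-(2 * Real.pi * ν * (Y + y₀))) * 2 * |y₁ - y₀|) atTop (nhds 0) := by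
    have h1 : Tendsto (fun Y : ℝ => Real.exp (-(2 * Real.pi * ν * (Y + y₀)))) atTop (nhds 0) := by
      refine Real.tendsto_exp_neg_atTop_nhds_zero.comp ?_
      exact (tendsto_atTop_add_const_right _ _ tendsto_id).const_mul_atTop (by positivity)
    have := ((h1.const_mul ((-y₁) ^ (-s.re) * Real.exp (s.im * Real.pi))).mul_const
      2).mul_const (|y₁ - y₀|)
    simpa using this
  refine squeeze_zero_norm' ?_ hlim
  filter_upwards [eventually_ge_atTop 0] with Y hY0
  refine intervalIntegral.norm_integral_le_of_norm_le_const fun y hyy => ?_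
  rw [Set.uIoc_of_le hy] at hyy
  refine (norm_dirf_le (A := -y₁) hs ht (by linarith) (by linarith [hyy.2])).trans ?_
  have : 0 ≤ (-y₁) ^ (-s.re) := Real.rpow_nonneg (by linarith) _
  gcongr
  exact hyy.1.le

lemma dirf_shift {s : ℂ} (hs : 0 ≤ s.re) (ht : 0 ≤ s.im) {ν p ε : ℝ} (hν : 0 < ν) (hε : 0 < ε)
    (hεp : ε ≤ p) :
    (∫ x in Set.Ioi (0 : ℝ), dirf s ν (x + (-p : ℝ) * I)) -
      (∫ x in Set.Ioi (0 : ℝ), dirf s ν (x + (-ε : ℝ) * I)) =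
      -((1 - I) * ∫ v in ε..p, ((1 - I) * (v : ℂ)) ^ (-s) * ex (ν * ((1 - I) * v))) := by
  have hlim : ∀ {q : ℝ}, 0 < q → Tendsto (fun Y : ℝ => ∫ x in (0 : ℝ)..Y,
      dirf s ν (x + (-q : ℝ) * I)) atTop
      (nhds (∫ x in Set.Ioi (0 : ℝ), dirf s ν (x + (-q : ℝ) * I))) := fun {q} hq =>
    intervalIntegral_tendsto_integral_Ioi 0 (integrableOn_dirf hs ht hν (by linarith)) tendsto_id
  have hR := (((hlim (q := p) (by linarith)).sub (hlim hε)).add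
    ((dirf_right_tendsto (y₀ := -p) (y₁ := -ε) hs ht hν (by linarith) (by linarith)).const_mul
      I)).sub_const (I * ∫ y in (-p)..(-ε), dirf s ν (((0 : ℝ) : ℂ) + y * I))
  have hc : Tendsto (fun Y : ℝ => rectInt (dirf s ν) 0 Y (-p) (-ε)) atTop (nhds 0) := by
    refine tendsto_const_nhds.congr' ?_
    filter_upwards [eventually_ge_atTop 0] with Y hY
    refine (rectInt_eq_zero ((differentiableOn_dirf s ν).mono fun z hz => ?_)).symm
    rw [mem_reProdIm, Set.uIcc_of_le hY, Set.uIcc_of_le (by linarith)] at hz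
    have h1 := hz.1.1
    have h2 := hz.2.2
    show z.im < z.re
    linarith
  have := tendsto_nhds_unique hc hR
  have e : I * (∫ y in (-p)..(-ε), dirf s ν (((0 : ℝ) : ℂ) + y * I)) =
      -((1 - I) * ∫ v in ε..p, ((1 - I) * (v : ℂ)) ^ (-s) * ex (ν * ((1 - I) * v))) := by
    rw [← intervalIntegral.integral_comp_neg]
    have h2 : ∀ v : ℝ, dirf s ν (((0 : ℝ) : ℂ) + ((-v : ℝ) : ℂ) * I) =
        (((1 - I) * (v : ℂ)) ^ (-s) * ex (ν * ((1 - I) * v))) * (1 + I) := by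
      intro v
      have : (1 + I) * (((0 : ℝ) : ℂ) + ((-v : ℝ) : ℂ) * I) = (1 - I) * v := by
        push_cast; ring_nf; simp
      rw [dirf, this]
    simp_rw [h2]
    rw [intervalIntegral.integral_mul_const]
    generalize (∫ v in ε..p, ((1 - I) * (v : ℂ)) ^ (-s) * ex (ν * ((1 - I) * v))) = J
    linear_combination J * I_sq
  rw [e] at this
  linear_combination -this

lemma dirf_tendsto {s : ℂ} (hs : 0 ≤ s.re) (hs1 : s.re < 1) (ht : 0 ≤ s.im) {ν : ℝ} (hν : 0 < ν) :
    Tendsto (fun ε : ℝ => ∫ x in Set.Ioi (0 : ℝ), dirf s ν (x + (-ε : ℝ) * I))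
      (nhdsWithin 0 (Set.Ioi 0)) (nhds (gam s * (ν : ℂ) ^ (s - 1))) := by
  rw [← integral_dirf hs1 hν]
  refine tendsto_integral_filter_of_dominated_convergence
    (fun x => Real.exp (s.im * Real.pi) * Real.exp (2 * Real.pi * ν) * 2 *
      (x ^ (-s.re) * Real.exp (-(2 * Real.pi * ν * x)))) ?_ ?_ ?_ ?_
  · filter_upwards [self_mem_nhdsWithin] with ε hε
    have hε' : 0 < ε := hε
    exact (dirf_line_continuousOn s ν (by linarith)).mono Set.Ioi_subset_Ici_self
      |>.aestronglyMeasurable measurableSet_Ioi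
  · filter_upwards [self_mem_nhdsWithin, mem_nhdsWithin_of_mem_nhds (Iio_mem_nhds one_pos)]
      with ε hε hε1
    have hε' : 0 < ε := hε
    have hε1' : ε < 1 := hε1
    refine ae_restrict_of_forall_mem measurableSet_Ioi fun x hx => ?_
    have hx' : 0 < x := hx
    refine (norm_dirf_le (A := x) hs ht hx' (by linarith)).trans ?_
    have : Real.exp (-(2 * Real.pi * ν * (x + -ε))) ≤
        Real.exp (2 * Real.pi * ν) * Real.exp (-(2 * Real.pi * ν * x)) := by
      rw [← Real.exp_add]; gcongr
      have : 2 * Real.pi * ν * ε ≤ 2 * Real.pi * ν * 1 := by gcongr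
      linarith
    have h0 : 0 < x ^ (-s.re) := Real.rpow_pos_of_pos hx' _
    calc _ ≤ x ^ (-s.re) * Real.exp (s.im * Real.pi) *
          (Real.exp (2 * Real.pi * ν) * Real.exp (-(2 * Real.pi * ν * x))) * 2 := by gcongr
      _ = _ := by ring
  · exact (integrableOn_rpow_mul_exp_neg (by linarith) (by positivity)).const_mul _
  · refine ae_restrict_of_forall_mem measurableSet_Ioi fun x hx => ?_
    have hx' : 0 < x := hx
    have hca : ContinuousAt (dirf s ν) (x : ℂ) :=
      ((differentiableOn_dirf s ν).differentiableAt
        ((isOpen_lt continuous_im continuous_re).mem_nhds (by simpa using hx'))).continuousAt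
    have h1 : Tendsto (fun ε : ℝ => (x : ℂ) + ((-ε : ℝ) : ℂ) * I) (nhdsWithin 0 (Set.Ioi 0))
        (nhds (x : ℂ)) := by
      have : Continuous (fun ε : ℝ => (x : ℂ) + ((-ε : ℝ) : ℂ) * I) := by fun_prop
      have := this.tendsto 0
      simp only [neg_zero, ofReal_zero, zero_mul, add_zero] at this
      exact this.mono_left nhdsWithin_le_nhds
    exact hca.tendsto.comp h1

/-- The integral of `w^{-s} e(ν w)` along the half-line through `X`. -/
noncomputable def jInt (s : ℂ) (X ν : ℝ) : ℂ :=
  ∫ u in Set.Ioi (0 : ℝ), wL X u ^ (-s) * ex (ν * wL X u) * (1 + I)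

lemma norm_jInt_sub_le {s : ℂ} (hs : 0 ≤ s.re) (hs1 : s.re < 1) (ht : 0 ≤ s.im) {X ν : ℝ}
    (hX : 0 < X) (hν : 0 < ν) : ‖jInt s X ν - gam s * (ν : ℂ) ^ (s - 1)‖ ≤
      2 * Real.exp (-(Real.pi / 4) * s.im) * Real.exp (Real.pi * ν * X) *
        ((X / 2) ^ (1 - s.re) / (1 - s.re)) := by
  have hj : jInt s X ν = ∫ x in Set.Ioi (0 : ℝ), dirf s ν (x + (-(X / 2) : ℝ) * I) := by
    rw [jInt]
    refine integral_congr_ae (Eventually.of_forall fun u => ?_)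
    simp only [dirf, wL, neg_div]
  refine le_of_tendsto ((tendsto_const_nhds.sub (dirf_tendsto hs hs1 ht hν)).norm) ?_
  filter_upwards [self_mem_nhdsWithin, mem_nhdsWithin_of_mem_nhds
    (Iio_mem_nhds (show (0 : ℝ) < X / 2 by linarith))] with ε hε hε1
  have hε' : 0 < ε := hε
  have hε1' : ε < X / 2 := hε1
  rw [hj, dirf_shift hs ht hν hε' hε1'.le, norm_neg, norm_mul]
  have h2 : ‖(1 - I : ℂ)‖ ≤ 2 := (norm_sub_le _ _).trans (by rw [norm_one, norm_I]; norm_num)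
  have h3 : ‖∫ v in ε..(X / 2), ((1 - I) * (v : ℂ)) ^ (-s) * ex (ν * ((1 - I) * v))‖ ≤
      ∫ v in ε..(X / 2), Real.exp (-(Real.pi / 4) * s.im) * Real.exp (Real.pi * ν * X) *
        v ^ (-s.re) := by
    refine intervalIntegral.norm_integral_le_of_norm_le hε1'.le (Eventually.of_forall fun v hv => ?_) ?_
    · have hv0 : 0 < v := hε'.trans hv.1
      rw [norm_mul]
      have h4 := norm_cpow_ray_le hv0 hs
      have h5 : ‖ex (ν * ((1 - I) * v))‖ ≤ Real.exp (Real.pi * ν * X) := by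
        rw [norm_ex]
        gcongr
        have : ((ν : ℂ) * ((1 - I) * v)).im = -(ν * v) := by simp
        rw [this]
        have : Real.pi * ν * (2 * v) ≤ Real.pi * ν * X := by gcongr; linarith [hv.2]
        linarith
      calc _ ≤ (v ^ (-s.re) * Real.exp (-(Real.pi / 4) * s.im)) * Real.exp (Real.pi * ν * X) := by
            have : 0 < v ^ (-s.re) := Real.rpow_pos_of_pos hv0 _
            gcongr
        _ = _ := by ring
    · refine (intervalIntegral.intervalIntegrable_rpow' (by linarith)).const_mul _
  rw [intervalIntegral.integral_const_mul, integral_rpow (Or.inl (by linarith))] at h3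
  have h6 : ((X / 2) ^ (-s.re + 1) - ε ^ (-s.re + 1)) / (-s.re + 1) ≤
      (X / 2) ^ (1 - s.re) / (1 - s.re) := by
    rw [show -s.re + 1 = 1 - s.re by ring]
    have : 0 ≤ ε ^ (1 - s.re) := Real.rpow_nonneg hε'.le _
    have : 0 < 1 - s.re := by linarith
    gcongr; linarith
  calc _ ≤ 2 * (Real.exp (-(Real.pi / 4) * s.im) * Real.exp (Real.pi * ν * X) *
        ((X / 2) ^ (1 - s.re) / (1 - s.re))) := by
        gcongr
        exact h3.trans (by gcongr)
    _ = _ := by ring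

/-- The kernel left after removing `K` exponentials. -/
noncomputable def phiK (a : ℝ) (K : ℕ) (w : ℂ) : ℂ := ex (w - a) ^ (K + 1) / (ex (w - a) - 1)

lemma kap_eq_phiK {a : ℝ} {s w : ℂ} (K : ℕ) (h : ex (w - a) - 1 ≠ 0) :
    kap a s w = w ^ (-s) * phiK a K w -
      ∑ n ∈ range K, ex (-((n + 1) * a)) * (w ^ (-s) * ex (((n : ℝ) + 1 : ℝ) * w)) := by
  have h1 : ∀ n : ℕ, ex (-((n + 1) * a)) * (w ^ (-s) * ex (((n : ℝ) + 1 : ℝ) * w)) =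
      w ^ (-s) * ex (w - a) * ex (w - a) ^ n := by
    intro n
    have : ex (w - a) ^ (n + 1) = ex (-((n + 1) * a)) * ex (((n : ℝ) + 1 : ℝ) * w) := by
      rw [← ex_natMul, ← ex_add]; congr 1; push_cast; ring
    rw [mul_assoc (w ^ (-s)), ← pow_succ', this]; ring
  simp_rw [h1]
  rw [← mul_sum, geom_sum_eq (sub_ne_zero.mp h), kap, phiK]
  field_simp
  ring

/-- The dual sum in the approximate functional equation. -/
noncomputable def dualSum (a : ℝ) (s : ℂ) (K : ℕ) : ℂ :=
  ∑ n ∈ range K, ex (-((n + 1) * a)) * (gam s * (((n : ℝ) + 1 : ℝ) : ℂ) ^ (s - 1))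

/-- The direct sum in the approximate functional equation. -/
noncomputable def dirSum (a : ℝ) (s : ℂ) (K : ℕ) : ℂ :=
  ∑ m ∈ range K, (xpt a m : ℂ) ^ (-s)

/-- The remainder integral in the approximate functional equation. -/
noncomputable def rMain (a : ℝ) (s : ℂ) (K : ℕ) : ℂ :=
  -∫ u in Set.Ioi (0 : ℝ), wL (mpt a K) u ^ (-s) * phiK a K (wL (mpt a K) u) * (1 + I)

lemma norm_phiK_le (a : ℝ) (K : ℕ) (u : ℝ) : ‖phiK a K (wL (mpt a K) u)‖ ≤
      2 * Real.exp (-(2 * Real.pi * (K + 1) * (u - mpt a K / 2))) := by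
  have h := (ex_sub_one_lower (a := a) K u).1
  rw [phiK, norm_div, norm_pow, norm_ex_wL, div_le_iff₀ (by linarith), ← Real.exp_nat_mul]
  have e : ((K + 1 : ℕ) : ℝ) * -(2 * Real.pi * (u - mpt a K / 2)) =
    -(2 * Real.pi * (K + 1) * (u - mpt a K / 2)) := by push_cast; ring
  rw [e]
  have := Real.exp_pos (-(2 * Real.pi * (K + 1) * (u - mpt a K / 2)))
  nlinarith

lemma norm_phiK_le' (a : ℝ) (K : ℕ) (u : ℝ) : ‖phiK a K (wL (mpt a K) u)‖ ≤
      2 * Real.exp (-(2 * Real.pi * K * (u - mpt a K / 2))) := by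
  have h := (ex_sub_one_lower (a := a) K u).2
  have h0 := Real.exp_pos (-(2 * Real.pi * (u - mpt a K / 2)))
  rw [phiK, norm_div, norm_pow, norm_ex_wL, div_le_iff₀ (by linarith), pow_succ, ← Real.exp_nat_mul]
  have e : (K : ℝ) * -(2 * Real.pi * (u - mpt a K / 2)) =
    -(2 * Real.pi * K * (u - mpt a K / 2)) := by ring
  rw [e]
  have := Real.exp_pos (-(2 * Real.pi * K * (u - mpt a K / 2)))
  nlinarith

lemma continuous_phiK_wL (a : ℝ) (K : ℕ) : Continuous (fun u => phiK a K (wL (mpt a K) u)) := by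
  unfold phiK
  exact Continuous.div (by fun_prop) (by fun_prop) fun u => ex_wL_ne a K u

lemma integrableOn_jInt {s : ℂ} (hs : 0 ≤ s.re) (ht : 0 ≤ s.im) {X ν : ℝ} (hX : 0 < X)
    (hν : 0 < ν) :
    IntegrableOn (fun u : ℝ => wL X u ^ (-s) * ex (ν * wL X u) * (1 + I)) (Set.Ioi 0) := by
  refine (integrableOn_dirf hs ht hν (y := -(X / 2)) (by linarith)).congr_fun (fun u _ => ?_)
    measurableSet_Ioi
  simp only [dirf, wL, neg_div]

lemma integrableOn_rMain {a : ℝ} (ha : 0 < a) {s : ℂ} (hs : 0 ≤ s.re) (ht : 0 ≤ s.im) {K : ℕ}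
    (hK : 1 ≤ K) : IntegrableOn (fun u : ℝ => wL (mpt a K) u ^ (-s) *
      phiK a K (wL (mpt a K) u) * (1 + I)) (Set.Ioi 0) := by
  have hX := mpt_pos ha hK
  have h1 := integrable_finsetSum (range K) (fun n _ =>
    (integrableOn_jInt hs ht hX (ν := (n : ℝ) + 1) (by positivity)).const_mul (ex (-((n + 1) * a))))
  refine ((integrableOn_kap_wL ha hs ht hK).add h1).congr ?_
  refine Eventually.of_forall fun u => ?_
  simp only [Pi.add_apply]
  rw [kap_eq_phiK K (ex_wL_ne a K u), sub_mul, sum_mul]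
  simp only [mul_assoc]
  ring

lemma wInt_eq {a : ℝ} (ha : 0 < a) {s : ℂ} (hs : 0 ≤ s.re) (ht : 0 ≤ s.im) {K : ℕ}
    (hK : 1 ≤ K) : wInt a s K = -rMain a s K -
      ∑ n ∈ range K, ex (-((n + 1) * a)) * jInt s (mpt a K) ((n : ℝ) + 1) := by
  have hX := mpt_pos ha hK
  have hj := fun n : ℕ => (integrableOn_jInt hs ht hX (ν := (n : ℝ) + 1) (by positivity)).const_mul
    (ex (-((n + 1) * a)))
  have h1 := integrable_finsetSum (range K) (fun n _ => hj n)
  rw [rMain, neg_neg]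
  simp only [jInt]
  simp_rw [← integral_const_mul]
  rw [← integral_finsetSum _ (fun n _ => hj n), ← integral_sub (integrableOn_rMain ha hs ht hK) h1,
    wInt]
  refine integral_congr_ae (Eventually.of_forall fun u => ?_)
  simp only
  rw [kap_eq_phiK K (ex_wL_ne a K u), sub_mul, sum_mul]
  simp only [mul_assoc]

lemma norm_ray_cpow_pos_le {v : ℝ} (hv : 0 < v) {s : ℂ} (hs : s.re < 1) :
    ‖((1 - I) * (v : ℂ)) ^ (1 - s)‖ ≤ (2 * v) ^ (1 - s.re) * Real.exp (-(Real.pi / 4) * s.im) := by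
  have h0 : (1 - I) * (v : ℂ) ≠ 0 := slitPlane_ne_zero (ray_mem_slitPlane hv)
  rw [norm_cpow_of_ne_zero h0, arg_one_sub_I_mul hv, div_eq_mul_inv, ← Real.exp_neg]
  have h1 : ‖(1 - I) * (v : ℂ)‖ ≤ 2 * v := by
    rw [norm_mul, norm_real, Real.norm_eq_abs, abs_of_pos hv]
    gcongr
    exact (norm_sub_le _ _).trans (by rw [norm_one, norm_I]; norm_num)
  have e : -(-(Real.pi / 4) * (1 - s).im) = -(Real.pi / 4) * s.im := by simp
  rw [e]
  simp only [sub_re, one_re]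
  have : 0 ≤ 1 - s.re := by linarith
  gcongr

theorem afe {a : ℝ} (ha : 0 < a) (ha1 : a ≤ 1) {s : ℂ} (hs : 0 < s.re) (hs1 : s.re < 1) {K : ℕ}
    (hK : 1 ≤ K) (ht : 2 * Real.pi * ((K : ℝ) + 1) ^ 2 ≤ s.im) :
    ‖hzeta a s - dirSum a s K - dualSum a s K - rMain a s K‖ ≤
      11 / (1 - s.re) * s.im * Real.exp (-(s.im / 4)) := by
  have hX := mpt_pos ha hK
  have hK1 : (1 : ℝ) ≤ K := by exact_mod_cast hK
  have hpi := Real.pi_gt_three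
  have ht0 : 0 < s.im := lt_of_lt_of_le (by positivity) ht
  have hs1' : s ≠ 1 := by rintro rfl; simp at hs1
  set X := mpt a K with hXd
  have hXK : X ≤ K + 1 := by rw [hXd, mpt]; linarith
  have hX2 : 1 / 4 ≤ X / 2 := mpt_half_ge ha hK
  have h1σ : 0 < 1 - s.re := by linarith
  set E := Real.exp (-(s.im / 4)) with hE
  have hE0 : 0 < E := Real.exp_pos _
  have htK : ((K : ℝ) + 1) ^ 2 ≤ s.im := by nlinarith [sq_nonneg ((K : ℝ) + 1)]
  have hray : Real.exp (-(Real.pi / 4) * s.im) ≤ E := by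
    rw [hE, Real.exp_le_exp]; nlinarith
  have hPow : ∀ {Y : ℝ}, 0 < Y → Y ≤ K + 1 → Y ^ (1 - s.re) ≤ K + 1 := by
    intro Y hY hY1
    calc Y ^ (1 - s.re) ≤ ((K : ℝ) + 1) ^ (1 - s.re) := by gcongr
      _ ≤ ((K : ℝ) + 1) ^ (1 : ℝ) :=
        Real.rpow_le_rpow_of_exponent_le (by linarith) (by linarith)
      _ = _ := Real.rpow_one _
  have hneg : (X / 2) ^ (-s.re) ≤ 4 := by
    calc (X / 2) ^ (-s.re) ≤ (1 / 4 : ℝ) ^ (-s.re) :=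
          Real.rpow_le_rpow_of_nonpos (by norm_num) hX2 (by linarith)
      _ = 4 ^ s.re := by rw [one_div, Real.inv_rpow (by norm_num), Real.rpow_neg (by norm_num), inv_inv]
      _ ≤ 4 ^ (1 : ℝ) := Real.rpow_le_rpow_of_exponent_le (by norm_num) hs1.le
      _ = 4 := by norm_num
  have e : hzeta a s - dirSum a s K - dualSum a s K - rMain a s K =
      ∑ n ∈ range K, ex (-((n + 1) * a)) * (jInt s X ((n : ℝ) + 1) -
        gam s * (((n : ℝ) + 1 : ℝ) : ℂ) ^ (s - 1))
      - ((1 - I) * ((X / 2 : ℝ) : ℂ)) ^ (1 - s) / (1 - s)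
      + (1 - I) * ∫ v in Set.Ioi (X / 2), rayf a s v := by
    rw [hzeta_contour ha ha1 hs ht0.le hs1' hK, wInt_eq ha hs.le ht0.le hK, dirSum, dualSum]
    simp only [mul_sub, sum_sub_distrib]
    ring
  rw [e]
  have b1 : ‖∑ n ∈ range K, ex (-((n + 1) * a)) * (jInt s X ((n : ℝ) + 1) -
        gam s * (((n : ℝ) + 1 : ℝ) : ℂ) ^ (s - 1))‖ ≤ K * (2 * E * ((K + 1) / (1 - s.re))) := by
    refine (norm_sum_le _ _).trans ?_
    have : ∀ n ∈ range K, ‖ex (-((n + 1) * a)) * (jInt s X ((n : ℝ) + 1) -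
        gam s * (((n : ℝ) + 1 : ℝ) : ℂ) ^ (s - 1))‖ ≤ 2 * E * ((K + 1) / (1 - s.re)) := by
      intro n hn
      have hn' : (n : ℝ) + 1 ≤ K := by exact_mod_cast mem_range.mp hn
      have h1 : ‖ex (-((n + 1) * a))‖ = 1 := by
        rw [norm_ex]; simp
      rw [norm_mul, h1, one_mul]
      refine (norm_jInt_sub_le hs.le hs1 ht0.le hX (by positivity)).trans ?_
      rw [mul_assoc 2, ← Real.exp_add]
      have h2 : Real.exp (-(Real.pi / 4) * s.im + Real.pi * ((n : ℝ) + 1) * X) ≤ E := by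
        rw [hE, Real.exp_le_exp]
        have h3 : Real.pi * ((n : ℝ) + 1) * X ≤ Real.pi * K * (K + 1) := by gcongr
        have h4 : Real.pi * K * (K + 1) ≤ s.im / 2 := by nlinarith
        nlinarith
      have h3 := hPow (Y := X / 2) (by linarith) (by linarith)
      gcongr
    refine (sum_le_sum this).trans ?_
    simp
  have b2 : ‖((1 - I) * ((X / 2 : ℝ) : ℂ)) ^ (1 - s) / (1 - s)‖ ≤ (K + 1) * E := by
    rw [norm_div]
    have h1 := norm_ray_cpow_pos_le (v := X / 2) (by linarith) hs1
    have h2 : 1 ≤ ‖1 - s‖ := by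
      have : s.im ≤ ‖1 - s‖ := by
        refine le_trans ?_ (abs_im_le_norm _)
        simp [abs_of_pos ht0]
      nlinarith
    have h3 := hPow (Y := 2 * (X / 2)) (by linarith) (by linarith)
    refine (div_le_self (norm_nonneg _) h2).trans (h1.trans ?_)
    gcongr
  have b3 : ‖(1 - I) * ∫ v in Set.Ioi (X / 2), rayf a s v‖ ≤ 8 * E := by
    rw [norm_mul]
    have h2 : ‖(1 - I : ℂ)‖ ≤ 2 := (norm_sub_le _ _).trans (by rw [norm_one, norm_I]; norm_num)
    have h3 := norm_integral_rayf_le (a := a) hX2 hs.le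
    have h4 : Real.exp (-(2 * Real.pi * (X / 2))) ≤ 1 := Real.exp_le_one_iff.mpr (by
      have := mul_pos Real.pi_pos hX; linarith)
    calc _ ≤ 2 * (4 * E * 1) := by
          gcongr
          exact h3.trans (by gcongr)
      _ = _ := by ring
  refine (norm_add_le _ _).trans ((add_le_add ((norm_sub_le _ _).trans (add_le_add b1 b2)) b3).trans ?_)
  have h1 : (1 : ℝ) ≤ 1 / (1 - s.re) := by
    rw [le_div_iff₀ h1σ]; linarith
  set c := 1 / (1 - s.re) with hc
  have h2 : (11 : ℝ) / (1 - s.re) = 11 * c := by rw [hc]; ring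
  have h3 : ((K : ℝ) + 1) / (1 - s.re) = (K + 1) * c := by rw [hc]; ring
  rw [h2, h3]
  have h5 : (K : ℝ) * (K + 1) * c ≤ s.im * c := by gcongr; nlinarith
  have h6 : (K + 1 : ℝ) ≤ s.im * c := by nlinarith
  have h7 : (8 : ℝ) ≤ 8 * (s.im * c) := by nlinarith
  calc _ = (2 * (K * (K + 1) * c) + (K + 1) + 8) * E := by ring
    _ ≤ (2 * (s.im * c) + s.im * c + 8 * (s.im * c)) * E := by gcongr
    _ = _ := by ring

lemma div_one_add_le_arctan {y : ℝ} (hy : 0 ≤ y) : y / (1 + y) ≤ Real.arctan y := by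
  have hm : MonotoneOn (fun y : ℝ => Real.arctan y - y / (1 + y)) (Set.Ici 0) := by
    have hd : ∀ x : ℝ, 0 ≤ x → HasDerivAt (fun y : ℝ => Real.arctan y - y / (1 + y))
        (1 / (1 + x ^ 2) - (1 * (1 + x) - x * 1) / (1 + x) ^ 2) x := by
      intro x hx
      have h1 : HasDerivAt (fun y : ℝ => 1 + y) 1 x := (hasDerivAt_id x).const_add 1
      exact (Real.hasDerivAt_arctan x).sub ((hasDerivAt_id x).div h1 (by positivity))
    refine monotoneOn_of_deriv_nonneg (convex_Ici 0)
      (fun x hx => (hd x hx).continuousAt.continuousWithinAt)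
      (fun x hx => ?_) (fun x hx => ?_)
    · rw [interior_Ici] at hx; exact (hd x (le_of_lt hx)).differentiableAt.differentiableWithinAt
    · rw [interior_Ici] at hx
      have hx' : 0 < x := hx
      rw [(hd x hx'.le).deriv, sub_nonneg, div_le_div_iff₀ (by positivity) (by positivity)]
      nlinarith
  have := hm (Set.mem_Ici.mpr le_rfl) (Set.mem_Ici.mpr hy) hy
  simp at this
  linarith

lemma mpt_ge {a : ℝ} (ha : 0 < a) (K : ℕ) : (K : ℝ) - 1 / 2 ≤ mpt a K := by
  unfold mpt; linarith

lemma mpt_le {a : ℝ} (ha1 : a ≤ 1) (K : ℕ) : mpt a K ≤ K + 1 / 2 := by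
  unfold mpt; linarith

lemma phase_bound_neg {K X t d : ℝ} (hK : 1 ≤ K) (hX : K - 1 / 2 ≤ X) (hX' : X ≤ K + 1 / 2)
    (ht : 2 * Real.pi * (K + 1) ^ 2 ≤ t) (hd : d ≤ 0) (hd' : -(X / 2) ≤ d) :
    t * Real.arctan (d / (X + d)) - 2 * Real.pi * K * d ≤ d := by
  have hpi := Real.pi_gt_three
  have hX0 : 0 < X := by linarith
  have hXd : 0 < X + d := by linarith
  have h := div_one_add_le_arctan (y := (-d) / (X + d)) (div_nonneg (by linarith) hXd.le)
  have e : (-d) / (X + d) / (1 + (-d) / (X + d)) = (-d) / X := by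
    rw [show 1 + (-d) / (X + d) = X / (X + d) by field_simp; ring]; field_simp
  rw [e, neg_div, neg_div, Real.arctan_neg] at h
  have h2 : Real.arctan (d / (X + d)) ≤ d / X := by linarith
  have ht0 : 0 ≤ t := le_trans (by positivity) ht
  have h3 : t * Real.arctan (d / (X + d)) ≤ (t / X) * d := by
    calc _ ≤ t * (d / X) := by gcongr
      _ = _ := by ring
  have h4 : 2 * Real.pi * (K + 1) ≤ t / X := by
    rw [le_div_iff₀ hX0]
    refine le_trans ?_ ht
    have : (K + 1) * X ≤ (K + 1) ^ 2 := by nlinarith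
    nlinarith
  nlinarith

lemma phase_bound_pos {K X t d : ℝ} (hK : 1 ≤ K) (hX : K - 1 / 2 ≤ X)
    (ht0 : 0 ≤ t) (ht : t ≤ 2 * Real.pi * (K + 2) ^ 2) (hd : 0 ≤ d) :
    t * Real.arctan (d / (X + d)) - 2 * Real.pi * (K + 1) * d ≤ 1000 - d := by
  have hpi := Real.pi_gt_three
  have hpi2 := Real.pi_lt_d2
  have hX0 : 0 < X := by linarith
  have hXd : 0 < X + d := by linarith
  have h3 : t * Real.arctan (d / (X + d)) ≤ 2 * Real.pi * (K + 2) ^ 2 / (X + d) * d := by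
    calc _ ≤ t * (d / (X + d)) := by gcongr; exact arctan_le_self (by positivity)
      _ ≤ 2 * Real.pi * (K + 2) ^ 2 * (d / (X + d)) := by gcongr
      _ = _ := by ring
  rcases le_total 8 d with h8 | h8
  · have h4 : 2 * Real.pi * (K + 2) ^ 2 / (X + d) ≤ 2 * Real.pi * (K + 1 / 2) := by
      rw [div_le_iff₀ hXd]
      have : (K + 2) ^ 2 ≤ (K + 1 / 2) * (X + d) := by nlinarith
      nlinarith
    have : 2 * Real.pi * (K + 2) ^ 2 / (X + d) * d ≤ 2 * Real.pi * (K + 1 / 2) * d := by gcongr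
    nlinarith
  · have h4 : 2 * Real.pi * (K + 2) ^ 2 / (X + d) ≤ 2 * Real.pi * (K + 17) := by
      rw [div_le_iff₀ hXd]
      have : (K + 2) ^ 2 ≤ (K + 17) * (X + d) := by nlinarith
      nlinarith
    have h5 : 2 * Real.pi * (K + 2) ^ 2 / (X + d) * d ≤ 2 * Real.pi * (K + 17) * d := by gcongr
    have : 2 * Real.pi * 16 * d ≤ 2 * 3.15 * 16 * 8 := by gcongr
    nlinarith

/-- The constant in the pointwise bound for the remainder integrand. -/
noncomputable def cPh : ℝ := 4 * Real.exp 1000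

lemma cPh_pos : 0 < cPh := by unfold cPh; positivity

lemma half_rpow_neg_le {X σ : ℝ} (hX : 0 < X) (hσ : σ ≤ 1) :
    (X / 2) ^ (-σ) ≤ 2 * X ^ (-σ) := by
  rw [Real.div_rpow hX.le (by norm_num), Real.rpow_neg (by norm_num : (0:ℝ) ≤ 2), div_inv_eq_mul,
    mul_comm]
  gcongr
  calc (2:ℝ) ^ σ ≤ 2 ^ (1:ℝ) := by gcongr; norm_num
    _ = 2 := by simp

lemma norm_cpow_mul_phiK_le {a : ℝ} (ha : 0 < a) (ha1 : a ≤ 1) {K : ℕ} (hK : 1 ≤ K) {s : ℂ}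
    (hs : 0 ≤ s.re) (hs1 : s.re ≤ 1) (ht : 2 * Real.pi * ((K : ℝ) + 1) ^ 2 ≤ s.im)
    (ht' : s.im ≤ 2 * Real.pi * ((K : ℝ) + 2) ^ 2) {u : ℝ} (hu : 0 ≤ u) :
    ‖wL (mpt a K) u ^ (-s)‖ * ‖phiK a K (wL (mpt a K) u)‖ ≤
      cPh * (mpt a K) ^ (-s.re) * Real.exp (-|u - mpt a K / 2|) := by
  have hX := mpt_pos ha hK
  have hX1 := mpt_ge ha K
  have hX2 := mpt_le ha1 K
  have hK1 : (1 : ℝ) ≤ K := by exact_mod_cast hK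
  have hpi := Real.pi_gt_three
  have hu2 : mpt a K / 2 ≤ (wL (mpt a K) u).re := by rw [wL_re]; linarith
  have h1 := norm_cpow_neg_le (by linarith : 0 < mpt a K / 2) hu2 hs
  rw [arg_le_div (by linarith), wL_re, wL_im] at h1
  have h2 := norm_phiK_le a K u
  have h2' := norm_phiK_le' a K u
  set X := mpt a K
  have e : u + X / 2 = X + (u - X / 2) := by ring
  rw [e] at h1
  have h0 := half_rpow_neg_le hX hs1
  obtain ⟨d, hd⟩ : ∃ d, d = u - X / 2 := ⟨_, rfl⟩
  rw [← hd] at h1 h2 h2' ⊢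
  have hXσ : 0 < X ^ (-s.re) := Real.rpow_pos_of_pos hX _
  have main : ∀ c : ℝ, s.im * Real.arctan (d / (X + d)) + c ≤ 1000 - |d| →
      ‖phiK a K (wL X u)‖ ≤ 2 * Real.exp c →
      ‖wL X u ^ (-s)‖ * ‖phiK a K (wL X u)‖ ≤ cPh * X ^ (-s.re) * Real.exp (-|d|) := by
    intro c hc hp
    calc _ ≤ ((2 * X ^ (-s.re)) * Real.exp (s.im * Real.arctan (d / (X + d)))) *
          (2 * Real.exp c) := by
          gcongr; exact h1.trans (by gcongr)
      _ = 4 * X ^ (-s.re) * Real.exp (s.im * Real.arctan (d / (X + d)) + c) := by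
          rw [Real.exp_add]; ring
      _ ≤ 4 * X ^ (-s.re) * Real.exp (1000 - |d|) := by gcongr
      _ = _ := by rw [cPh, sub_eq_add_neg, Real.exp_add]; ring
  rcases le_total 0 d with h | h
  · refine main _ ?_ h2
    have := phase_bound_pos hK1 hX1 (le_trans (by positivity) ht) ht' h
    rw [abs_of_nonneg h]; linarith
  · refine main _ ?_ h2'
    have := phase_bound_neg hK1 hX1 hX2 ht h (by linarith)
    rw [abs_of_nonpos h]; linarith

lemma integral_exp_neg_mul_abs {c : ℝ} (hc : 0 < c) (b : ℝ) :
    ∫ u : ℝ, Real.exp (-(c * |u - b|)) = 2 / c := by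
  rw [integral_sub_right_eq_self (fun u : ℝ => Real.exp (-(c * |u|))) b,
    integral_comp_abs (f := fun x => Real.exp (-(c * x)))]
  have := exp_integral_Ioi_le c 0 hc
  simp only [sub_zero] at this
  rw [this]; field_simp

lemma integrable_exp_neg_mul_abs {c : ℝ} (hc : 0 < c) (b : ℝ) :
    Integrable (fun u : ℝ => Real.exp (-(c * |u - b|))) := by
  by_contra h
  have h1 := integral_undef h
  rw [integral_exp_neg_mul_abs hc] at h1
  have : 0 < 2 / c := by positivity
  linarith

lemma integrable_exp_neg_abs (b : ℝ) : Integrable (fun u : ℝ => Real.exp (-|u - b|)) := by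
  simpa using integrable_exp_neg_mul_abs one_pos b

lemma integral_exp_neg_abs (b : ℝ) : ∫ u : ℝ, Real.exp (-|u - b|) = 2 := by
  simpa using integral_exp_neg_mul_abs one_pos b

lemma norm_rMain_le {a : ℝ} (ha : 0 < a) (ha1 : a ≤ 1) {K : ℕ} (hK : 1 ≤ K) {s : ℂ}
    (hs : 0 ≤ s.re) (hs1 : s.re ≤ 1) (ht : 2 * Real.pi * ((K : ℝ) + 1) ^ 2 ≤ s.im)
    (ht' : s.im ≤ 2 * Real.pi * ((K : ℝ) + 2) ^ 2) :
    ‖rMain a s K‖ ≤ 4 * cPh * (mpt a K) ^ (-s.re) := by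
  have hX := mpt_pos ha hK
  have hc := cPh_pos
  rw [rMain, norm_neg]
  calc _ ≤ ∫ u in Set.Ioi (0 : ℝ), (cPh * (mpt a K) ^ (-s.re) * 2) *
        Real.exp (-|u - mpt a K / 2|) := by
        refine norm_integral_le_of_norm_le (((integrable_exp_neg_abs _).const_mul _).integrableOn)
          (ae_restrict_of_forall_mem measurableSet_Ioi fun u hu => ?_)
        rw [norm_mul, norm_mul]
        calc _ ≤ (cPh * (mpt a K) ^ (-s.re) * Real.exp (-|u - mpt a K / 2|)) * 2 := by
              refine mul_le_mul (norm_cpow_mul_phiK_le ha ha1 hK hs hs1 ht ht' (le_of_lt hu))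
                norm_one_add_I_le (by positivity) ?_
              have := Real.rpow_nonneg hX.le (-s.re)
              positivity
          _ = _ := by ring
    _ ≤ ∫ u : ℝ, (cPh * (mpt a K) ^ (-s.re) * 2) * Real.exp (-|u - mpt a K / 2|) := by
        refine setIntegral_le_integral ((integrable_exp_neg_abs _).const_mul _)
          (Eventually.of_forall fun u => ?_)
        have := Real.rpow_nonneg hX.le (-s.re)
        positivity
    _ = _ := by rw [integral_const_mul, integral_exp_neg_abs]; ring

lemma log_interp {A B θ : ℝ} (hA : 1 ≤ A) (hAB : A ≤ B) (hB : (B - A) ^ 2 ≤ 4 * B)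
    (h0 : 0 ≤ θ) (h1 : θ ≤ 1) :
    |Real.log ((1 - θ) * A + θ * B - θ * (1 - θ)) - ((1 - θ) * Real.log A + θ * Real.log B)| ≤
      4 / A := by
  have hA0 : 0 < A := by linarith
  have hB0 : 0 < B := by linarith
  set M := (1 - θ) * A + θ * B with hM
  have hMA : A ≤ M := by nlinarith
  have hq : θ * (1 - θ) ≤ 1 / 4 := by nlinarith [sq_nonneg (θ - 1 / 2)]
  have hq0 : 0 ≤ θ * (1 - θ) := mul_nonneg h0 (by linarith)
  have hMq : 3 / 4 * A ≤ M - θ * (1 - θ) := by nlinarith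
  have hMq0 : 0 < M - θ * (1 - θ) := by linarith
  have hM0 : 0 < M := by linarith
  rw [abs_le]
  constructor
  · have hc : (1 - θ) * Real.log A + θ * Real.log B ≤ Real.log M := by
      have := strictConcaveOn_log_Ioi.concaveOn.2 (Set.mem_Ioi.mpr hA0) (Set.mem_Ioi.mpr hB0)
        (by linarith : 0 ≤ 1 - θ) h0 (by ring)
      simpa using this
    have h2 := Real.one_sub_inv_le_log_of_pos (div_pos hMq0 hM0)
    rw [Real.log_div hMq0.ne' hM0.ne', inv_div] at h2
    have h3 : M / (M - θ * (1 - θ)) ≤ 1 + 4 / A := by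
      rw [div_le_iff₀ hMq0]
      have : 4 / A * (3 / 4 * A) ≤ 4 / A * (M - θ * (1 - θ)) := by gcongr
      have e : 4 / A * (3 / 4 * A) = 3 := by field_simp
      linarith
    linarith
  · have h2 : Real.log (M - θ * (1 - θ)) ≤ Real.log M := Real.log_le_log hMq0 (by linarith)
    have h3 := Real.log_le_sub_one_of_pos (div_pos hM0 hA0)
    have h4 := Real.one_sub_inv_le_log_of_pos (div_pos hB0 hA0)
    rw [Real.log_div hM0.ne' hA0.ne'] at h3
    rw [Real.log_div hB0.ne' hA0.ne', inv_div] at h4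
    have h5 : M / A - 1 - θ * (1 - A / B) ≤ 4 / A := by
      have e : M / A - 1 - θ * (1 - A / B) = θ * ((B - A) ^ 2 / (A * B)) := by
        rw [hM]; field_simp; ring
      have h6 : (B - A) ^ 2 / (A * B) ≤ 4 / A := by
        rw [div_le_div_iff₀ (by positivity) hA0]; nlinarith
      have h7 : 0 ≤ (B - A) ^ 2 / (A * B) := by positivity
      rw [e]; nlinarith
    nlinarith

lemma sum_inv_sq_le {y : ℝ} (hy : 0 < y) (n : ℕ) :
    ∑ k ∈ range n, 1 / (((k : ℝ) + 1 / 2) ^ 2 + y ^ 2) ≤ 2 / y := by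
  have h : ∀ n : ℕ, ∑ k ∈ range n, 1 / (((k : ℝ) + 1 / 2) ^ 2 + y ^ 2) ≤ 2 / y - 2 / (n + y) := by
    intro n
    induction n with
    | zero => simp
    | succ n ih =>
      rw [sum_range_succ]
      have : 1 / (((n : ℝ) + 1 / 2) ^ 2 + y ^ 2) ≤ 2 / (n + y) - 2 / (((n + 1 : ℕ) : ℝ) + y) := by
        push_cast
        have hn : (0 : ℝ) ≤ n := n.cast_nonneg
        rw [div_sub_div _ _ (by positivity) (by positivity),
          div_le_div_iff₀ (by positivity) (by positivity)]
        nlinarith [sq_nonneg ((n : ℝ) + 1 / 2 - y)]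
      linarith
  have := h n
  have h2 : 0 ≤ 2 / ((n : ℝ) + y) := by positivity
  linarith

lemma log_norm_GammaSeq {z : ℂ} (hz : 0 < z.re) {n : ℕ} (hn : 0 < n) :
    Real.log ‖GammaSeq z n‖ = z.re * Real.log n + Real.log n.factorial -
      ∑ j ∈ range (n + 1), Real.log (normSq (z + j)) / 2 := by
  have hz' : ∀ j : ℕ, z + j ≠ 0 := fun j h => by
    have := congrArg re h
    simp at this
    have hj : (0 : ℝ) ≤ j := j.cast_nonneg
    linarith
  have hn' : (0 : ℝ) < n := by exact_mod_cast hn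
  rw [GammaSeq, norm_div, norm_mul, norm_natCast_cpow_of_pos hn, norm_natCast, norm_prod,
    Real.log_div (by positivity) (prod_ne_zero_iff.mpr fun j _ => norm_ne_zero_iff.mpr (hz' j)),
    Real.log_mul (by positivity) (by positivity), Real.log_rpow hn',
    Real.log_prod (fun j _ => norm_ne_zero_iff.mpr (hz' j))]
  congr 1
  refine sum_congr rfl fun j _ => ?_
  rw [normSq_eq_norm_sq, Real.log_pow]; push_cast; ring

lemma log_norm_Gamma_interp {y θ : ℝ} (hy : 1 ≤ y) (h0 : 0 ≤ θ) (h1 : θ ≤ 1) :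
    |Real.log ‖Gamma ((1 / 2 + θ : ℝ) - y * I)‖ - ((1 - θ) * Real.log ‖Gamma ((1 / 2 : ℝ) - y * I)‖
      + θ * Real.log ‖Gamma ((3 / 2 : ℝ) - y * I)‖)| ≤ 4 / y := by
  have hlim : ∀ x : ℝ, 0 < x → Tendsto (fun n : ℕ => Real.log ‖GammaSeq (x - y * I) n‖) atTop
      (nhds (Real.log ‖Gamma (x - y * I)‖)) := by
    intro x hx
    have hne : Gamma ((x : ℂ) - y * I) ≠ 0 := Gamma_ne_zero_of_re_pos (by simpa using hx)
    exact (Real.continuousAt_log (norm_ne_zero_iff.mpr hne)).tendsto.comp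
      (GammaSeq_tendsto_Gamma _).norm
  refine le_of_tendsto (((hlim _ (by linarith)).sub (((hlim _ (by norm_num)).const_mul _).add
    ((hlim _ (by norm_num)).const_mul _))).abs) ?_
  filter_upwards [eventually_gt_atTop 0] with n hn
  rw [log_norm_GammaSeq (by simp; linarith) hn, log_norm_GammaSeq (by simp) hn,
    log_norm_GammaSeq (by simp) hn]
  have e : ∀ x : ℝ, ((x : ℂ) - y * I).re = x := by intro x; simp
  have e2 : ∀ (x : ℝ) (j : ℕ), normSq ((x : ℂ) - y * I + j) = (x + j) ^ 2 + y ^ 2 := by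
    intro x j; simp [normSq_apply]; ring
  simp only [e, e2]
  have hsum : (1 / 2 + θ) * Real.log n + Real.log n.factorial -
      ∑ j ∈ range (n + 1), Real.log ((1 / 2 + θ + j) ^ 2 + y ^ 2) / 2 -
      ((1 - θ) * (1 / 2 * Real.log n + Real.log n.factorial -
        ∑ j ∈ range (n + 1), Real.log ((1 / 2 + (j:ℝ)) ^ 2 + y ^ 2) / 2) +
      θ * (3 / 2 * Real.log n + Real.log n.factorial -
        ∑ j ∈ range (n + 1), Real.log ((3 / 2 + (j:ℝ)) ^ 2 + y ^ 2) / 2)) =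
      -∑ j ∈ range (n + 1), (Real.log ((1 / 2 + θ + j) ^ 2 + y ^ 2) -
        ((1 - θ) * Real.log ((1 / 2 + (j:ℝ)) ^ 2 + y ^ 2) +
        θ * Real.log ((3 / 2 + (j:ℝ)) ^ 2 + y ^ 2))) / 2 := by
    simp only [sub_div, add_div, sum_sub_distrib, sum_add_distrib, mul_div_assoc, ← mul_sum]
    ring
  rw [hsum, abs_neg]
  calc _ ≤ ∑ j ∈ range (n + 1), 2 * (1 / (((j:ℝ) + 1 / 2) ^ 2 + y ^ 2)) := by
        refine (abs_sum_le_sum_abs _ _).trans (sum_le_sum fun j _ => ?_)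
        have hj : (0 : ℝ) ≤ j := j.cast_nonneg
        have h := log_interp (A := (1 / 2 + (j:ℝ)) ^ 2 + y ^ 2) (B := (3 / 2 + (j:ℝ)) ^ 2 + y ^ 2)
          (by nlinarith) (by nlinarith) (by nlinarith) h0 h1
        have e3 : (1 - θ) * ((1 / 2 + (j:ℝ)) ^ 2 + y ^ 2) + θ * ((3 / 2 + (j:ℝ)) ^ 2 + y ^ 2) -
          θ * (1 - θ) = (1 / 2 + θ + j) ^ 2 + y ^ 2 := by ring
        rw [e3] at h
        rw [abs_div, abs_of_pos (two_pos : (0:ℝ) < 2)]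
        have e4 : ((j:ℝ) + 1 / 2) ^ 2 = (1 / 2 + (j:ℝ)) ^ 2 := by ring
        rw [e4, div_le_iff₀ two_pos]
        refine h.trans (le_of_eq ?_); ring
    _ ≤ 2 * (2 / y) := by
        rw [← mul_sum]
        exact mul_le_mul_of_nonneg_left (sum_inv_sq_le (by linarith) _) zero_le_two
    _ = _ := by ring

lemma norm_Gamma_half_sq (y : ℝ) :
    ‖Gamma ((1 / 2 : ℝ) - y * I)‖ ^ 2 = Real.pi / Real.cosh (Real.pi * y) := by
  have h := Gamma_mul_Gamma_one_sub ((1 / 2 : ℝ) - y * I)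
  have e : 1 - ((1 / 2 : ℝ) - y * I) = (starRingEnd ℂ) ((1 / 2 : ℝ) - y * I) := by
    simp [Complex.ext_iff]; norm_num
  have e2 : (Real.pi : ℂ) * ((1 / 2 : ℝ) - y * I) = Real.pi / 2 - (Real.pi * y : ℝ) * I := by
    push_cast; ring
  rw [e, Gamma_conj, mul_conj, e2, Complex.sin_pi_div_two_sub, cos_mul_I, normSq_eq_norm_sq] at h
  exact_mod_cast h

lemma log_norm_Gamma_half {y : ℝ} (hy : 1 ≤ y) :
    |2 * Real.log ‖Gamma ((1 / 2 : ℝ) - y * I)‖ - (Real.log (2 * Real.pi) - Real.pi * y)| ≤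
      1 / y := by
  have hpi := Real.pi_gt_three
  have h := norm_Gamma_half_sq y
  have hc : Real.cosh (Real.pi * y) =
      Real.exp (Real.pi * y) * (1 + Real.exp (-(2 * (Real.pi * y)))) / 2 := by
    rw [Real.cosh_eq, mul_add, ← Real.exp_add]; ring_nf
  have h2 : 2 * Real.log ‖Gamma ((1 / 2 : ℝ) - y * I)‖ = Real.log (Real.pi / Real.cosh (Real.pi * y)) := by
    rw [← h, Real.log_pow]; norm_num
  have hexp := Real.exp_pos (-(2 * (Real.pi * y)))
  rw [h2, hc, show Real.pi / (Real.exp (Real.pi * y) * (1 + Real.exp (-(2 * (Real.pi * y)))) / 2) =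
    (2 * Real.pi) / (Real.exp (Real.pi * y) * (1 + Real.exp (-(2 * (Real.pi * y))))) by field_simp,
    Real.log_div (by positivity) (by positivity),
    Real.log_mul (Real.exp_pos _).ne' (by positivity), Real.log_exp]
  have h3 : Real.log (1 + Real.exp (-(2 * (Real.pi * y)))) ≤ Real.exp (-(2 * (Real.pi * y))) := by
    have := Real.log_le_sub_one_of_pos (by positivity : 0 < 1 + Real.exp (-(2 * (Real.pi * y))))
    linarith
  have h4 : 0 ≤ Real.log (1 + Real.exp (-(2 * (Real.pi * y)))) := Real.log_nonneg (by linarith)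
  have h5 : Real.exp (-(2 * (Real.pi * y))) ≤ 1 / y := by
    rw [Real.exp_neg, ← one_div]
    apply one_div_le_one_div_of_le (by linarith)
    have := Real.add_one_le_exp (2 * (Real.pi * y))
    nlinarith
  rw [abs_le]; constructor <;> linarith

/-- Stirling's formula for the modulus of `Γ` on vertical lines. -/
lemma log_norm_Gamma {y θ : ℝ} (hy : 1 ≤ y) (h0 : 0 ≤ θ) (h1 : θ ≤ 1) :
    |2 * Real.log ‖Gamma ((1 / 2 + θ : ℝ) - y * I)‖ -
      (Real.log (2 * Real.pi) - Real.pi * y + 2 * θ * Real.log y)| ≤ 10 / y := by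
  have hint := log_norm_Gamma_interp hy h0 h1
  have hhalf := log_norm_Gamma_half hy
  have hy0 : 0 < y := by linarith
  have hz : ((1 / 2 : ℝ) : ℂ) - y * I ≠ 0 := fun h => by
    have := congrArg re h; simp at this
  have h32 : Real.log ‖Gamma ((3 / 2 : ℝ) - y * I)‖ =
      Real.log ((1 / 2) ^ 2 + y ^ 2) / 2 + Real.log ‖Gamma ((1 / 2 : ℝ) - y * I)‖ := by
    have e : ((3 / 2 : ℝ) : ℂ) - y * I = ((1 / 2 : ℝ) : ℂ) - y * I + 1 := by push_cast; ring
    have hn : Real.log ‖((1 / 2 : ℝ) : ℂ) - y * I‖ = Real.log ((1 / 2) ^ 2 + y ^ 2) / 2 := by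
      have : ‖((1 / 2 : ℝ) : ℂ) - y * I‖ ^ 2 = (1 / 2) ^ 2 + y ^ 2 := by
        rw [← normSq_eq_norm_sq, normSq_apply]; simp; ring
      rw [← this, Real.log_pow]; push_cast; ring
    rw [e, Gamma_add_one _ hz, norm_mul, Real.log_mul (norm_ne_zero_iff.mpr hz)
      (norm_ne_zero_iff.mpr (Gamma_ne_zero_of_re_pos (by simp))), hn]
  have hlog : |Real.log ((1 / 2) ^ 2 + y ^ 2) - 2 * Real.log y| ≤ 1 / y := by
    have e : (1 / 2 : ℝ) ^ 2 + y ^ 2 = y ^ 2 * (1 + 1 / (4 * y ^ 2)) := by field_simp; ring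
    have hp : 0 < 1 / (4 * y ^ 2) := by positivity
    rw [e, Real.log_mul (by positivity) (by positivity), Real.log_pow]
    have h3 := Real.log_le_sub_one_of_pos (by positivity : 0 < 1 + 1 / (4 * y ^ 2))
    have h4 : 0 ≤ Real.log (1 + 1 / (4 * y ^ 2)) := Real.log_nonneg (by linarith)
    have h5 : 1 / (4 * y ^ 2) ≤ 1 / y := one_div_le_one_div_of_le hy0 (by nlinarith)
    push_cast
    rw [abs_le]; constructor <;> linarith
  rw [h32] at hint
  have hy1 : 0 ≤ 1 / y := by positivity
  have e4 : 4 / y = 4 * (1 / y) := by ring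
  have e10 : 10 / y = 10 * (1 / y) := by ring
  rw [e4] at hint
  rw [e10]
  rw [abs_le] at *
  constructor <;> nlinarith

lemma norm_gam (s : ℂ) : ‖gam s‖ =
    (2 * Real.pi) ^ (s.re - 1) * Real.exp (Real.pi * s.im / 2) * ‖Gamma (1 - s)‖ := by
  rw [gam, norm_mul, norm_mul, norm_exp]
  congr 2
  · have : (2 * Real.pi : ℂ) = ((2 * Real.pi : ℝ) : ℂ) := by push_cast; ring
    rw [this, norm_cpow_eq_rpow_re_of_pos (by positivity)]; simp
  · congr 1
    have : I * Real.pi * (1 - s) / 2 = ((Real.pi / 2 : ℝ) : ℂ) * (I * (1 - s)) := by push_cast; ring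
    rw [this, re_ofReal_mul]; simp; ring

lemma gam_ne_zero {s : ℂ} (hs : s.re < 1) : gam s ≠ 0 := by
  have hpi := Real.pi_pos
  rw [← norm_ne_zero_iff, norm_gam]
  have := norm_ne_zero_iff.mpr (Gamma_ne_zero_of_re_pos (s := 1 - s) (by simp; linarith))
  positivity

lemma log_norm_gam {s : ℂ} (h0 : -(1 / 2) ≤ s.re) (h1 : s.re ≤ 1 / 2) (ht : 1 ≤ s.im) :
    |2 * Real.log ‖gam s‖ - (1 - 2 * s.re) * Real.log (s.im / (2 * Real.pi))| ≤ 10 / s.im := by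
  have hpi := Real.pi_pos
  have h := log_norm_Gamma ht (θ := 1 / 2 - s.re) (by linarith) (by linarith)
  have e : ((1 / 2 + (1 / 2 - s.re) : ℝ) : ℂ) - s.im * I = 1 - s := by
    apply Complex.ext <;> simp; ring
  rw [e] at h
  have hne := norm_ne_zero_iff.mpr (Gamma_ne_zero_of_re_pos (s := 1 - s) (by simp; linarith))
  rw [norm_gam, Real.log_mul (by positivity) hne, Real.log_mul (by positivity) (by positivity),
    Real.log_rpow (by positivity), Real.log_exp, Real.log_div (by linarith) (by positivity)]
  refine le_of_eq_of_le ?_ h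
  congr 1; ring

/-- A constant for estimates of the Gamma factor. -/
noncomputable def cGa : ℝ := 10 * Real.exp 10

lemma cGa_pos : 0 < cGa := by unfold cGa; positivity

lemma norm_gam_sq_eq {s : ℂ} (h0 : -(1 / 2) ≤ s.re) (h1 : s.re ≤ 1 / 2) (ht : 1 ≤ s.im) :
    ∃ δ : ℝ, |δ| ≤ 10 / s.im ∧
      ‖gam s‖ ^ 2 = (s.im / (2 * Real.pi)) ^ (1 - 2 * s.re) * Real.exp δ := by
  have hpi := Real.pi_pos
  have hp : 0 < s.im / (2 * Real.pi) := by positivity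
  have hn : 0 < ‖gam s‖ := norm_pos_iff.mpr (gam_ne_zero (by linarith))
  refine ⟨_, log_norm_gam h0 h1 ht, ?_⟩
  rw [Real.rpow_def_of_pos hp, ← Real.exp_add, ← Real.exp_log hn, ← Real.exp_nat_mul, Real.exp_log hn]
  congr 1; push_cast; ring

lemma abs_exp_sub_one_le_mul {δ : ℝ} : |Real.exp δ - 1| ≤ |δ| * Real.exp |δ| := by
  have h1 := Real.add_one_le_exp δ
  have h2 := Real.add_one_le_exp (-δ)
  have h3 : Real.exp δ * Real.exp (-δ) = 1 := by rw [← Real.exp_add]; simp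
  have hp := Real.exp_pos δ
  rcases le_total 0 δ with h | h
  · rw [abs_of_nonneg h, abs_of_nonneg (by linarith)]; nlinarith
  · rw [abs_of_nonpos h, abs_of_nonpos (by rw [sub_nonpos]; exact Real.exp_le_one_iff.mpr h)]
    have : 1 ≤ Real.exp (-δ) := Real.one_le_exp (by linarith)
    nlinarith

lemma norm_gam_sq_sub_le {s : ℂ} (h0 : -(1 / 2) ≤ s.re) (h1 : s.re ≤ 1 / 2) (ht : 1 ≤ s.im) :
    |‖gam s‖ ^ 2 - (s.im / (2 * Real.pi)) ^ (1 - 2 * s.re)| ≤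
      cGa * ((s.im / (2 * Real.pi)) ^ (1 - 2 * s.re) / s.im) := by
  have hpi := Real.pi_pos
  obtain ⟨δ, hδ, he⟩ := norm_gam_sq_eq h0 h1 ht
  have hp : 0 ≤ (s.im / (2 * Real.pi)) ^ (1 - 2 * s.re) := by positivity
  have h10 : |δ| ≤ 10 := hδ.trans (div_le_self (by norm_num) ht)
  rw [he, ← mul_sub_one, abs_mul, abs_of_nonneg hp]
  calc _ ≤ (s.im / (2 * Real.pi)) ^ (1 - 2 * s.re) * (10 / s.im * Real.exp 10) := by
        gcongr
        exact abs_exp_sub_one_le_mul.trans (by gcongr)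
    _ = _ := by rw [cGa]; ring

lemma gam_add_one {s : ℂ} (hs : s ≠ 0) : gam (s + 1) = 2 * Real.pi * I / s * gam s := by
  have h2 : (2 * Real.pi : ℂ) ≠ 0 := by
    have := Real.pi_ne_zero
    simp [this]
  have hG : Gamma (1 - s) = -s * Gamma (-s) := by
    rw [← Gamma_add_one _ (neg_ne_zero.mpr hs)]; congr 1; ring
  have hexp : cexp (I * Real.pi * (1 - (s + 1)) / 2) = cexp (I * Real.pi * (1 - s) / 2) * (-I) := by
    rw [show I * Real.pi * (1 - (s + 1)) / 2 = I * Real.pi * (1 - s) / 2 + (-(Real.pi / 2 * I)) by ring,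
      Complex.exp_add, Complex.exp_neg, exp_pi_div_two_mul_I, inv_I]
  rw [gam, gam, hG, hexp, show s + 1 - 1 = (s - 1) + 1 by ring, cpow_add _ _ h2, cpow_one,
    show 1 - (s + 1) = -s by ring]
  field_simp

lemma norm_gam_le_left {s : ℂ} (h0 : -(1 / 2) ≤ s.re) (h1 : s.re ≤ 1 / 2) (ht : 1 ≤ s.im) :
    ‖gam s‖ ≤ Real.exp 5 * s.im ^ (1 / 2 - s.re) := by
  have hpi := Real.pi_gt_three
  obtain ⟨δ, hδ, he⟩ := norm_gam_sq_eq h0 h1 ht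
  have h10 : δ ≤ 10 := (le_abs_self _).trans (hδ.trans (div_le_self (by norm_num) ht))
  refine le_of_sq_le_sq ?_ (by positivity) |>.trans le_rfl
  rw [he, mul_pow, ← Real.rpow_natCast (s.im ^ _), ← Real.rpow_mul (by linarith), mul_comm,
    ← Real.exp_nat_mul]
  have e : (1 / 2 - s.re) * ((2 : ℕ) : ℝ) = 1 - 2 * s.re := by push_cast; ring
  rw [e]
  gcongr
  · push_cast; linarith
  · linarith
  · exact div_le_self (by linarith) (by linarith)

lemma norm_gam_le {s : ℂ} (h0 : -(1 / 2) ≤ s.re) (h1 : s.re ≤ 3 / 2) (ht : 1 ≤ s.im) :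
    ‖gam s‖ ≤ cGa * s.im ^ (1 / 2 - s.re) := by
  have hpi := Real.pi_pos
  have hpi2 := Real.pi_lt_d2
  have he : Real.exp 5 * 7 ≤ cGa := by
    have : Real.exp 5 ≤ Real.exp 10 := Real.exp_le_exp.mpr (by norm_num)
    have := Real.exp_pos 5
    unfold cGa; nlinarith
  have he0 := Real.exp_pos 5
  have hs0 : 0 < s.im := by linarith
  rcases le_total s.re (1 / 2) with h | h
  · refine (norm_gam_le_left h0 h ht).trans ?_
    gcongr
    linarith
  · have hz : s - 1 ≠ 0 := fun h => by
      have := congrArg im h; simp at this; linarith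
    have e := gam_add_one hz
    rw [sub_add_cancel] at e
    have hl := norm_gam_le_left (s := s - 1) (by simp; linarith) (by simp; linarith) (by simpa using ht)
    have him : s.im ≤ ‖s - 1‖ := by
      have := (le_abs_self _).trans (abs_im_le_norm (s - 1)); simpa using this
    simp only [sub_re, one_re, sub_im, one_im, sub_zero] at hl
    rw [e, norm_mul, norm_div]
    have h2 : ‖(2 * Real.pi * I : ℂ)‖ = 2 * Real.pi := by
      simp [abs_of_pos hpi]
    rw [h2]
    calc _ ≤ 2 * Real.pi / s.im * (Real.exp 5 * s.im ^ (1 / 2 - (s.re - 1))) := by gcongr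
      _ = 2 * Real.pi * Real.exp 5 * s.im ^ (1 / 2 - s.re) := by
          rw [show 1 / 2 - (s.re - 1) = 1 / 2 - s.re + 1 by ring, Real.rpow_add_one hs0.ne']
          field_simp
      _ ≤ _ := by gcongr; nlinarith

lemma differentiableAt_gam {s : ℂ} (hs : s.im ≠ 0) : DifferentiableAt ℂ gam s := by
  have hpi := Real.pi_ne_zero
  unfold gam
  have hG : DifferentiableAt ℂ (fun s => Gamma (1 - s)) s := by
    refine DifferentiableAt.comp s (differentiableAt_Gamma (1 - s) fun m h => ?_) (by fun_prop)
    have := congrArg im h; simp at this; exact hs this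
  refine DifferentiableAt.mul (DifferentiableAt.mul ?_ (by fun_prop)) hG
  exact DifferentiableAt.const_cpow (by fun_prop) (Or.inl (by simp [hpi]))

/-- The function `gam(s) z^s`, whose vertical integrals are estimated by shifting to the right. -/
noncomputable def gz (z s : ℂ) : ℂ := gam s * z ^ s

lemma gz_add_one {z s : ℂ} (hz : z ≠ 0) (hs : s ≠ 0) :
    gz z (s + 1) = 2 * Real.pi * I * z / s * gz z s := by
  rw [gz, gz, gam_add_one hs, cpow_add _ _ hz, cpow_one]; ring

lemma differentiableAt_gz {z s : ℂ} (hz : z ≠ 0) (hs : s.im ≠ 0) : DifferentiableAt ℂ (gz z) s :=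
  (differentiableAt_gam hs).mul (DifferentiableAt.const_cpow (by fun_prop) (Or.inl hz))

lemma norm_gz_add_nat_le {z s : ℂ} (hz : z ≠ 0) {q τ : ℝ} (hτ : 0 < τ) (hs : τ ≤ s.im)
    (hq : 2 * Real.pi * ‖z‖ ≤ q * τ) (k : ℕ) : ‖gz z (s + k)‖ ≤ q ^ k * ‖gz z s‖ := by
  have hq0 : 0 ≤ q := by
    by_contra h
    have : q * τ < 0 := mul_neg_of_neg_of_pos (not_le.mp h) hτ
    have : 0 ≤ 2 * Real.pi * ‖z‖ := by have := Real.pi_pos; positivity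
    linarith
  induction k with
  | zero => simp
  | succ k ih =>
    have him : (s + k).im = s.im := by simp
    have hne : s + k ≠ 0 := fun h => by
      have := congrArg im h; rw [him] at this; simp at this; linarith
    have hn : τ ≤ ‖s + k‖ := by
      have := (le_abs_self _).trans (abs_im_le_norm (s + k)); rw [him] at this; linarith
    have hb : ‖(2 * Real.pi * I * z / (s + k) : ℂ)‖ ≤ q := by
      rw [norm_div, norm_mul, div_le_iff₀ (by linarith)]
      have h2 : ‖(2 * Real.pi * I : ℂ)‖ = 2 * Real.pi := by
        simp [abs_of_pos Real.pi_pos]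
      rw [h2]
      exact hq.trans (by gcongr)
    rw [Nat.cast_succ, ← add_assoc, gz_add_one hz hne, norm_mul, pow_succ]
    calc _ ≤ q * (q ^ k * ‖gz z s‖) := by gcongr
      _ = _ := by ring

lemma norm_gz_le {z s : ℂ} (hz : z ≠ 0) {σ : ℝ} (h0 : 0 ≤ σ) (h1 : σ ≤ 1 / 2) (hs : σ ≤ s.re)
    (hs1 : s.re ≤ σ + 1) (ht : 1 ≤ s.im) (hzs : ‖z‖ ≤ s.im) :
    ‖gz z s‖ ≤ cGa * (‖z‖ ^ σ * Real.exp (-(s.im * arg z)) * s.im ^ (1 / 2 - σ)) := by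
  have hz0 : 0 < ‖z‖ := norm_pos_iff.mpr hz
  have ht0 : 0 < s.im := by linarith
  have hg := norm_gam_le (s := s) (by linarith) (by linarith) ht
  rw [gz, norm_mul, norm_cpow_of_ne_zero hz, div_eq_mul_inv, ← Real.exp_neg]
  have hpow : s.im ^ (1 / 2 - s.re) * ‖z‖ ^ s.re ≤ s.im ^ (1 / 2 - σ) * ‖z‖ ^ σ := by
    have e1 : s.im ^ (1 / 2 - s.re) = s.im ^ (1 / 2 - σ) * s.im ^ (-(s.re - σ)) := by
      rw [← Real.rpow_add ht0]; congr 1; ring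
    have e2 : ‖z‖ ^ s.re = ‖z‖ ^ σ * ‖z‖ ^ (s.re - σ) := by
      rw [← Real.rpow_add hz0]; congr 1; ring
    have h3 : s.im ^ (-(s.re - σ)) * ‖z‖ ^ (s.re - σ) ≤ 1 := by
      calc _ ≤ s.im ^ (-(s.re - σ)) * s.im ^ (s.re - σ) := by
            gcongr
        _ = 1 := by rw [← Real.rpow_add ht0]; simp
    calc _ = (s.im ^ (1 / 2 - σ) * ‖z‖ ^ σ) * (s.im ^ (-(s.re - σ)) * ‖z‖ ^ (s.re - σ)) := by
          rw [e1, e2]; ring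
      _ ≤ _ := mul_le_of_le_one_right (by positivity) h3
  have hc := cGa_pos
  have e : -(arg z * s.im) = -(s.im * arg z) := by ring
  rw [e]
  calc _ ≤ cGa * s.im ^ (1 / 2 - s.re) * (‖z‖ ^ s.re * Real.exp (-(s.im * arg z))) := by gcongr
    _ = cGa * Real.exp (-(s.im * arg z)) * (s.im ^ (1 / 2 - s.re) * ‖z‖ ^ s.re) := by ring
    _ ≤ cGa * Real.exp (-(s.im * arg z)) * (s.im ^ (1 / 2 - σ) * ‖z‖ ^ σ) := by gcongr
    _ = _ := by ring

lemma gz_vertical_step {z : ℂ} (hz : z ≠ 0) {x τ₁ τ₂ B₁ B₂ : ℝ} (h1 : 0 < τ₁) (h12 : τ₁ ≤ τ₂)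
    (hB₁ : ∀ y ∈ Set.Icc x (x + 1), ‖gz z (y + τ₁ * I)‖ ≤ B₁)
    (hB₂ : ∀ y ∈ Set.Icc x (x + 1), ‖gz z (y + τ₂ * I)‖ ≤ B₂) :
    ‖∫ t in τ₁..τ₂, gz z (x + t * I)‖ ≤ B₁ + B₂ + ‖∫ t in τ₁..τ₂, gz z ((x + 1 : ℝ) + t * I)‖ := by
  have h := rectInt_eq_zero (f := gz z) (x₀ := x) (x₁ := x + 1) (y₀ := τ₁) (y₁ := τ₂) (by
    intro s hs
    have him := hs.2
    rw [Set.mem_preimage, Set.uIcc_of_le h12] at him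
    exact (differentiableAt_gz hz (by linarith [him.1])).differentiableWithinAt)
  have hb : ∀ τ B : ℝ, (∀ y ∈ Set.Icc x (x + 1), ‖gz z (y + τ * I)‖ ≤ B) →
      ‖∫ y in x..(x + 1), gz z (y + τ * I)‖ ≤ B := by
    intro τ B hB
    have := intervalIntegral.norm_integral_le_of_norm_le_const (a := x) (b := x + 1)
      (f := fun y : ℝ => gz z (y + τ * I)) (C := B) (fun y hy => by
        rw [Set.uIoc_of_le (by linarith)] at hy; exact hB y ⟨hy.1.le, hy.2⟩)
    simpa using this
  have b1 := hb _ _ hB₁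
  have b2 := hb _ _ hB₂
  unfold rectInt at h
  set J1 := ∫ y in x..(x + 1), gz z (y + τ₁ * I)
  set J2 := ∫ y in x..(x + 1), gz z (y + τ₂ * I)
  set V1 := ∫ t in τ₁..τ₂, gz z ((x + 1 : ℝ) + t * I)
  set V0 := ∫ t in τ₁..τ₂, gz z (x + t * I)
  have e : V0 = -I * (J1 - J2) + V1 := by linear_combination I * h - (V1 - V0) * I_sq
  rw [e]
  refine (norm_add_le _ _).trans ?_
  rw [norm_mul, norm_neg, norm_I, one_mul]
  have := norm_sub_le J1 J2
  linarith

/-- Vertical integrals of `gam(s) z^s` above the saddle, by repeated shifts to the right. -/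
lemma norm_integral_gz_le {z : ℂ} (hz : z ≠ 0) {σ : ℝ} (h0 : 0 ≤ σ) (h1 : σ ≤ 1 / 2)
    {τ₁ τ₂ q : ℝ} (ht1 : 1 ≤ τ₁) (ht12 : τ₁ ≤ τ₂) (hq1 : q < 1)
    (hq : 2 * Real.pi * ‖z‖ ≤ q * τ₁) :
    ‖∫ t in τ₁..τ₂, gz z (σ + t * I)‖ ≤ cGa * (‖z‖ ^ σ * Real.exp (-(τ₁ * arg z)) * τ₁ ^ (1 / 2 - σ) +
      ‖z‖ ^ σ * Real.exp (-(τ₂ * arg z)) * τ₂ ^ (1 / 2 - σ)) / (1 - q) := by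
  have hpi := Real.pi_gt_three
  have hz0 : 0 < ‖z‖ := norm_pos_iff.mpr hz
  have hq0 : 0 < q := by
    by_contra h
    have : q * τ₁ ≤ 0 := mul_nonpos_of_nonpos_of_nonneg (not_lt.mp h) (by linarith)
    have : 0 < 2 * Real.pi * ‖z‖ := by positivity
    linarith
  have hzt : ‖z‖ ≤ τ₁ := by nlinarith
  set b : ℝ → ℝ := fun τ => cGa * (‖z‖ ^ σ * Real.exp (-(τ * arg z)) * τ ^ (1 / 2 - σ)) with hb
  have hF : ∀ τ, τ₁ ≤ τ → ∀ k : ℕ, ∀ y ∈ Set.Icc (σ + k) (σ + k + 1), ‖gz z (y + τ * I)‖ ≤ q ^ k * b τ := by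
    intro τ hτ k y hy
    have e : (y : ℂ) + τ * I = ((y - k : ℝ) + τ * I) + k := by push_cast; ring
    have him : (((y - k : ℝ) : ℂ) + τ * I).im = τ := by simp
    have hre : (((y - k : ℝ) : ℂ) + τ * I).re = y - k := by simp
    rw [e]
    refine (norm_gz_add_nat_le hz (by linarith) (by rw [him]; exact hτ) hq k).trans ?_
    have := norm_gz_le hz (s := ((y - k : ℝ) : ℂ) + τ * I) h0 h1 (by rw [hre]; linarith [hy.1])
      (by rw [hre]; linarith [hy.2]) (by rw [him]; linarith) (by rw [him]; linarith)
    rw [him] at this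
    gcongr
  set V : ℕ → ℝ := fun k => ‖∫ t in τ₁..τ₂, gz z ((σ + k : ℝ) + t * I)‖ with hV
  have hstep : ∀ k, V k ≤ q ^ k * (b τ₁ + b τ₂) + V (k + 1) := by
    intro k
    have := gz_vertical_step hz (by linarith) ht12 (hF τ₁ le_rfl k) (hF τ₂ ht12 k)
    have e : σ + ((k + 1 : ℕ) : ℝ) = σ + k + 1 := by push_cast; ring
    simp only [hV, e]
    linarith
  have hsum : ∀ n : ℕ, V 0 ≤ (∑ k ∈ range n, q ^ k) * (b τ₁ + b τ₂) + V n := by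
    intro n
    induction n with
    | zero => simp
    | succ n ih => rw [sum_range_succ]; have := hstep n; linarith
  obtain ⟨M, hM⟩ : ∃ M, ∀ t ∈ Set.Icc τ₁ τ₂, ‖gz z (σ + t * I)‖ ≤ M := by
    have hc : ContinuousOn (fun t : ℝ => gz z (σ + t * I)) (Set.Icc τ₁ τ₂) := by
      intro t ht
      have h3 : ContinuousAt (gz z) (σ + t * I) :=
        (differentiableAt_gz hz (by simp; linarith [ht.1])).continuousAt
      have h4 : ContinuousAt (fun t : ℝ => (σ : ℂ) + t * I) t := by fun_prop
      exact (ContinuousAt.comp (g := gz z) (f := fun t : ℝ => (σ : ℂ) + t * I) h3 h4).continuousWithinAt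
    exact isCompact_Icc.exists_bound_of_continuousOn hc
  have hVn : ∀ n, V n ≤ q ^ n * M * |τ₂ - τ₁| := by
    intro n
    refine intervalIntegral.norm_integral_le_of_norm_le_const fun t ht => ?_
    rw [Set.uIoc_of_le ht12] at ht
    have e : ((σ + n : ℝ) : ℂ) + t * I = (σ + t * I) + n := by push_cast; ring
    rw [e]
    refine (norm_gz_add_nat_le hz (by linarith) (by simp; linarith [ht.1]) hq n).trans ?_
    have := hM t ⟨ht.1.le, ht.2⟩
    gcongr
  have hlim : Tendsto (fun n : ℕ => (1 - q)⁻¹ * (b τ₁ + b τ₂) + q ^ n * M * |τ₂ - τ₁|) atTop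
      (nhds ((1 - q)⁻¹ * (b τ₁ + b τ₂) + 0 * M * |τ₂ - τ₁|)) :=
    (((tendsto_pow_atTop_nhds_zero_of_lt_one hq0.le hq1).mul_const _).mul_const _).const_add _
  have hb0 : 0 ≤ b τ₁ + b τ₂ := by
    have := cGa_pos
    have : 0 < τ₁ := by linarith
    have : 0 < τ₂ := by linarith
    simp only [hb]; positivity
  have hle := ge_of_tendsto' hlim (b := V 0) fun n => (hsum n).trans (by
    gcongr
    · calc _ ≤ ∑' k : ℕ, q ^ k := (summable_geometric_of_lt_one hq0.le hq1).sum_le_tsum _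
            (fun k _ => by positivity)
        _ = _ := tsum_geometric_of_lt_one hq0.le hq1
    · exact hVn n)
  simp only [hV, Nat.cast_zero, add_zero, zero_mul] at hle
  refine hle.trans (le_of_eq ?_)
  simp only [hb]; ring

/-- The division points `2π(K+1)²`. -/
noncomputable def tB (K : ℕ) : ℝ := 2 * Real.pi * ((K : ℝ) + 1) ^ 2

lemma tB_mono {K L : ℕ} (h : K ≤ L) : tB K ≤ tB L := by
  unfold tB
  have : (K : ℝ) ≤ L := by exact_mod_cast h
  have := Real.pi_pos
  gcongr

lemma tB_succ (K : ℕ) : tB (K + 1) = 2 * Real.pi * ((K : ℝ) + 2) ^ 2 := by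
  unfold tB; push_cast; ring

lemma six_le_tB (K : ℕ) : 6 * ((K : ℝ) + 1) ^ 2 ≤ tB K := by
  unfold tB
  have := Real.pi_gt_three
  gcongr; linarith

lemma one_le_tB (K : ℕ) : 1 ≤ tB K := by
  have := six_le_tB K
  have : (0 : ℝ) ≤ K := K.cast_nonneg
  nlinarith

lemma tB_succ_sub (K : ℕ) : tB (K + 1) - tB K ≤ 20 * ((K : ℝ) + 1) := by
  have := Real.pi_lt_d2
  have := Real.pi_pos
  have : (0 : ℝ) ≤ K := K.cast_nonneg
  unfold tB; push_cast; nlinarith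

/-- Continuity of a family of functions on their blocks. -/
def BC {E : Type*} [NormedAddCommGroup E] (f : ℕ → ℝ → E) : Prop :=
  ∀ K, 1 ≤ K → ContinuousOn (f K) (Set.Icc (tB K) (tB (K + 1)))

/-- The integral up to `T` of a family of functions, the `K`-th one being used on the block
`[tB K, tB (K+1)]`. -/
noncomputable def bInt (f : ℕ → ℝ → ℂ) (N : ℕ) (T : ℝ) : ℂ :=
  (∑ K ∈ Ico 1 N, ∫ t in tB K..tB (K + 1), f K t) + ∫ t in tB N..T, f N t

lemma BC.intervalIntegrable {E : Type*} [NormedAddCommGroup E] {f : ℕ → ℝ → E} (hf : BC f) {K : ℕ}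
    (hK : 1 ≤ K) {τ : ℝ} (h1 : tB K ≤ τ) (h2 : τ ≤ tB (K + 1)) :
    IntervalIntegrable (f K) volume (tB K) τ :=
  ((hf K hK).mono (Set.Icc_subset_Icc_right h2)).intervalIntegrable_of_Icc h1

lemma bInt_add {f g : ℕ → ℝ → ℂ} (hf : BC f) (hg : BC g) {N : ℕ} (hN : 1 ≤ N) {T : ℝ}
    (h1 : tB N ≤ T) (h2 : T ≤ tB (N + 1)) :
    bInt (fun K t => f K t + g K t) N T = bInt f N T + bInt g N T := by
  unfold bInt
  have hs : ∑ K ∈ Ico 1 N, ∫ t in tB K..tB (K + 1), f K t + g K t =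
      ∑ K ∈ Ico 1 N, ((∫ t in tB K..tB (K + 1), f K t) + ∫ t in tB K..tB (K + 1), g K t) := by
    refine sum_congr rfl fun K hK => ?_
    have hK1 := (mem_Ico.mp hK).1
    exact intervalIntegral.integral_add (hf.intervalIntegrable hK1 (tB_mono K.le_succ) le_rfl)
      (hg.intervalIntegrable hK1 (tB_mono K.le_succ) le_rfl)
  rw [intervalIntegral.integral_add (hf.intervalIntegrable hN h1 h2)
    (hg.intervalIntegrable hN h1 h2), hs, sum_add_distrib]
  ring

lemma bInt_congr {f g : ℕ → ℝ → ℂ} (h : ∀ K, 1 ≤ K → ∀ t ∈ Set.Icc (tB K) (tB (K + 1)), f K t = g K t)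
    {N : ℕ} (hN : 1 ≤ N) {T : ℝ} (h1 : tB N ≤ T) (h2 : T ≤ tB (N + 1)) :
    bInt f N T = bInt g N T := by
  unfold bInt
  congr 1
  · refine sum_congr rfl fun K hK => intervalIntegral.integral_congr fun t ht => ?_
    rw [Set.uIcc_of_le (tB_mono K.le_succ)] at ht
    exact h K (mem_Ico.mp hK).1 t ht
  · refine intervalIntegral.integral_congr fun t ht => ?_
    rw [Set.uIcc_of_le h1] at ht
    exact h N hN t ⟨ht.1, ht.2.trans h2⟩

lemma norm_bInt_le_sum {f : ℕ → ℝ → ℂ} {b : ℕ → ℝ}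
    (h : ∀ K, 1 ≤ K → ∀ τ ∈ Set.Icc (tB K) (tB (K + 1)), ‖∫ t in tB K..τ, f K t‖ ≤ b K)
    {N : ℕ} (hN : 1 ≤ N) {T : ℝ} (h1 : tB N ≤ T) (h2 : T ≤ tB (N + 1)) :
    ‖bInt f N T‖ ≤ ∑ K ∈ Ico 1 (N + 1), b K := by
  unfold bInt
  rw [sum_Ico_succ_top hN]
  refine (norm_add_le _ _).trans (add_le_add ((norm_sum_le _ _).trans (sum_le_sum fun K hK => ?_))
    (h N hN T ⟨h1, h2⟩))
  exact h K (mem_Ico.mp hK).1 _ ⟨tB_mono K.le_succ, le_rfl⟩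

lemma sum_integral_tB {E : Type*} [NormedAddCommGroup E] [NormedSpace ℝ E] {g : ℝ → E}
    (hg : ContinuousOn g (Set.Ici (tB 1))) {N : ℕ} (hN : 1 ≤ N) {T : ℝ} (h1 : tB N ≤ T) :
    (∑ K ∈ Ico 1 N, ∫ t in tB K..tB (K + 1), g t) + ∫ t in tB N..T, g t = ∫ t in tB 1..T, g t := by
  have hint : ∀ x y : ℝ, tB 1 ≤ x → x ≤ y → IntervalIntegrable g volume x y := fun x y hx hxy =>
    (hg.mono (Set.Icc_subset_Ici_self.trans (Set.Ici_subset_Ici.mpr hx))).intervalIntegrable_of_Icc hxy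
  rw [intervalIntegral.sum_integral_adjacent_intervals_Ico hN fun k hk =>
    hint _ _ (tB_mono hk.1) (tB_mono k.le_succ)]
  exact intervalIntegral.integral_add_adjacent_intervals (hint _ _ le_rfl (tB_mono hN))
    (hint _ _ (tB_mono hN) h1)

lemma bInt_const {g : ℝ → ℂ} (hg : ContinuousOn g (Set.Ici (tB 1))) {N : ℕ} (hN : 1 ≤ N) {T : ℝ}
    (h1 : tB N ≤ T) : bInt (fun _ => g) N T = ∫ t in tB 1..T, g t :=
  sum_integral_tB hg hN h1

lemma norm_bInt_le_integral {f : ℕ → ℝ → ℂ} {g : ℝ → ℝ} (hg : ContinuousOn g (Set.Ici (tB 1)))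
    (h : ∀ K, 1 ≤ K → ∀ t ∈ Set.Icc (tB K) (tB (K + 1)), ‖f K t‖ ≤ g t)
    {N : ℕ} (hN : 1 ≤ N) {T : ℝ} (h1 : tB N ≤ T) (h2 : T ≤ tB (N + 1)) :
    ‖bInt f N T‖ ≤ ∫ t in tB 1..T, g t := by
  have hint : ∀ x y : ℝ, tB 1 ≤ x → x ≤ y → IntervalIntegrable g volume x y := fun x y hx hxy =>
    (hg.mono (Set.Icc_subset_Ici_self.trans (Set.Ici_subset_Ici.mpr hx))).intervalIntegrable_of_Icc hxy
  rw [← sum_integral_tB hg hN h1]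
  unfold bInt
  refine (norm_add_le _ _).trans (add_le_add ((norm_sum_le _ _).trans (sum_le_sum fun K hK => ?_)) ?_)
  · have hK1 := (mem_Ico.mp hK).1
    refine intervalIntegral.norm_integral_le_of_norm_le (tB_mono K.le_succ)
      (Eventually.of_forall fun t ht => h K hK1 t ⟨ht.1.le, ht.2⟩)
      (hint _ _ (tB_mono hK1) (tB_mono K.le_succ))
  · refine intervalIntegral.norm_integral_le_of_norm_le h1
      (Eventually.of_forall fun t ht => h N hN t ⟨ht.1.le, ht.2.trans h2⟩)
      (hint _ _ (tB_mono hN) h1)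

/-- A double sum whose length grows with the block is integrated term by term. -/
lemma bInt_switch {c : ℕ → ℕ → ℝ → ℂ} (hc : ∀ i j, ContinuousOn (c i j) (Set.Ici (tB 1)))
    {N : ℕ} (hN : 1 ≤ N) : ∀ {T : ℝ}, tB N ≤ T →
    bInt (fun K t => ∑ i ∈ range K, ∑ j ∈ range K, c i j t) N T =
      ∑ i ∈ range N, ∑ j ∈ range N, ∫ t in tB (max i j + 1)..T, c i j t := by
  have hint : ∀ i j, ∀ x y : ℝ, tB 1 ≤ x → x ≤ y → IntervalIntegrable (c i j) volume x y :=
    fun i j x y hx hxy => ((hc i j).mono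
      (Set.Icc_subset_Ici_self.trans (Set.Ici_subset_Ici.mpr hx))).intervalIntegrable_of_Icc hxy
  have hsum : ∀ N : ℕ, ∀ x y : ℝ, tB 1 ≤ x → x ≤ y →
      ∫ t in x..y, ∑ i ∈ range N, ∑ j ∈ range N, c i j t =
      ∑ i ∈ range N, ∑ j ∈ range N, ∫ t in x..y, c i j t := by
    intro N x y hx hxy
    rw [intervalIntegral.integral_finsetSum]
    · refine sum_congr rfl fun i _ => ?_
      rw [intervalIntegral.integral_finsetSum]
      exact fun j _ => hint i j x y hx hxy
    · intro i _
      simp_rw [← Finset.sum_apply]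
      exact IntervalIntegrable.sum _ fun j _ => hint i j x y hx hxy
  induction N, hN using Nat.le_induction with
  | base =>
    intro T hT
    simp only [bInt, Ico_self, sum_empty, zero_add]
    rw [hsum 1 _ _ le_rfl hT]
    simp
  | succ N hN ih =>
    intro T hT
    have h := ih (T := tB (N + 1)) (tB_mono N.le_succ)
    have hNN : tB 1 ≤ tB (N + 1) := tB_mono (by omega)
    have e : bInt (fun K t => ∑ i ∈ range K, ∑ j ∈ range K, c i j t) (N + 1) T =
        bInt (fun K t => ∑ i ∈ range K, ∑ j ∈ range K, c i j t) N (tB (N + 1)) +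
        ∫ t in tB (N + 1)..T, ∑ i ∈ range (N + 1), ∑ j ∈ range (N + 1), c i j t := by
      unfold bInt
      rw [sum_Ico_succ_top hN]
    rw [e, h, hsum (N + 1) _ _ hNN hT]
    simp only [sum_range_succ, sum_add_distrib]
    have h1 : ∑ i ∈ range N, ∫ t in tB (max i N + 1)..T, c i N t =
        ∑ i ∈ range N, ∫ t in tB (N + 1)..T, c i N t :=
      sum_congr rfl fun i hi => by rw [max_eq_right (mem_range.mp hi).le]
    have h2 : ∑ i ∈ range N, ∫ t in tB (max N i + 1)..T, c N i t =
        ∑ i ∈ range N, ∫ t in tB (N + 1)..T, c N i t :=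
      sum_congr rfl fun i hi => by rw [max_eq_left (mem_range.mp hi).le]
    have h3 : ∑ i ∈ range N, ∑ j ∈ range N, ∫ t in tB (max i j + 1)..T, c i j t =
        (∑ i ∈ range N, ∑ j ∈ range N, ∫ t in tB (max i j + 1)..tB (N + 1), c i j t) +
        ∑ i ∈ range N, ∑ j ∈ range N, ∫ t in tB (N + 1)..T, c i j t := by
      rw [← sum_add_distrib]
      refine sum_congr rfl fun i hi => ?_
      rw [← sum_add_distrib]
      refine sum_congr rfl fun j hj => ?_
      have hm : max i j + 1 ≤ N + 1 := by
        have := mem_range.mp hi; have := mem_range.mp hj; omega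
      exact (intervalIntegral.integral_add_adjacent_intervals
        (hint i j _ _ (tB_mono (by omega)) (tB_mono hm)) (hint i j _ _ hNN hT)).symm
    rw [h1, h2, h3, max_self]
    ring

lemma sum_inv_succ_le (N : ℕ) : ∑ k ∈ range N, ((k : ℝ) + 1)⁻¹ ≤ 1 + Real.log N := by
  have h := harmonic_le_one_add_log N
  have e : ((harmonic N : ℚ) : ℝ) = ∑ k ∈ range N, ((k : ℝ) + 1)⁻¹ := by
    unfold harmonic; push_cast; rfl
  rwa [e] at h

lemma sum_inv_succ_le_of_le {M N : ℕ} (h : M ≤ N) :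
    ∑ k ∈ range M, ((k : ℝ) + 1)⁻¹ ≤ 1 + Real.log N :=
  (sum_le_sum_of_subset_of_nonneg (range_mono h) fun _ _ _ => by positivity).trans
    (sum_inv_succ_le N)

lemma sum_inv_le_of_le {M N : ℕ} (h : M ≤ N) :
    ∑ k ∈ range M, ((k : ℝ))⁻¹ ≤ 1 + Real.log N := by
  rcases M with _ | M
  · have := Real.log_natCast_nonneg N
    simp; linarith
  · rw [sum_range_succ']
    simpa using sum_inv_succ_le_of_le (M := M) (N := N) (by omega)

/-- Sum of a function of the distance to a given index. -/
lemma sum_dist_le {f : ℝ → ℝ} {N i : ℕ} (hi : i ≤ N) {B : ℝ}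
    (h1 : ∑ k ∈ range (N - i), f k ≤ B) (h2 : ∑ k ∈ range i, f ((k : ℝ) + 1) ≤ B) :
    ∑ j ∈ range N, f |(i : ℝ) - j| ≤ 2 * B := by
  rw [← sum_range_add_sum_Ico _ hi, sum_Ico_eq_sum_range]
  have e1 : ∑ j ∈ range i, f |(i : ℝ) - j| = ∑ k ∈ range i, f ((k : ℝ) + 1) := by
    rw [← sum_range_reflect]
    refine sum_congr rfl fun k hk => ?_
    have hk := mem_range.mp hk
    have : ((i - 1 - k : ℕ) : ℝ) = (i : ℝ) - 1 - k := by
      rw [Nat.cast_sub (by omega), Nat.cast_sub (by omega)]; simp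
    rw [this, abs_of_nonneg (by have : (0:ℝ) ≤ k := k.cast_nonneg
                                linarith)]
    congr 1; ring
  have e2 : ∑ k ∈ range (N - i), f |(i : ℝ) - ((i + k : ℕ) : ℝ)| = ∑ k ∈ range (N - i), f k := by
    refine sum_congr rfl fun k _ => ?_
    push_cast
    rw [show (i : ℝ) - (i + k) = -k by ring, abs_neg, Nat.abs_cast]
  rw [e1, e2]; linarith

lemma sum_inv_dist_le {N i : ℕ} (hi : i ≤ N) :
    ∑ j ∈ range N, |(i : ℝ) - j|⁻¹ ≤ 2 * (1 + Real.log N) :=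
  sum_dist_le (f := fun x => x⁻¹) hi (sum_inv_le_of_le (by omega)) (sum_inv_succ_le_of_le hi)

lemma sum_inv_dist_succ_le {N i : ℕ} (hi : i ≤ N) :
    ∑ j ∈ range N, (|(i : ℝ) - j| + 1)⁻¹ ≤ 2 * (1 + Real.log N) := by
  refine sum_dist_le (f := fun x => (x + 1)⁻¹) hi (sum_inv_succ_le_of_le (by omega)) ?_
  refine le_trans (sum_le_sum fun k _ => ?_) (sum_inv_succ_le_of_le hi)
  have : (0 : ℝ) ≤ k := k.cast_nonneg
  gcongr; linarith

lemma sum_sum_dist_le {d : ℝ → ℝ} {L : ℝ} {N : ℕ}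
    (hd : ∀ i, i ≤ N → ∑ j ∈ range N, d |(i : ℝ) - j| ≤ L) {f g : ℕ → ℝ}
    (hf : ∀ i, 0 ≤ f i) (hg : ∀ i, 0 ≤ g i) :
    ∑ i ∈ range N, ∑ j ∈ range N, (f i + g j) * d |(i : ℝ) - j| ≤
      (∑ i ∈ range N, f i + ∑ i ∈ range N, g i) * L := by
  simp_rw [add_mul, sum_add_distrib]
  refine add_le_add ?_ ?_
  · rw [sum_mul]
    refine sum_le_sum fun i hi => ?_
    rw [← mul_sum]
    exact mul_le_mul_of_nonneg_left (hd i (mem_range.mp hi).le) (hf i)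
  · rw [sum_comm, sum_mul]
    refine sum_le_sum fun j hj => ?_
    rw [← mul_sum]
    simp_rw [abs_sub_comm _ (j : ℝ)]
    exact mul_le_mul_of_nonneg_left (hd j (mem_range.mp hj).le) (hg j)

/-- A triangular sum weighted by inverse distances. -/
lemma sum_triangle_le {N : ℕ} (hN : 1 ≤ N) {f : ℕ → ℝ} (hf : ∀ i, 0 ≤ f i) :
    ∑ K ∈ Ico 1 (N + 1), ∑ m ∈ range K, f m * ((K : ℝ) - m)⁻¹ ≤
      (∑ m ∈ range N, f m) * (4 * (1 + Real.log N)) := by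
  have h1 : ∑ K ∈ Ico 1 (N + 1), ∑ m ∈ range K, f m * ((K : ℝ) - m)⁻¹ ≤
      ∑ K ∈ range (N + 1), ∑ m ∈ range N, f m * |(m : ℝ) - K|⁻¹ := by
    refine (sum_le_sum fun K hK => ?_).trans (sum_le_sum_of_subset_of_nonneg
      (fun K hK => by simp only [mem_Ico, mem_range] at *; omega)
      fun K _ _ => sum_nonneg fun m _ => mul_nonneg (hf m) (by positivity))
    have hK := mem_Ico.mp hK
    refine (sum_le_sum fun m hm => ?_).trans (sum_le_sum_of_subset_of_nonneg
      (range_mono (by omega : K ≤ N)) fun m _ _ => mul_nonneg (hf m) (by positivity))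
    have : (m : ℝ) < K := by exact_mod_cast mem_range.mp hm
    rw [abs_sub_comm, abs_of_pos (by linarith)]
  refine h1.trans ?_
  rw [sum_comm, sum_mul]
  refine sum_le_sum fun m hm => ?_
  rw [← mul_sum]
  refine mul_le_mul_of_nonneg_left ?_ (hf m)
  have hm := mem_range.mp hm
  refine (sum_inv_dist_le (N := N + 1) (i := m) (by omega)).trans ?_
  have hN' : (1 : ℝ) ≤ N := by exact_mod_cast hN
  have : Real.log ((N + 1 : ℕ) : ℝ) ≤ Real.log 2 + Real.log N := by
    rw [← Real.log_mul (by norm_num) (by positivity)]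
    apply Real.log_le_log (by positivity)
    push_cast; linarith
  have := Real.log_two_lt_d9
  have := Real.log_nonneg hN'
  linarith

lemma rpow_comparable {x y : ℝ} (hx : 0 < x) (hy : 0 < y) (h1 : y / 2 ≤ x) (h2 : x ≤ 2 * y) (p : ℝ) :
    x ^ p ≤ 2 ^ |p| * y ^ p := by
  rcases le_total 0 p with hp | hp
  · rw [abs_of_nonneg hp, ← Real.mul_rpow (by norm_num) hy.le]
    exact Real.rpow_le_rpow hx.le h2 hp
  · rw [abs_of_nonpos hp, Real.rpow_neg (by norm_num), ← Real.inv_rpow (by norm_num),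
      ← Real.mul_rpow (by norm_num) hy.le]
    exact Real.rpow_le_rpow_of_nonpos (by positivity) (by linarith) hp

lemma mpt_half_le {a : ℝ} (ha : 0 < a) {N : ℕ} (hN : 1 ≤ N) : (N : ℝ) / 2 ≤ mpt a N := by
  have : (1 : ℝ) ≤ N := by exact_mod_cast hN
  have := mpt_ge ha N
  linarith

lemma mpt_le_two_mul {a : ℝ} (ha1 : a ≤ 1) {N : ℕ} (hN : 1 ≤ N) : mpt a N ≤ 2 * N := by
  have : (1 : ℝ) ≤ N := by exact_mod_cast hN
  have := mpt_le ha1 N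
  linarith

lemma mpt_rpow_le {a : ℝ} (ha : 0 < a) (ha1 : a ≤ 1) {N : ℕ} (hN : 1 ≤ N) (p : ℝ) :
    mpt a N ^ p ≤ 2 ^ |p| * (N : ℝ) ^ p :=
  rpow_comparable (mpt_pos ha hN) (by exact_mod_cast hN) (mpt_half_le ha hN) (mpt_le_two_mul ha1 hN) p

lemma ofReal_sum_xpt {a : ℝ} (ha : 0 < a) (β : ℝ) (N : ℕ) :
    ((∑ m ∈ range N, xpt a m ^ (-β) : ℝ) : ℂ) = ∑ m ∈ range N, (xpt a m : ℂ) ^ (-(β : ℂ)) := by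
  push_cast
  refine sum_congr rfl fun m _ => ?_
  rw [ofReal_cpow (xpt_pos ha m).le]; push_cast; rfl

lemma sum_xpt_le {a : ℝ} (ha : 0 < a) (ha1 : a ≤ 1) {β : ℝ} (hβ : 0 < β) (hβ1 : β ≠ 1) :
    ∃ C, 0 ≤ C ∧ ∀ N : ℕ, 1 ≤ N → ∑ m ∈ range N, xpt a m ^ (-β) ≤ C * ((N : ℝ) ^ (1 - β) + 1) := by
  have hs1 : (β : ℂ) ≠ 1 := by exact_mod_cast hβ1
  obtain ⟨C, hC, h⟩ := hzeta_approx ha ha1 (s := (β : ℂ)) (by simpa using hβ) hs1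
  set Z := ‖hzeta a β‖
  have hb : 0 < |β - 1|⁻¹ := inv_pos.mpr (abs_pos.mpr (sub_ne_zero.mpr hβ1))
  refine ⟨a ^ (-β) + Z + 2 ^ |1 - β| * |β - 1|⁻¹ + C, by positivity, fun N hN => ?_⟩
  have hNp : (0 : ℝ) < N := by exact_mod_cast hN
  have hN1 : (0 : ℝ) ≤ (N : ℝ) ^ (1 - β) := by positivity
  have ha' : 0 ≤ a ^ (-β) := by positivity
  have hZ : 0 ≤ Z := norm_nonneg _
  have h2p : 0 ≤ 2 ^ |1 - β| * |β - 1|⁻¹ := by positivity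
  rcases Nat.lt_or_ge N 2 with h2 | h2
  · have : N = 1 := by omega
    subst this
    simp only [range_one, sum_singleton, Nat.cast_one, Real.one_rpow, xpt, Nat.cast_zero, zero_add]
    nlinarith
  · have h3 := h N h2
    rw [← ofReal_sum_xpt ha] at h3
    have hX1 : 1 ≤ mpt a N := by
      have := mpt_ge ha N
      have : (2 : ℝ) ≤ N := by exact_mod_cast h2
      linarith
    have e1 : ‖((∑ m ∈ range N, xpt a m ^ (-β) : ℝ) : ℂ)‖ = ∑ m ∈ range N, xpt a m ^ (-β) := by
      rw [norm_real, Real.norm_of_nonneg]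
      exact sum_nonneg fun m _ => Real.rpow_nonneg (xpt_pos ha m).le _
    have e2 : ‖((mpt a N : ℂ) ^ (1 - (β : ℂ)) / (β - 1))‖ = mpt a N ^ (1 - β) * |β - 1|⁻¹ := by
      rw [norm_div, norm_cpow_eq_rpow_re_of_pos (by linarith), div_eq_mul_inv]
      congr 1
      rw [show (β : ℂ) - 1 = ((β - 1 : ℝ) : ℂ) by push_cast; rfl, norm_real, Real.norm_eq_abs]
    have e3 : mpt a N ^ (-(β : ℂ).re) ≤ 1 := by
      rw [ofReal_re]
      exact Real.rpow_le_one_of_one_le_of_nonpos hX1 (by linarith)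
    have h4 := mpt_rpow_le ha ha1 hN (1 - β)
    rw [← e1]
    generalize ((∑ m ∈ range N, xpt a m ^ (-β) : ℝ) : ℂ) = S at *
    have h5 : ‖S‖ ≤ Z + ‖((mpt a N : ℂ) ^ (1 - (β : ℂ)) / (β - 1))‖ + C * mpt a N ^ (-(β : ℂ).re) := by
      have : S = hzeta a β - (mpt a N : ℂ) ^ (1 - (β : ℂ)) / (β - 1) -
        (hzeta a β - S - (mpt a N : ℂ) ^ (1 - (β : ℂ)) / (β - 1)) := by ring
      rw [this]
      exact (norm_sub_le _ _).trans (add_le_add (norm_sub_le _ _) h3)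
    rw [e2] at h5
    have h6 : mpt a N ^ (1 - β) * |β - 1|⁻¹ ≤ 2 ^ |1 - β| * |β - 1|⁻¹ * (N : ℝ) ^ (1 - β) := by
      calc _ ≤ (2 ^ |1 - β| * (N : ℝ) ^ (1 - β)) * |β - 1|⁻¹ := by gcongr
        _ = _ := by ring
    have h7 : C * mpt a N ^ (-(β : ℂ).re) ≤ C := mul_le_of_le_one_right hC e3
    have h8 := mul_nonneg ha' hN1
    have h9 := mul_nonneg hZ hN1
    have h10 := mul_nonneg hC hN1
    nlinarith

lemma xpt_rpow_le {a : ℝ} (ha : 0 < a) (ha1 : a ≤ 1) {j N : ℕ} (hj : 1 ≤ j) (hjN : j < N) (p : ℝ) :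
    xpt a j ^ p ≤ (N : ℝ) ^ p + 1 := by
  have h1 : (1 : ℝ) ≤ j := by exact_mod_cast hj
  have h2 : (j : ℝ) + 1 ≤ N := by exact_mod_cast hjN
  have hx1 : 1 ≤ xpt a j := by unfold xpt; linarith
  have hxN : xpt a j ≤ N := by unfold xpt; linarith
  have : 0 ≤ (N : ℝ) ^ p := by positivity
  rcases le_total 0 p with hp | hp
  · have := Real.rpow_le_rpow (by linarith) hxN hp
    linarith
  · have := Real.rpow_le_one_of_one_le_of_nonpos hx1 hp
    linarith

lemma log_xpt_sub_ge {a : ℝ} (ha : 0 < a) (i j : ℕ) :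
    ((j : ℝ) - i) / xpt a j ≤ Real.log (xpt a j) - Real.log (xpt a i) := by
  have hi := xpt_pos ha i
  have hj := xpt_pos ha j
  have := Real.one_sub_inv_le_log_of_pos (div_pos hj hi)
  rw [Real.log_div hj.ne' hi.ne', inv_div] at this
  refine le_trans (le_of_eq ?_) this
  rw [eq_sub_iff_add_eq, ← add_div, div_eq_one_iff_eq hj.ne']
  unfold xpt; ring

lemma inv_log_xpt_sub_le {a : ℝ} (ha : 0 < a) {i j : ℕ} (h : i < j) :
    |Real.log (xpt a i) - Real.log (xpt a j)|⁻¹ ≤ xpt a j * |(i : ℝ) - j|⁻¹ := by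
  have hj := xpt_pos ha j
  have hij : (0 : ℝ) < (j : ℝ) - i := by
    have : (i : ℝ) < j := by exact_mod_cast h
    linarith
  have h1 := log_xpt_sub_ge ha i j
  have h2 : 0 < ((j : ℝ) - i) / xpt a j := by positivity
  rw [abs_sub_comm, abs_of_pos (h2.trans_le h1), abs_sub_comm, abs_of_pos hij]
  calc _ ≤ (((j : ℝ) - i) / xpt a j)⁻¹ := inv_anti₀ h2 h1
    _ = _ := by rw [inv_div]; rfl

lemma log_xpt_ne {a : ℝ} (ha : 0 < a) {i j : ℕ} (h : i ≠ j) :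
    Real.log (xpt a i) - Real.log (xpt a j) ≠ 0 := by
  have key : ∀ {i j : ℕ}, i < j → Real.log (xpt a i) < Real.log (xpt a j) := fun {i j} h =>
    Real.log_lt_log (xpt_pos ha i) (by unfold xpt; have : (i : ℝ) < j := by exact_mod_cast h
                                       linarith)
  rcases h.lt_or_gt with h | h
  · have := key h; linarith
  · have := key h; intro h'; linarith

/-- The sum over off-diagonal pairs weighted by the inverse logarithmic distance. -/
lemma sum_offdiag_le {a : ℝ} (ha : 0 < a) (ha1 : a ≤ 1) {β γ : ℝ} (hβ : 0 < β) (hβ1 : β ≠ 1)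
    (hγ : 0 < γ) (hγ1 : γ ≠ 1) :
    ∃ C, 0 ≤ C ∧ ∀ N : ℕ, 1 ≤ N → ∑ i ∈ range N, ∑ j ∈ range N,
      xpt a i ^ (-β) * xpt a j ^ (-γ) * |Real.log (xpt a i) - Real.log (xpt a j)|⁻¹ ≤
      C * (((N : ℝ) ^ (1 - β) + 1) * ((N : ℝ) ^ (1 - γ) + 1) * (1 + Real.log N)) := by
  obtain ⟨C₁, hC₁, h₁⟩ := sum_xpt_le ha ha1 hβ hβ1
  obtain ⟨C₂, hC₂, h₂⟩ := sum_xpt_le ha ha1 hγ hγ1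
  refine ⟨2 * (C₁ + C₂), by positivity, fun N hN => ?_⟩
  set A := (N : ℝ) ^ (1 - β) + 1 with hA
  set B := (N : ℝ) ^ (1 - γ) + 1 with hB
  have hA0 : 0 ≤ A := by positivity
  have hB0 : 0 ≤ B := by positivity
  have hL : 0 ≤ 1 + Real.log N := by have := Real.log_natCast_nonneg N; linarith
  have hp : ∀ (m : ℕ) (p : ℝ), 0 ≤ xpt a m ^ p := fun m p => Real.rpow_nonneg (xpt_pos ha m).le _
  have hterm : ∀ i ∈ range N, ∀ j ∈ range N,
      xpt a i ^ (-β) * xpt a j ^ (-γ) * |Real.log (xpt a i) - Real.log (xpt a j)|⁻¹ ≤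
      (B * xpt a i ^ (-β) + A * xpt a j ^ (-γ)) * (fun x : ℝ => x⁻¹) |(i : ℝ) - j| := by
    intro i hi j hj
    rw [mem_range] at hi hj
    rcases lt_trichotomy i j with h | h | h
    · have h3 := inv_log_xpt_sub_le ha h
      have h4 := xpt_rpow_le ha ha1 (by omega : 1 ≤ j) hj (1 - γ)
      have h5 : xpt a j ^ (1 - γ) = xpt a j ^ (-γ) * xpt a j := by
        rw [sub_eq_neg_add, Real.rpow_add_one (xpt_pos ha j).ne']
      have hd : 0 ≤ |(i : ℝ) - j|⁻¹ := by positivity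
      calc _ ≤ xpt a i ^ (-β) * xpt a j ^ (-γ) * (xpt a j * |(i : ℝ) - j|⁻¹) :=
            mul_le_mul_of_nonneg_left h3 (mul_nonneg (hp _ _) (hp _ _))
        _ = xpt a i ^ (-β) * xpt a j ^ (1 - γ) * |(i : ℝ) - j|⁻¹ := by rw [h5]; ring
        _ ≤ xpt a i ^ (-β) * B * |(i : ℝ) - j|⁻¹ :=
            mul_le_mul_of_nonneg_right (mul_le_mul_of_nonneg_left h4 (hp _ _)) hd
        _ ≤ _ := by
            refine mul_le_mul_of_nonneg_right ?_ hd
            have := mul_nonneg hA0 (hp j (-γ))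
            linarith
    · subst h; simp
    · have h3 := inv_log_xpt_sub_le ha h
      rw [abs_sub_comm, abs_sub_comm (j : ℝ)] at h3
      have h4 := xpt_rpow_le ha ha1 (by omega : 1 ≤ i) hi (1 - β)
      have h5 : xpt a i ^ (1 - β) = xpt a i ^ (-β) * xpt a i := by
        rw [sub_eq_neg_add, Real.rpow_add_one (xpt_pos ha i).ne']
      have hd : 0 ≤ |(i : ℝ) - j|⁻¹ := by positivity
      calc _ ≤ xpt a i ^ (-β) * xpt a j ^ (-γ) * (xpt a i * |(i : ℝ) - j|⁻¹) :=
            mul_le_mul_of_nonneg_left h3 (mul_nonneg (hp _ _) (hp _ _))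
        _ = xpt a j ^ (-γ) * xpt a i ^ (1 - β) * |(i : ℝ) - j|⁻¹ := by rw [h5]; ring
        _ ≤ xpt a j ^ (-γ) * A * |(i : ℝ) - j|⁻¹ :=
            mul_le_mul_of_nonneg_right (mul_le_mul_of_nonneg_left h4 (hp _ _)) hd
        _ ≤ _ := by
            refine mul_le_mul_of_nonneg_right ?_ hd
            have := mul_nonneg hB0 (hp i (-β))
            linarith
  refine (sum_le_sum fun i hi => sum_le_sum fun j hj => hterm i hi j hj).trans ?_
  refine (sum_sum_dist_le (d := fun x => x⁻¹) (fun i hi => sum_inv_dist_le hi)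
    (f := fun i => B * xpt a i ^ (-β)) (g := fun j => A * xpt a j ^ (-γ))
    (fun i => mul_nonneg hB0 (hp _ _)) fun j => mul_nonneg hA0 (hp _ _)).trans ?_
  rw [← mul_sum, ← mul_sum]
  have h6 := mul_le_mul_of_nonneg_left (h₁ N hN) hB0
  have h7 := mul_le_mul_of_nonneg_left (h₂ N hN) hA0
  rw [← hA] at h6
  rw [← hB] at h7
  calc _ ≤ (B * (C₁ * A) + A * (C₂ * B)) * (2 * (1 + Real.log N)) :=
        mul_le_mul_of_nonneg_right (add_le_add h6 h7) (by positivity)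
    _ = _ := by ring

lemma norm_integral_rpow_mul_cexp_le {p lam τ₁ τ₂ : ℝ} (hp : 0 ≤ p) (hl : lam ≠ 0) (h1 : 0 < τ₁)
    (h12 : τ₁ ≤ τ₂) :
    ‖∫ t in τ₁..τ₂, (((t / (2 * Real.pi)) ^ p : ℝ) : ℂ) * cexp (I * (lam * t))‖ ≤
      2 * (τ₂ / (2 * Real.pi)) ^ p * |lam|⁻¹ := by
  have hpi := Real.pi_pos
  set w : ℝ → ℝ := fun t => (t / (2 * Real.pi)) ^ p with hw
  set w' : ℝ → ℝ := fun t => p * (t / (2 * Real.pi)) ^ (p - 1) * (1 / (2 * Real.pi)) with hw'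
  have hpos : ∀ t ∈ Set.uIcc τ₁ τ₂, 0 < t / (2 * Real.pi) := fun t ht => by
    rw [Set.uIcc_of_le h12] at ht
    have := ht.1
    exact div_pos (by linarith) (by positivity)
  have hd : ∀ t ∈ Set.uIcc τ₁ τ₂, HasDerivAt w (w' t) t := fun t ht => by
    have h := ((hasDerivAt_id t).div_const (2 * Real.pi)).rpow_const (p := p) (Or.inl (hpos t ht).ne')
    have e : 1 / (2 * Real.pi) * p * (id t / (2 * Real.pi)) ^ (p - 1) = w' t := by
      simp only [hw', id]; ring
    rw [e] at h
    exact h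
  have hw'0 : ∀ t ∈ Set.uIcc τ₁ τ₂, 0 ≤ w' t := fun t ht => by
    have := hpos t ht
    simp only [hw']; positivity
  have hcw' : ContinuousOn w' (Set.uIcc τ₁ τ₂) := by
    refine (continuousOn_const.mul (ContinuousOn.rpow_const (by fun_prop) ?_)).mul continuousOn_const
    exact fun t ht => Or.inl (hpos t ht).ne'
  have hiw' : IntervalIntegrable w' volume τ₁ τ₂ := hcw'.intervalIntegrable
  have hlI : I * (lam : ℂ) ≠ 0 := mul_ne_zero I_ne_zero (by exact_mod_cast hl)
  set v : ℝ → ℂ := fun t => cexp (I * (lam * t)) / (I * lam) with hv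
  have hdv : ∀ t ∈ Set.uIcc τ₁ τ₂, HasDerivAt v (cexp (I * (lam * t))) t := fun t _ => by
    have h0 : HasDerivAt (fun t : ℝ => I * ((lam : ℂ) * (t : ℂ))) (I * (lam * 1)) t :=
      ((ofRealCLM.hasDerivAt (x := t)).const_mul (lam : ℂ)).const_mul I
    have h := (h0.cexp).div_const (I * (lam : ℂ))
    have e : cexp (I * (lam * t)) * (I * (lam * 1)) / (I * lam) = cexp (I * (lam * t)) := by
      rw [mul_one, mul_div_assoc, div_self hlI, mul_one]
    rw [e] at h
    exact h
  have hnv : ∀ t, ‖v t‖ = |lam|⁻¹ := fun t => by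
    simp only [hv]
    rw [norm_div, show I * ((lam : ℂ) * t) = ((lam * t : ℝ) : ℂ) * I by push_cast; ring,
      norm_exp_ofReal_mul_I, norm_mul, norm_I, norm_real, Real.norm_eq_abs]
    simp
  have hcv : Continuous fun t : ℝ => cexp (I * (lam * t)) := by fun_prop
  rw [intervalIntegral.integral_mul_deriv_eq_deriv_mul (fun t ht => (hd t ht).ofReal_comp) hdv
    (ContinuousOn.intervalIntegrable (continuous_ofReal.comp_continuousOn hcw'))
    (hcv.intervalIntegrable _ _)]
  have hL : 0 ≤ |lam|⁻¹ := by positivity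
  have hint : ‖∫ t in τ₁..τ₂, (w' t : ℂ) * v t‖ ≤ (w τ₂ - w τ₁) * |lam|⁻¹ := by
    rw [← intervalIntegral.integral_eq_sub_of_hasDerivAt hd hiw', ← intervalIntegral.integral_mul_const]
    refine intervalIntegral.norm_integral_le_of_norm_le h12
      ((ae_of_all _ fun t ht => ?_)) (hiw'.mul_const _)
    rw [norm_mul, hnv, norm_real, Real.norm_of_nonneg]
    refine hw'0 t ?_
    rw [Set.uIcc_of_le h12]; exact ⟨ht.1.le, ht.2⟩
  have hw1 : 0 ≤ w τ₁ := (Real.rpow_nonneg (hpos τ₁ Set.left_mem_uIcc).le _)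
  have hw2 : 0 ≤ w τ₂ := (Real.rpow_nonneg (hpos τ₂ Set.right_mem_uIcc).le _)
  have n1 : ‖(w τ₁ : ℂ) * v τ₁‖ = w τ₁ * |lam|⁻¹ := by
    rw [norm_mul, hnv, norm_real, Real.norm_of_nonneg hw1]
  have n2 : ‖(w τ₂ : ℂ) * v τ₂‖ = w τ₂ * |lam|⁻¹ := by
    rw [norm_mul, hnv, norm_real, Real.norm_of_nonneg hw2]
  have := norm_sub_le ((w τ₂ : ℂ) * v τ₂ - (w τ₁ : ℂ) * v τ₁) (∫ t in τ₁..τ₂, (w' t : ℂ) * v t)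
  have := norm_sub_le ((w τ₂ : ℂ) * v τ₂) ((w τ₁ : ℂ) * v τ₁)
  rw [n1, n2] at this
  have : 2 * (τ₂ / (2 * Real.pi)) ^ p * |lam|⁻¹ = 2 * w τ₂ * |lam|⁻¹ := rfl
  rw [this]
  linarith

lemma norm_integral_cexp_le {lam τ₁ τ₂ : ℝ} (hl : lam ≠ 0) (h1 : 0 < τ₁) (h12 : τ₁ ≤ τ₂) :
    ‖∫ t in τ₁..τ₂, cexp (I * (lam * t))‖ ≤ 2 * |lam|⁻¹ := by
  have := norm_integral_rpow_mul_cexp_le le_rfl hl h1 h12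
  simpa using this

lemma conj_cpow_ofReal {x : ℝ} (hx : 0 < x) (s : ℂ) :
    starRingEnd ℂ ((x : ℂ) ^ s) = (x : ℂ) ^ (starRingEnd ℂ s) := by
  rw [cpow_def_of_ne_zero (by exact_mod_cast hx.ne'), cpow_def_of_ne_zero (by exact_mod_cast hx.ne'),
    ← exp_conj, map_mul, ← ofReal_log hx.le, conj_ofReal]

lemma cpow_mul_conj_cpow {x y : ℝ} (hx : 0 < x) (hy : 0 < y) (σ₁ σ₂ t : ℝ) :
    (x : ℂ) ^ (-(σ₁ + t * I : ℂ)) * starRingEnd ℂ ((y : ℂ) ^ (-(σ₂ + t * I : ℂ))) =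
      ((x ^ (-σ₁) * y ^ (-σ₂) : ℝ) : ℂ) * cexp (I * ((Real.log y - Real.log x : ℝ) * t)) := by
  have hx' : (x : ℂ) ≠ 0 := by exact_mod_cast hx.ne'
  have hy' : (y : ℂ) ≠ 0 := by exact_mod_cast hy.ne'
  rw [conj_cpow_ofReal hy, ofReal_mul, ofReal_cpow hx.le, ofReal_cpow hy.le,
    cpow_def_of_ne_zero hx', cpow_def_of_ne_zero hy', cpow_def_of_ne_zero hx',
    cpow_def_of_ne_zero hy', ← Complex.exp_add, ← Complex.exp_add, ← Complex.exp_add,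
    ← ofReal_log hx.le, ← ofReal_log hy.le]
  congr 1
  simp only [map_neg, map_add, map_mul, conj_ofReal, conj_I]
  push_cast
  ring

/-- The family of functions `f` has negligible integral, i.e. its integral up to `T` is
`O(T^(1-σ) log T)`. -/
def Ngl (σ : ℝ) (f : ℕ → ℝ → ℂ) : Prop :=
  ∃ C, 0 ≤ C ∧ ∀ N T, 1 ≤ N → tB N ≤ T → T ≤ tB (N + 1) →
    ‖bInt f N T‖ ≤ C * (T ^ (1 - σ) * Real.log T)

lemma sq_le_of_tB_le {N : ℕ} {T : ℝ} (h : tB N ≤ T) : 6 * ((N : ℝ) + 1) ^ 2 ≤ T :=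
  (six_le_tB N).trans h

lemma le_sq_of_le_tB {N : ℕ} {T : ℝ} (hN : 1 ≤ N) (h : T ≤ tB (N + 1)) : T ≤ 57 * (N : ℝ) ^ 2 := by
  have hN' : (1 : ℝ) ≤ N := by exact_mod_cast hN
  refine h.trans ?_
  rw [tB_succ]
  have h1 : ((N : ℝ) + 2) ^ 2 ≤ (3 * N) ^ 2 := by gcongr; linarith
  have := Real.pi_lt_d2
  have := Real.pi_pos
  nlinarith

lemma one_add_log_le {N : ℕ} {T : ℝ} (hN : 1 ≤ N) (h : tB N ≤ T) : 1 + Real.log N ≤ 2 * Real.log T := by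
  have hN' : (1 : ℝ) ≤ N := by exact_mod_cast hN
  have h1 := sq_le_of_tB_le h
  have h2 : (N : ℝ) ≤ T := by nlinarith
  have h3 : Real.log N ≤ Real.log T := Real.log_le_log (by linarith) h2
  have h4 : 1 ≤ Real.log T := by
    rw [Real.le_log_iff_exp_le (by linarith)]
    have := Real.exp_one_lt_d9
    nlinarith
  linarith

lemma natCast_rpow_le {N : ℕ} {T p : ℝ} (hN : 1 ≤ N) (h : tB N ≤ T) (hp : 0 ≤ p) :
    (N : ℝ) ^ (2 * p) ≤ T ^ p := by
  have hN' : (1 : ℝ) ≤ N := by exact_mod_cast hN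
  rw [Real.rpow_mul (by linarith), Real.rpow_two]
  have h1 := sq_le_of_tB_le h
  exact Real.rpow_le_rpow (by positivity) (by nlinarith) hp

lemma rpow_le_natCast {N : ℕ} {T p : ℝ} (hN : 1 ≤ N) (hT : 0 ≤ T) (h : T ≤ tB (N + 1)) (hp : 0 ≤ p) :
    T ^ p ≤ 57 ^ p * (N : ℝ) ^ (2 * p) := by
  rw [Real.rpow_mul (by positivity), Real.rpow_two, ← Real.mul_rpow (by norm_num) (by positivity)]
  exact Real.rpow_le_rpow hT (le_sq_of_le_tB hN h) hp

lemma ngl_of_le {σ : ℝ} (hσ : σ ≤ 1) {f : ℕ → ℝ → ℂ} {C : ℝ} (hC : 0 ≤ C)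
    (h : ∀ N T, 1 ≤ N → tB N ≤ T → T ≤ tB (N + 1) →
      ‖bInt f N T‖ ≤ C * ((N : ℝ) ^ (2 - 2 * σ) * (1 + Real.log N))) : Ngl σ f := by
  refine ⟨C * 2, by positivity, fun N T hN h1 h2 => (h N T hN h1 h2).trans ?_⟩
  rw [mul_assoc]
  refine mul_le_mul_of_nonneg_left ?_ hC
  have e := natCast_rpow_le hN h1 (p := 1 - σ) (by linarith)
  rw [show 2 * (1 - σ) = 2 - 2 * σ by ring] at e
  have := one_add_log_le hN h1
  have hL : 0 ≤ 1 + Real.log N := by have := Real.log_natCast_nonneg N; linarith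
  have : 0 ≤ T := by have := one_le_tB N; linarith
  calc _ ≤ T ^ (1 - σ) * (2 * Real.log T) := by gcongr
    _ = _ := by ring

lemma Ngl.add {σ : ℝ} {f g : ℕ → ℝ → ℂ} (hf : BC f) (hg : BC g) (h1 : Ngl σ f) (h2 : Ngl σ g) :
    Ngl σ fun K t => f K t + g K t := by
  obtain ⟨C₁, hC₁, h1⟩ := h1
  obtain ⟨C₂, hC₂, h2⟩ := h2
  refine ⟨C₁ + C₂, by positivity, fun N T hN hT1 hT2 => ?_⟩
  rw [bInt_add hf hg hN hT1 hT2, add_mul]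
  exact (norm_add_le _ _).trans (add_le_add (h1 N T hN hT1 hT2) (h2 N T hN hT1 hT2))

lemma Ngl.conj {σ : ℝ} {f : ℕ → ℝ → ℂ} (h : Ngl σ f) : Ngl σ fun K t => starRingEnd ℂ (f K t) := by
  obtain ⟨C, hC, h⟩ := h
  refine ⟨C, hC, fun N T hN hT1 hT2 => ?_⟩
  have e : bInt (fun K t => starRingEnd ℂ (f K t)) N T = starRingEnd ℂ (bInt f N T) := by
    unfold bInt
    simp only [map_add, map_sum, intervalIntegral.intervalIntegral_eq_integral_uIoc, integral_conj,
      real_smul, map_mul, conj_ofReal]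
  rw [e, norm_conj]
  exact h N T hN hT1 hT2

lemma Ngl.congr {σ : ℝ} {f g : ℕ → ℝ → ℂ} (h : Ngl σ f)
    (hfg : ∀ K, 1 ≤ K → ∀ t ∈ Set.Icc (tB K) (tB (K + 1)), g K t = f K t) : Ngl σ g := by
  obtain ⟨C, hC, h⟩ := h
  refine ⟨C, hC, fun N T hN hT1 hT2 => ?_⟩
  rw [bInt_congr hfg hN hT1 hT2]
  exact h N T hN hT1 hT2

lemma Ngl.of_pointwise {σ : ℝ} (h0 : 0 < σ) (hσ : σ < 1) {f : ℕ → ℝ → ℂ} {C : ℝ} (hC : 0 ≤ C)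
    (h : ∀ K, 1 ≤ K → ∀ t ∈ Set.Icc (tB K) (tB (K + 1)), ‖f K t‖ ≤ C * t ^ (-σ)) : Ngl σ f := by
  refine ⟨C * (1 - σ)⁻¹, by have : 0 < 1 - σ := by linarith
                            positivity, fun N T hN hT1 hT2 => ?_⟩
  have h1 := one_le_tB 1
  have hT : tB 1 ≤ T := (tB_mono hN).trans hT1
  have hc : ContinuousOn (fun t : ℝ => C * t ^ (-σ)) (Set.Ici (tB 1)) := by
    refine continuousOn_const.mul (continuousOn_id.rpow_const fun t ht => Or.inl ?_)
    have : tB 1 ≤ t := ht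
    simp only [id]; linarith
  refine (norm_bInt_le_integral hc h hN hT1 hT2).trans ?_
  rw [intervalIntegral.integral_const_mul, integral_rpow (Or.inl (by linarith))]
  have h2 : 1 ≤ Real.log T := by
    have := one_add_log_le hN hT1
    have h3 := sq_le_of_tB_le hT1
    have : (0 : ℝ) ≤ N := N.cast_nonneg
    rw [Real.le_log_iff_exp_le (by linarith)]
    have := Real.exp_one_lt_d9
    nlinarith
  have h3 : 0 ≤ tB 1 ^ (-σ + 1) := by positivity
  have h4 : 0 ≤ T ^ (1 - σ) := by have : 0 ≤ T := by linarith
                                  positivity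
  rw [mul_assoc]
  refine mul_le_mul_of_nonneg_left ?_ hC
  have : 0 < 1 - σ := by linarith
  rw [show -σ + 1 = 1 - σ by ring] at h3 ⊢
  rw [div_eq_inv_mul]
  refine mul_le_mul_of_nonneg_left ?_ (by positivity)
  nlinarith

lemma BC.add {f g : ℕ → ℝ → ℂ} (hf : BC f) (hg : BC g) : BC fun K t => f K t + g K t :=
  fun K hK => (hf K hK).add (hg K hK)

lemma BC.sub {f g : ℕ → ℝ → ℂ} (hf : BC f) (hg : BC g) : BC fun K t => f K t - g K t :=
  fun K hK => (hf K hK).sub (hg K hK)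

lemma BC.mul {f g : ℕ → ℝ → ℂ} (hf : BC f) (hg : BC g) : BC fun K t => f K t * g K t :=
  fun K hK => (hf K hK).mul (hg K hK)

lemma BC.conj {f : ℕ → ℝ → ℂ} (hf : BC f) : BC fun K t => starRingEnd ℂ (f K t) :=
  fun K hK => continuous_conj.comp_continuousOn (hf K hK)

lemma BC.congr {f g : ℕ → ℝ → ℂ} (hf : BC f)
    (hfg : ∀ K, 1 ≤ K → ∀ t ∈ Set.Icc (tB K) (tB (K + 1)), g K t = f K t) : BC g :=
  fun K hK => (hf K hK).congr (hfg K hK)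

lemma continuous_cpow_line {x : ℝ} (hx : 0 < x) {g : ℝ → ℂ} (hg : Continuous g) :
    Continuous fun t => (x : ℂ) ^ g t := by
  refine continuous_iff_continuousAt.mpr fun t => ?_
  exact (continuousAt_const_cpow (by exact_mod_cast hx.ne')).comp hg.continuousAt

lemma continuous_dirSum {a : ℝ} (ha : 0 < a) (σ : ℝ) (K : ℕ) :
    Continuous fun t : ℝ => dirSum a (σ + t * I) K := by
  unfold dirSum
  exact continuous_finsetSum _ fun m _ => continuous_cpow_line (xpt_pos ha m) (by fun_prop)

lemma continuousOn_gam (σ : ℝ) : ContinuousOn (fun t : ℝ => gam (σ + t * I)) (Set.Ioi 0) := by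
  intro t ht
  have ht : 0 < t := ht
  have h : DifferentiableAt ℂ gam (σ + t * I) := differentiableAt_gam (by simp; exact ht.ne')
  have hc : ContinuousAt (fun t : ℝ => (σ + t * I : ℂ)) t := by fun_prop
  exact (ContinuousAt.comp (f := fun t : ℝ => (σ + t * I : ℂ)) (g := gam) h.continuousAt hc).continuousWithinAt

lemma continuousOn_dualSum (a σ : ℝ) (K : ℕ) :
    ContinuousOn (fun t : ℝ => dualSum a (σ + t * I) K) (Set.Ioi 0) := by
  unfold dualSum
  refine continuousOn_finsetSum _ fun n _ => continuousOn_const.mul ((continuousOn_gam σ).mul ?_)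
  exact (continuous_cpow_line (by positivity) (by fun_prop)).continuousOn

lemma Icc_tB_subset (K : ℕ) : Set.Icc (tB K) (tB (K + 1)) ⊆ Set.Ioi 0 := fun t ht => by
  have := one_le_tB K
  have := ht.1
  show 0 < t
  linarith

lemma bc_dirSum {a : ℝ} (ha : 0 < a) (σ : ℝ) : BC fun K t => dirSum a (σ + t * I) K :=
  fun K _ => (continuous_dirSum ha σ K).continuousOn

lemma bc_dualSum (a σ : ℝ) : BC fun K t => dualSum a (σ + t * I) K :=
  fun K _ => (continuousOn_dualSum a σ K).mono (Icc_tB_subset K)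

/-- Splitting off the diagonal of a double sum. -/
lemma sum_mul_conj_sum (f : ℕ → ℂ) (K : ℕ) :
    (∑ i ∈ range K, f i) * starRingEnd ℂ (∑ i ∈ range K, f i) =
      (∑ i ∈ range K, ((‖f i‖ ^ 2 : ℝ) : ℂ)) +
      ∑ i ∈ range K, ∑ j ∈ range K, if i = j then 0 else f i * starRingEnd ℂ (f j) := by
  rw [map_sum, sum_mul_sum, ← sum_add_distrib]
  refine sum_congr rfl fun i hi => ?_
  have : ((‖f i‖ ^ 2 : ℝ) : ℂ) = ∑ j ∈ range K, if i = j then f i * starRingEnd ℂ (f j) else 0 := by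
    rw [sum_ite_eq, if_pos hi, mul_conj, normSq_eq_norm_sq]
  rw [this, ← sum_add_distrib]
  refine sum_congr rfl fun j _ => ?_
  split_ifs <;> simp

lemma norm_xpt_cpow {a : ℝ} (ha : 0 < a) (m : ℕ) (σ t : ℝ) :
    ‖(xpt a m : ℂ) ^ (-(σ + t * I : ℂ))‖ = xpt a m ^ (-σ) := by
  rw [norm_cpow_eq_rpow_re_of_pos (xpt_pos ha m)]
  congr 1; simp

lemma rpow_sq_eq {x : ℝ} (hx : 0 < x) (p : ℝ) : (x ^ p) ^ 2 = x ^ (2 * p) := by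
  rw [← Real.rpow_natCast (x ^ p), ← Real.rpow_mul hx.le]
  congr 1; push_cast; ring

lemma two_sq_rpow_le {N : ℕ} (hN : 1 ≤ N) {p : ℝ} (hp : 0 ≤ p) : ((N : ℝ) ^ p + 1) * ((N : ℝ) ^ p + 1)
    ≤ 4 * (N : ℝ) ^ (2 * p) := by
  have hN' : (1 : ℝ) ≤ N := by exact_mod_cast hN
  have h1 : 1 ≤ (N : ℝ) ^ p := Real.one_le_rpow hN' hp
  rw [← rpow_sq_eq (by linarith)]
  nlinarith

/-- The mean square of the Dirichlet polynomial, off the diagonal. -/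
lemma ngl_dir_dir {a : ℝ} (ha : 0 < a) (ha1 : a ≤ 1) {σ : ℝ} (h0 : 0 < σ) (h1 : σ < 1) :
    Ngl σ fun K t => dirSum a (σ + t * I) K * starRingEnd ℂ (dirSum a (σ + t * I) K) -
      ((∑ m ∈ range K, xpt a m ^ (-(2 * σ)) : ℝ) : ℂ) := by
  obtain ⟨C, hC, h⟩ := sum_offdiag_le ha ha1 h0 h1.ne h0 h1.ne
  set c : ℕ → ℕ → ℝ → ℂ := fun i j t => if i = j then 0 else
    (xpt a i : ℂ) ^ (-(σ + t * I : ℂ)) * starRingEnd ℂ ((xpt a j : ℂ) ^ (-(σ + t * I : ℂ))) with hc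
  have hcc : ∀ i j, ContinuousOn (c i j) (Set.Ici (tB 1)) := fun i j => by
    by_cases hij : i = j
    · simp only [hc, hij, if_true]; exact continuousOn_const
    · simp only [hc, hij, if_false]
      exact ((continuous_cpow_line (xpt_pos ha i) (by fun_prop)).mul
        (continuous_conj.comp (continuous_cpow_line (xpt_pos ha j) (by fun_prop)))).continuousOn
  refine Ngl.congr (f := fun K t => ∑ i ∈ range K, ∑ j ∈ range K, c i j t) ?_ fun K _ t _ => ?_
  · refine ngl_of_le h1.le (C := 2 * C * 4) (by positivity) fun N T hN hT1 hT2 => ?_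
    rw [bInt_switch hcc hN hT1]
    have hb : ∀ i ∈ range N, ∀ j ∈ range N, ‖∫ t in tB (max i j + 1)..T, c i j t‖ ≤
        2 * (xpt a i ^ (-σ) * xpt a j ^ (-σ) * |Real.log (xpt a i) - Real.log (xpt a j)|⁻¹) := by
      intro i hi j hj
      by_cases hij : i = j
      · simp [hc, hij]
      · have hl : Real.log (xpt a j) - Real.log (xpt a i) ≠ 0 := log_xpt_ne ha (Ne.symm hij)
        simp only [hc, hij, if_false]
        simp_rw [cpow_mul_conj_cpow (xpt_pos ha i) (xpt_pos ha j)]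
        rw [intervalIntegral.integral_const_mul, norm_mul, norm_real, Real.norm_of_nonneg
          (mul_nonneg (Real.rpow_nonneg (xpt_pos ha i).le _) (Real.rpow_nonneg (xpt_pos ha j).le _))]
        have h2 : tB (max i j + 1) ≤ T := (tB_mono (by
          rw [mem_range] at hi hj; omega)).trans hT1
        have h3 := norm_integral_cexp_le hl (by have := one_le_tB (max i j + 1); linarith) h2
        rw [abs_sub_comm] at h3
        calc _ ≤ xpt a i ^ (-σ) * xpt a j ^ (-σ) * (2 * |Real.log (xpt a i) - Real.log (xpt a j)|⁻¹) :=
              mul_le_mul_of_nonneg_left h3 (mul_nonneg (Real.rpow_nonneg (xpt_pos ha i).le _)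
                (Real.rpow_nonneg (xpt_pos ha j).le _))
          _ = _ := by ring
    refine (norm_sum_le _ _).trans ((sum_le_sum fun i hi => (norm_sum_le _ _).trans
      (sum_le_sum fun j hj => hb i hi j hj)).trans ?_)
    simp_rw [← mul_sum]
    have hL : 0 ≤ 1 + Real.log N := by have := Real.log_natCast_nonneg N; linarith
    have h5 := two_sq_rpow_le hN (p := 1 - σ) (by linarith)
    rw [show 2 * (1 - σ) = 2 - 2 * σ by ring] at h5
    calc _ ≤ 2 * (C * (((N : ℝ) ^ (1 - σ) + 1) * ((N : ℝ) ^ (1 - σ) + 1) * (1 + Real.log N))) := by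
          gcongr; exact h N hN
      _ ≤ 2 * (C * (4 * (N : ℝ) ^ (2 - 2 * σ) * (1 + Real.log N))) := by
          refine mul_le_mul_of_nonneg_left (mul_le_mul_of_nonneg_left
            (mul_le_mul_of_nonneg_right h5 hL) hC) (by norm_num)
      _ = _ := by ring
  · simp only [dirSum]
    rw [sum_mul_conj_sum, ofReal_sum, sub_eq_iff_eq_add, add_comm]
    congr 1
    refine sum_congr rfl fun m _ => ?_
    rw [norm_xpt_cpow ha, rpow_sq_eq (xpt_pos ha m)]
    congr 2; ring

lemma norm_ex_neg_natCast_mul (a : ℝ) (n : ℕ) : ‖ex (-(((n : ℂ) + 1) * a))‖ = 1 := by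
  rw [norm_ex]; simp

/-- The terms of the dual sum without the Gamma factor. -/
noncomputable def dTerm (a σ t : ℝ) (n : ℕ) : ℂ :=
  ex (-(((n : ℂ) + 1) * a)) * (xpt 1 n : ℂ) ^ (-(((1 - σ : ℝ) : ℂ) + ((-t : ℝ) : ℂ) * I))

lemma dualSum_eq (a σ t : ℝ) (K : ℕ) :
    dualSum a (σ + t * I) K = gam (σ + t * I) * ∑ n ∈ range K, dTerm a σ t n := by
  unfold dualSum dTerm
  rw [mul_sum]
  refine sum_congr rfl fun n _ => ?_
  have : -(((1 - σ : ℝ) : ℂ) + ((-t : ℝ) : ℂ) * I) = σ + t * I - 1 := by push_cast; ring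
  rw [this]
  simp only [xpt]
  ring

lemma norm_dTerm (a σ t : ℝ) (n : ℕ) : ‖dTerm a σ t n‖ = xpt 1 n ^ (-(1 - σ)) := by
  rw [dTerm, norm_mul, norm_ex_neg_natCast_mul, one_mul, norm_xpt_cpow one_pos]

lemma continuous_dTerm (a σ : ℝ) (n : ℕ) : Continuous fun t => dTerm a σ t n := by
  unfold dTerm
  exact continuous_const.mul (continuous_cpow_line (xpt_pos one_pos n) (by fun_prop))

lemma sum_xpt_le' {a : ℝ} (ha : 0 < a) (ha1 : a ≤ 1) {β : ℝ} (hβ : 0 < β) (hβ1 : β < 1) :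
    ∃ C, 0 ≤ C ∧ ∀ N : ℕ, 1 ≤ N → ∑ m ∈ range N, xpt a m ^ (-β) ≤ C * (N : ℝ) ^ (1 - β) := by
  obtain ⟨C, hC, h⟩ := sum_xpt_le ha ha1 hβ hβ1.ne
  refine ⟨2 * C, by positivity, fun N hN => (h N hN).trans ?_⟩
  have : 1 ≤ (N : ℝ) ^ (1 - β) := Real.one_le_rpow (by exact_mod_cast hN) (by linarith)
  nlinarith

lemma two_pi_rpow_le {t p : ℝ} (ht : 0 ≤ t) (hp : 0 ≤ p) : (t / (2 * Real.pi)) ^ p ≤ t ^ p := by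
  have := Real.pi_gt_three
  refine Real.rpow_le_rpow (by positivity) (div_le_self ht (by linarith)) hp

/-- The mean square of the dual sum, off the diagonal. -/
lemma ngl_dual_dual (a : ℝ) {σ : ℝ} (h0 : 0 < σ) (h1 : σ < 1 / 2) :
    Ngl σ fun K t => dualSum a (σ + t * I) K * starRingEnd ℂ (dualSum a (σ + t * I) K) -
      (((t / (2 * Real.pi)) ^ (1 - 2 * σ) * ∑ n ∈ range K, xpt 1 n ^ (-(2 - 2 * σ)) : ℝ) : ℂ) := by
  obtain ⟨C, hC, h⟩ := sum_offdiag_le one_pos le_rfl (β := 1 - σ) (γ := 1 - σ) (by linarith)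
    (by linarith) (by linarith) (by linarith)
  obtain ⟨C₁, hC₁, h₁⟩ := sum_xpt_le' one_pos le_rfl (β := 1 - σ) (by linarith) (by linarith)
  have hpi := Real.pi_gt_three
  set w : ℝ → ℝ := fun t => (t / (2 * Real.pi)) ^ (1 - 2 * σ) with hw
  have hwc : Continuous w := (continuous_id.div_const _).rpow_const fun _ => Or.inr (by linarith)
  set c : ℕ → ℕ → ℝ → ℂ := fun i j t => (w t : ℂ) * (if i = j then 0 else
    dTerm a σ t i * starRingEnd ℂ (dTerm a σ t j)) with hc
  have hcc' : ∀ i j, Continuous (c i j) := fun i j => by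
    by_cases hij : i = j
    · simp only [hc, hij, if_true, mul_zero]; exact continuous_const
    · simp only [hc, hij, if_false]
      exact (continuous_ofReal.comp hwc).mul ((continuous_dTerm a σ i).mul
        (continuous_conj.comp (continuous_dTerm a σ j)))
  have hcc : ∀ i j, ContinuousOn (c i j) (Set.Ici (tB 1)) := fun i j => (hcc' i j).continuousOn
  set E : ℕ → ℝ → ℂ := fun K t => ((‖gam (σ + t * I)‖ ^ 2 - w t : ℝ) : ℂ) *
    ((∑ n ∈ range K, dTerm a σ t n) * starRingEnd ℂ (∑ n ∈ range K, dTerm a σ t n)) with hE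
  have hEc : BC E := fun K _ => by
    refine (continuous_ofReal.comp_continuousOn (((((continuousOn_gam σ).mono
      (Icc_tB_subset K)).norm).pow 2).sub hwc.continuousOn)).mul (Continuous.continuousOn ?_)
    have : Continuous fun t => ∑ n ∈ range K, dTerm a σ t n :=
      continuous_finsetSum _ fun n _ => continuous_dTerm a σ n
    exact this.mul (continuous_conj.comp this)
  have hSc : BC (fun K t => ∑ i ∈ range K, ∑ j ∈ range K, c i j t) := fun K _ =>
    (continuous_finsetSum _ fun i _ => continuous_finsetSum _ fun j _ => hcc' i j).continuousOn
  refine Ngl.congr (f := fun K t => (∑ i ∈ range K, ∑ j ∈ range K, c i j t) + E K t)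
    (Ngl.add hSc hEc ?_ ?_) fun K _ t _ => ?_
  · refine ngl_of_le (by linarith) (C := 2 * 57 ^ (1 - 2 * σ) * C * 4) (by positivity)
      fun N T hN hT1 hT2 => ?_
    have hT0 : 0 ≤ T := by have := one_le_tB N; linarith
    have hwT : w T ≤ 57 ^ (1 - 2 * σ) * (N : ℝ) ^ (2 * (1 - 2 * σ)) :=
      (two_pi_rpow_le hT0 (by linarith)).trans (rpow_le_natCast hN hT0 hT2 (by linarith))
    have hwT0 : 0 ≤ w T := by simp only [hw]; positivity
    rw [bInt_switch hcc hN hT1]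
    have hb : ∀ i ∈ range N, ∀ j ∈ range N, ‖∫ t in tB (max i j + 1)..T, c i j t‖ ≤
        2 * w T * (xpt 1 i ^ (-(1 - σ)) * xpt 1 j ^ (-(1 - σ)) *
          |Real.log (xpt 1 i) - Real.log (xpt 1 j)|⁻¹) := by
      intro i hi j hj
      by_cases hij : i = j
      · simp [hc, hij]
      · have hl : Real.log (xpt 1 i) - Real.log (xpt 1 j) ≠ 0 := log_xpt_ne one_pos hij
        have hxx : 0 ≤ xpt 1 i ^ (-(1 - σ)) * xpt 1 j ^ (-(1 - σ)) :=
          mul_nonneg (Real.rpow_nonneg (xpt_pos one_pos i).le _)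
            (Real.rpow_nonneg (xpt_pos one_pos j).le _)
        have e : ∀ t, c i j t = (ex (-(((i : ℂ) + 1) * a)) * starRingEnd ℂ (ex (-(((j : ℂ) + 1) * a))) *
            ((xpt 1 i ^ (-(1 - σ)) * xpt 1 j ^ (-(1 - σ)) : ℝ) : ℂ)) *
            ((w t : ℂ) * cexp (I * ((Real.log (xpt 1 i) - Real.log (xpt 1 j) : ℝ) * t))) := by
          intro t
          simp only [hc, hij, if_false, dTerm]
          have e1 := cpow_mul_conj_cpow (xpt_pos one_pos i) (xpt_pos one_pos j) (1 - σ) (1 - σ) (-t)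
          have e2 : cexp (I * ((Real.log (xpt 1 j) - Real.log (xpt 1 i) : ℝ) * (-t : ℝ))) =
            cexp (I * ((Real.log (xpt 1 i) - Real.log (xpt 1 j) : ℝ) * t)) := by
            congr 1; push_cast; ring
          rw [e2] at e1
          rw [map_mul]
          linear_combination ((w t : ℂ) * ex (-(((i : ℂ) + 1) * a)) *
            starRingEnd ℂ (ex (-(((j : ℂ) + 1) * a)))) * e1
        simp_rw [e]
        rw [intervalIntegral.integral_const_mul, norm_mul, norm_mul, norm_mul, norm_conj,
          norm_ex_neg_natCast_mul, norm_ex_neg_natCast_mul, norm_real, Real.norm_of_nonneg hxx]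
        have h2 : tB (max i j + 1) ≤ T := (tB_mono (by
          rw [mem_range] at hi hj; omega)).trans hT1
        have h3 := norm_integral_rpow_mul_cexp_le (p := 1 - 2 * σ) (by linarith) hl
          (by have := one_le_tB (max i j + 1); linarith) h2
        calc _ ≤ 1 * 1 * (xpt 1 i ^ (-(1 - σ)) * xpt 1 j ^ (-(1 - σ))) *
              (2 * w T * |Real.log (xpt 1 i) - Real.log (xpt 1 j)|⁻¹) :=
              mul_le_mul_of_nonneg_left h3 (by linarith)
          _ = _ := by ring
    refine (norm_sum_le _ _).trans ((sum_le_sum fun i hi => (norm_sum_le _ _).trans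
      (sum_le_sum fun j hj => hb i hi j hj)).trans ?_)
    simp_rw [← mul_sum]
    have hL : 0 ≤ 1 + Real.log N := by have := Real.log_natCast_nonneg N; linarith
    have h5 := two_sq_rpow_le hN (p := σ) (by linarith)
    have h6 := h N hN
    rw [sub_sub_cancel] at h6
    have hNp : (0 : ℝ) < N := by exact_mod_cast hN
    have e3 : (N : ℝ) ^ (2 * (1 - 2 * σ)) * (N : ℝ) ^ (2 * σ) = (N : ℝ) ^ (2 - 2 * σ) := by
      rw [← Real.rpow_add hNp]; congr 1; ring
    calc _ ≤ 2 * w T * (C * (((N : ℝ) ^ σ + 1) * ((N : ℝ) ^ σ + 1) * (1 + Real.log N))) := by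
          gcongr
      _ ≤ 2 * (57 ^ (1 - 2 * σ) * (N : ℝ) ^ (2 * (1 - 2 * σ))) *
            (C * (4 * (N : ℝ) ^ (2 * σ) * (1 + Real.log N))) := by
          have := mul_le_mul_of_nonneg_right h5 hL
          refine mul_le_mul (by linarith) (mul_le_mul_of_nonneg_left this hC) ?_ (by positivity)
          have : 0 ≤ ((N : ℝ) ^ σ + 1) * ((N : ℝ) ^ σ + 1) := by positivity
          positivity
      _ = 2 * 57 ^ (1 - 2 * σ) * C * 4 *
            (((N : ℝ) ^ (2 * (1 - 2 * σ)) * (N : ℝ) ^ (2 * σ)) * (1 + Real.log N)) := by ring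
      _ = _ := by rw [e3]
  · refine Ngl.of_pointwise h0 (by linarith) (C := cGa * C₁ ^ 2)
      (by have := cGa_pos; positivity) fun K hK t ht => ?_
    have ht1 : 1 ≤ t := (one_le_tB K).trans ht.1
    have hg := norm_gam_sq_sub_le (s := σ + t * I) (by simp; linarith) (by simp; linarith)
      (by simpa using ht1)
    have hre : (σ + t * I : ℂ).re = σ := by simp
    have him : (σ + t * I : ℂ).im = t := by simp
    rw [hre, him] at hg
    have hH : ‖∑ n ∈ range K, dTerm a σ t n‖ ≤ C₁ * (K : ℝ) ^ σ := by
      refine (norm_sum_le _ _).trans ?_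
      simp_rw [norm_dTerm]
      have := h₁ K hK
      rwa [sub_sub_cancel] at this
    have hKt := natCast_rpow_le hK ht.1 h0.le
    rw [mul_comm 2 σ, mul_comm σ 2, ← rpow_sq_eq (by exact_mod_cast hK)] at hKt
    have hwt := two_pi_rpow_le (t := t) (by linarith) (p := 1 - 2 * σ) (by linarith)
    have htp : 0 < t := by linarith
    simp only [hE]
    rw [norm_mul, norm_mul, norm_conj, norm_real, Real.norm_eq_abs]
    have hca := cGa_pos
    have e4 : t ^ (1 - 2 * σ) / t * t ^ σ = t ^ (-σ) := by
      rw [div_eq_mul_inv, ← Real.rpow_neg_one t, ← Real.rpow_add htp, ← Real.rpow_add htp]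
      congr 1; ring
    calc _ ≤ (cGa * (t ^ (1 - 2 * σ) / t)) * ((C₁ * (K : ℝ) ^ σ) * (C₁ * (K : ℝ) ^ σ)) := by
          refine mul_le_mul (hg.trans ?_) (mul_le_mul hH hH (norm_nonneg _) (by positivity))
            (by positivity) (by positivity)
          gcongr
      _ = cGa * (t ^ (1 - 2 * σ) / t) * C₁ ^ 2 * ((K : ℝ) ^ σ) ^ 2 := by ring
      _ ≤ cGa * (t ^ (1 - 2 * σ) / t) * C₁ ^ 2 * t ^ σ := by gcongr
      _ = cGa * C₁ ^ 2 * (t ^ (1 - 2 * σ) / t * t ^ σ) := by ring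
      _ = _ := by rw [e4]
  · have e5 := sum_mul_conj_sum (fun n => dTerm a σ t n) K
    have e6 : ∑ i ∈ range K, ((‖dTerm a σ t i‖ ^ 2 : ℝ) : ℂ) =
        ((∑ n ∈ range K, xpt 1 n ^ (-(2 - 2 * σ)) : ℝ) : ℂ) := by
      rw [ofReal_sum]
      refine sum_congr rfl fun n _ => ?_
      rw [norm_dTerm, rpow_sq_eq (xpt_pos one_pos n)]
      congr 2; ring
    have e7 : ∑ i ∈ range K, ∑ j ∈ range K, c i j t = (w t : ℂ) * ∑ i ∈ range K, ∑ j ∈ range K,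
        if i = j then 0 else dTerm a σ t i * starRingEnd ℂ (dTerm a σ t j) := by
      simp only [hc, mul_sum]
    have e8 : gam (σ + t * I) * starRingEnd ℂ (gam (σ + t * I)) = ((‖gam (σ + t * I)‖ ^ 2 : ℝ) : ℂ) := by
      rw [mul_conj, normSq_eq_norm_sq]
    rw [e6] at e5
    rw [dualSum_eq, map_mul, e7]
    simp only [hE]
    have e9 : (t / (2 * Real.pi)) ^ (1 - 2 * σ) = w t := rfl
    rw [e9, ofReal_mul, ofReal_sub]
    linear_combination (w t : ℂ) * e5 + ((∑ n ∈ range K, dTerm a σ t n) *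
      starRingEnd ℂ (∑ n ∈ range K, dTerm a σ t n)) * e8

lemma conj_line (σ t : ℝ) : starRingEnd ℂ (σ + t * I : ℂ) = 2 * σ - (σ + t * I) := by
  simp only [map_add, map_mul, conj_ofReal, conj_I]; ring

lemma gam_mul_conj_cpow {x y : ℝ} (hx : 0 < x) (hy : 0 < y) (σ t : ℝ) :
    gam (σ + t * I) * (y : ℂ) ^ (σ + t * I - 1 : ℂ) *
      starRingEnd ℂ ((x : ℂ) ^ (-(σ + t * I : ℂ))) =
      ((x ^ (-(2 * σ)) * y⁻¹ : ℝ) : ℂ) * gz ((y * x : ℝ) : ℂ) (σ + t * I) := by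
  have hx' : (x : ℂ) ≠ 0 := by exact_mod_cast hx.ne'
  have hy' : (y : ℂ) ≠ 0 := by exact_mod_cast hy.ne'
  rw [conj_cpow_ofReal hx, map_neg, conj_line, gz, ofReal_mul y, mul_cpow_ofReal_nonneg hy.le hx.le,
    cpow_sub _ _ hy', cpow_one, show -(2 * (σ : ℂ) - (σ + t * I)) = -(2 * (σ : ℂ)) + (σ + t * I) by ring,
    cpow_add _ _ hx', ofReal_mul, ofReal_cpow hx.le]
  push_cast
  field_simp

/-- The interaction of the two sums. -/
lemma ngl_dual_dir {a : ℝ} (ha : 0 < a) (ha1 : a ≤ 1) {σ : ℝ} (h0 : 0 < σ) (h1 : σ < 1 / 2) :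
    Ngl σ fun K t => dualSum a (σ + t * I) K * starRingEnd ℂ (dirSum a (σ + t * I) K) := by
  obtain ⟨C₁, hC₁, h₁⟩ := sum_xpt_le' one_pos le_rfl (β := 1 - σ) (by linarith) (by linarith)
  obtain ⟨C₂, hC₂, h₂⟩ := sum_xpt_le' ha ha1 (β := σ) (by linarith) (by linarith)
  have hca := cGa_pos
  have hpi := Real.pi_pos
  set c : ℕ → ℕ → ℝ → ℂ := fun i j t => ex (-(((i : ℂ) + 1) * a)) *
    (gam (σ + t * I) * (xpt 1 i : ℂ) ^ (σ + t * I - 1 : ℂ)) *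
      starRingEnd ℂ ((xpt a j : ℂ) ^ (-(σ + t * I : ℂ))) with hc
  have hcc : ∀ i j, ContinuousOn (c i j) (Set.Ici (tB 1)) := fun i j => by
    have hsub : Set.Ici (tB 1) ⊆ Set.Ioi 0 := fun t ht => by
      have h1 := one_le_tB 1
      have h2 : tB 1 ≤ t := ht
      show 0 < t
      linarith
    exact (continuousOn_const.mul (((continuousOn_gam σ).mono hsub).mul
      (continuous_cpow_line (xpt_pos one_pos i) (by fun_prop)).continuousOn)).mul
      (continuous_conj.comp (continuous_cpow_line (xpt_pos ha j) (by fun_prop))).continuousOn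
  refine Ngl.congr (f := fun K t => ∑ i ∈ range K, ∑ j ∈ range K, c i j t) ?_ fun K _ t _ => ?_
  · refine ngl_of_le (by linarith) (C := 2 * cGa * 57 ^ (1 / 2 - σ) * ((2 / a * C₁ + 2 * C₂) * 2))
      (by positivity) fun N T hN hT1 hT2 => ?_
    have hNp : (0 : ℝ) < N := by exact_mod_cast hN
    have hT0 : 0 ≤ T := by have := one_le_tB N; linarith
    have hTp : T ^ (1 / 2 - σ) ≤ 57 ^ (1 / 2 - σ) * (N : ℝ) ^ (2 * (1 / 2 - σ)) :=
      rpow_le_natCast hN hT0 hT2 (by linarith)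
    have hTp0 : 0 ≤ T ^ (1 / 2 - σ) := by positivity
    rw [bInt_switch hcc hN hT1]
    have hb : ∀ i ∈ range N, ∀ j ∈ range N, ‖∫ t in tB (max i j + 1)..T, c i j t‖ ≤
        2 * cGa * T ^ (1 / 2 - σ) * ((2 / a * (N : ℝ) ^ (1 - σ) * xpt 1 i ^ (-(1 - σ)) +
          2 * (N : ℝ) ^ σ * xpt a j ^ (-σ)) * (fun x : ℝ => (x + 1)⁻¹) |(i : ℝ) - j|) := by
      intro i hi j hj
      have hiN : (i : ℝ) + 1 ≤ N := by exact_mod_cast mem_range.mp hi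
      have hjN : (j : ℝ) + 1 ≤ N := by exact_mod_cast mem_range.mp hj
      have hxi := xpt_pos one_pos i
      have hxj := xpt_pos ha j
      have hi0 : (0 : ℝ) ≤ i := i.cast_nonneg
      have hj0 : (0 : ℝ) ≤ j := j.cast_nonneg
      have exi : xpt 1 i = i + 1 := rfl
      have hxj' : xpt a j ≤ j + 1 := by unfold xpt; linarith
      set z : ℝ := xpt 1 i * xpt a j with hz
      have hz0 : 0 < z := by positivity
      set M : ℝ := (max i j : ℕ) + 2 with hM
      have hM0 : 0 < M := by positivity
      have hMi : (i : ℝ) + 2 ≤ M := by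
        have : (i : ℝ) ≤ (max i j : ℕ) := by exact_mod_cast le_max_left i j
        linarith
      have hMj : (j : ℝ) + 2 ≤ M := by
        have : (j : ℝ) ≤ (max i j : ℕ) := by exact_mod_cast le_max_right i j
        linarith
      have hd0 : 0 ≤ |(i : ℝ) - j| := abs_nonneg _
      have hMd : z ≤ M * (M - 1 - |(i : ℝ) - j|) := by
        have h3 : z ≤ (i + 1) * (j + 1) := by
          rw [hz, exi]; gcongr
        rcases le_total i j with hij | hij
        · have : (i : ℝ) ≤ j := by exact_mod_cast hij
          have e : M = j + 2 := by rw [hM, max_eq_right hij]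
          rw [abs_of_nonpos (by linarith), e]; nlinarith
        · have : (j : ℝ) ≤ i := by exact_mod_cast hij
          have e : M = i + 2 := by rw [hM, max_eq_left hij]
          rw [abs_of_nonneg (by linarith), e]; nlinarith
      have hq : (|(i : ℝ) - j| + 1) / M ≤ 1 - z / M ^ 2 := by
        rw [div_le_iff₀ hM0, sub_mul, one_mul, pow_two, ← div_div, div_mul_cancel₀ _ hM0.ne']
        have : z / M ≤ M - 1 - |(i : ℝ) - j| := by rw [div_le_iff₀ hM0]; linarith
        linarith
      have hq0 : 0 < (|(i : ℝ) - j| + 1) / M := by positivity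
      have hτ : tB (max i j + 1) = 2 * Real.pi * M ^ 2 := by rw [tB_succ, hM]
      have hτT : tB (max i j + 1) ≤ T := (tB_mono (by
          rw [mem_range] at hi hj; omega)).trans hT1
      have hzc : ((z : ℝ) : ℂ) ≠ 0 := by exact_mod_cast hz0.ne'
      have hg := norm_integral_gz_le hzc h0.le h1.le (one_le_tB (max i j + 1)) hτT
        (q := z / M ^ 2) (by linarith) (by
          rw [hτ, norm_real, Real.norm_of_nonneg hz0.le]
          field_simp; exact le_rfl)
      rw [arg_ofReal_of_nonneg hz0.le, mul_zero, neg_zero, Real.exp_zero, mul_one, mul_zero, neg_zero,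
        Real.exp_zero, mul_one, norm_real, Real.norm_of_nonneg hz0.le] at hg
      have hττ : tB (max i j + 1) ^ (1 / 2 - σ) ≤ T ^ (1 / 2 - σ) :=
        Real.rpow_le_rpow (by have := one_le_tB (max i j + 1); linarith) hτT (by linarith)
      have e : ∀ t, c i j t = (ex (-(((i : ℂ) + 1) * a)) *
          ((xpt a j ^ (-(2 * σ)) * (xpt 1 i)⁻¹ : ℝ) : ℂ)) * gz (z : ℂ) (σ + t * I) := fun t => by
        have := gam_mul_conj_cpow hxj hxi σ t
        simp only [hc]
        linear_combination ex (-(((i : ℂ) + 1) * a)) * this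
      simp_rw [e]
      have hcf : 0 ≤ xpt a j ^ (-(2 * σ)) * (xpt 1 i)⁻¹ := by positivity
      rw [intervalIntegral.integral_const_mul, norm_mul, norm_mul, norm_ex_neg_natCast_mul, one_mul,
        norm_real, Real.norm_of_nonneg hcf]
      have hzσ : xpt a j ^ (-(2 * σ)) * (xpt 1 i)⁻¹ * z ^ σ = xpt a j ^ (-σ) * xpt 1 i ^ (-(1 - σ)) := by
        rw [hz, Real.mul_rpow hxi.le hxj.le, ← Real.rpow_neg_one (xpt 1 i)]
        calc _ = (xpt a j ^ (-(2 * σ)) * xpt a j ^ σ) * (xpt 1 i ^ (-1 : ℝ) * xpt 1 i ^ σ) := by ring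
          _ = _ := by
            rw [← Real.rpow_add hxj, ← Real.rpow_add hxi]
            congr 2 <;> ring
      have hbound : M * (xpt a j ^ (-σ) * xpt 1 i ^ (-(1 - σ))) ≤
          2 / a * (N : ℝ) ^ (1 - σ) * xpt 1 i ^ (-(1 - σ)) + 2 * (N : ℝ) ^ σ * xpt a j ^ (-σ) := by
        have p1 : 0 ≤ xpt 1 i ^ (-(1 - σ)) := by positivity
        have p2 : 0 ≤ xpt a j ^ (-σ) := by positivity
        rcases le_total i j with hij | hij
        · have e3 : M = j + 2 := by rw [hM, max_eq_right hij]
          have h3 : M ≤ 2 / a * xpt a j := by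
            rw [e3, div_mul_eq_mul_div, le_div_iff₀ ha]; unfold xpt; nlinarith
          have h4 : xpt a j * xpt a j ^ (-σ) ≤ (N : ℝ) ^ (1 - σ) := by
            rw [mul_comm, ← Real.rpow_add_one hxj.ne', show -σ + 1 = 1 - σ by ring]
            exact Real.rpow_le_rpow hxj.le (by linarith) (by linarith)
          calc _ ≤ 2 / a * xpt a j * (xpt a j ^ (-σ) * xpt 1 i ^ (-(1 - σ))) := by gcongr
            _ = 2 / a * (xpt a j * xpt a j ^ (-σ)) * xpt 1 i ^ (-(1 - σ)) := by ring
            _ ≤ 2 / a * (N : ℝ) ^ (1 - σ) * xpt 1 i ^ (-(1 - σ)) := by gcongr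
            _ ≤ _ := by
              have : 0 ≤ 2 * (N : ℝ) ^ σ * xpt a j ^ (-σ) := by positivity
              linarith
        · have e3 : M = i + 2 := by rw [hM, max_eq_left hij]
          have h3 : M ≤ 2 * xpt 1 i := by rw [e3, exi]; linarith
          have h4 : xpt 1 i * xpt 1 i ^ (-(1 - σ)) ≤ (N : ℝ) ^ σ := by
            rw [mul_comm, ← Real.rpow_add_one hxi.ne', show -(1 - σ) + 1 = σ by ring]
            exact Real.rpow_le_rpow hxi.le (by rw [exi]; linarith) (by linarith)
          calc _ ≤ 2 * xpt 1 i * (xpt a j ^ (-σ) * xpt 1 i ^ (-(1 - σ))) := by gcongr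
            _ = 2 * (xpt 1 i * xpt 1 i ^ (-(1 - σ))) * xpt a j ^ (-σ) := by ring
            _ ≤ 2 * (N : ℝ) ^ σ * xpt a j ^ (-σ) := by gcongr
            _ ≤ _ := by
              have : 0 ≤ 2 / a * (N : ℝ) ^ (1 - σ) * xpt 1 i ^ (-(1 - σ)) := by positivity
              linarith
      have hd1 : 0 < |(i : ℝ) - j| + 1 := by linarith
      calc _ ≤ xpt a j ^ (-(2 * σ)) * (xpt 1 i)⁻¹ * (cGa * (z ^ σ * T ^ (1 / 2 - σ) +
              z ^ σ * T ^ (1 / 2 - σ)) / ((|(i : ℝ) - j| + 1) / M)) := by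
            refine mul_le_mul_of_nonneg_left (hg.trans ?_) hcf
            gcongr
        _ = 2 * cGa * T ^ (1 / 2 - σ) * (M * (xpt a j ^ (-(2 * σ)) * (xpt 1 i)⁻¹ * z ^ σ) *
              (|(i : ℝ) - j| + 1)⁻¹) := by
            field_simp; ring
        _ ≤ _ := by
            rw [hzσ]
            refine mul_le_mul_of_nonneg_left (mul_le_mul_of_nonneg_right hbound ?_) (by positivity)
            positivity
    refine (norm_sum_le _ _).trans ((sum_le_sum fun i hi => (norm_sum_le _ _).trans
      (sum_le_sum fun j hj => hb i hi j hj)).trans ?_)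
    simp_rw [← mul_sum]
    have hL : 0 ≤ 1 + Real.log N := by have := Real.log_natCast_nonneg N; linarith
    have h6 := sum_sum_dist_le (N := N) (d := fun x => (x + 1)⁻¹) (fun i hi => sum_inv_dist_succ_le hi)
      (f := fun i => 2 / a * (N : ℝ) ^ (1 - σ) * xpt 1 i ^ (-(1 - σ)))
      (g := fun j => 2 * (N : ℝ) ^ σ * xpt a j ^ (-σ))
      (fun i => by have := xpt_pos one_pos i
                   positivity) (fun j => by have := xpt_pos ha j
                                            positivity)
    rw [← mul_sum, ← mul_sum] at h6
    have h7 := h₁ N hN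
    rw [sub_sub_cancel] at h7
    have h8 := h₂ N hN
    have e3 : (N : ℝ) ^ (1 - σ) * (N : ℝ) ^ σ = N := by
      rw [← Real.rpow_add hNp]; simp
    have e4 : (N : ℝ) ^ (2 * (1 / 2 - σ)) * N = (N : ℝ) ^ (2 - 2 * σ) := by
      rw [← Real.rpow_add_one hNp.ne']; congr 1; ring
    calc _ ≤ 2 * cGa * T ^ (1 / 2 - σ) * ((2 / a * (N : ℝ) ^ (1 - σ) * (C₁ * (N : ℝ) ^ σ) +
            2 * (N : ℝ) ^ σ * (C₂ * (N : ℝ) ^ (1 - σ))) * (2 * (1 + Real.log N))) := by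
          refine mul_le_mul_of_nonneg_left (h6.trans ?_) (by positivity)
          gcongr
      _ = 2 * cGa * T ^ (1 / 2 - σ) * ((2 / a * C₁ + 2 * C₂) * ((N : ℝ) ^ (1 - σ) * (N : ℝ) ^ σ) *
            (2 * (1 + Real.log N))) := by ring
      _ ≤ 2 * cGa * (57 ^ (1 / 2 - σ) * (N : ℝ) ^ (2 * (1 / 2 - σ))) * ((2 / a * C₁ + 2 * C₂) * N *
            (2 * (1 + Real.log N))) := by
          rw [e3]; gcongr
      _ = 2 * cGa * 57 ^ (1 / 2 - σ) * ((2 / a * C₁ + 2 * C₂) * 2) *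
            ((N : ℝ) ^ (2 * (1 / 2 - σ)) * N * (1 + Real.log N)) := by ring
      _ = _ := by rw [e4]
  · simp only [dualSum, dirSum, hc, map_sum]
    rw [sum_mul_sum]
    rfl

/-- The integrand of `rMain`. -/
noncomputable def rI (a : ℝ) (K : ℕ) (s : ℂ) (u : ℝ) : ℂ :=
  wL (mpt a K) u ^ (-s) * phiK a K (wL (mpt a K) u) * (1 + I)

lemma rMain_eq_rI (a : ℝ) (s : ℂ) (K : ℕ) : rMain a s K = -∫ u in Set.Ioi (0 : ℝ), rI a K s u := rfl

section
variable {a σ : ℝ} {K : ℕ}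

lemma norm_wphi_le (ha : 0 < a) (ha1 : a ≤ 1) (hK : 1 ≤ K) (h0 : 0 < σ) (h1 : σ < 1) {t u : ℝ}
    (ht : t ∈ Set.Icc (tB K) (tB (K + 1))) (hu : 0 ≤ u) :
    ‖wL (mpt a K) u ^ (-(σ + t * I : ℂ))‖ * ‖phiK a K (wL (mpt a K) u)‖ ≤
      cPh * mpt a K ^ (-σ) * Real.exp (-|u - mpt a K / 2|) := by
  have h := norm_cpow_mul_phiK_le ha ha1 hK (s := σ + t * I) (by simp; linarith) (by simp; linarith)
    (by simpa [tB] using ht.1) (by simpa [tB_succ] using ht.2) hu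
  simpa using h

lemma norm_rI_le (ha : 0 < a) (ha1 : a ≤ 1) (hK : 1 ≤ K) (h0 : 0 < σ) (h1 : σ < 1) {t u : ℝ}
    (ht : t ∈ Set.Icc (tB K) (tB (K + 1))) (hu : 0 ≤ u) :
    ‖rI a K (σ + t * I) u‖ ≤ 2 * cPh * mpt a K ^ (-σ) * Real.exp (-|u - mpt a K / 2|) := by
  have h := norm_wphi_le ha ha1 hK h0 h1 ht hu
  rw [rI, norm_mul, norm_mul]
  have := norm_one_add_I_le
  calc _ ≤ (cPh * mpt a K ^ (-σ) * Real.exp (-|u - mpt a K / 2|)) * 2 :=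
        mul_le_mul h this (norm_nonneg _) (le_trans (by positivity) h)
    _ = _ := by ring

lemma continuousOn_rI (ha : 0 < a) (hK : 1 ≤ K) :
    ContinuousOn (fun p : ℝ × ℝ => rI a K (σ + p.1 * I) p.2) (Set.univ ×ˢ Set.Ici 0) := by
  have hX := mpt_pos ha hK
  unfold rI
  refine ((ContinuousOn.cpow (by fun_prop) (by fun_prop) fun p hp => ?_).mul
    ((continuous_phiK_wL a K).comp continuous_snd).continuousOn).mul continuousOn_const
  exact wL_mem_slitPlane hX hp.2

lemma bc_rMain (ha : 0 < a) (ha1 : a ≤ 1) (h0 : 0 < σ) (h1 : σ < 1) :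
    BC fun K t => rMain a (σ + t * I) K := fun K hK => by
  simp_rw [rMain_eq_rI]
  refine ContinuousOn.neg ?_
  refine continuousOn_of_dominated (bound := fun u =>
    2 * cPh * mpt a K ^ (-σ) * Real.exp (-|u - mpt a K / 2|)) (fun t _ => ?_) (fun t ht => ?_) ?_ ?_
  · refine ContinuousOn.aestronglyMeasurable ?_ measurableSet_Ioi
    exact (continuousOn_rI (σ := σ) ha hK).comp (f := fun u : ℝ => (t, u)) (by fun_prop)
      fun u hu => ⟨Set.mem_univ _, le_of_lt (Set.mem_Ioi.mp hu)⟩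
  · exact ae_restrict_of_forall_mem measurableSet_Ioi fun u hu =>
      norm_rI_le ha ha1 hK h0 h1 ht (le_of_lt hu)
  · exact ((integrable_exp_neg_abs _).const_mul _).integrableOn
  · exact ae_restrict_of_forall_mem measurableSet_Ioi fun u hu =>
      (continuousOn_rI (σ := σ) ha hK).comp (f := fun t : ℝ => (t, u)) (by fun_prop)
      fun t _ => ⟨Set.mem_univ _, le_of_lt (Set.mem_Ioi.mp hu)⟩

lemma integral_mul_conj_rMain (ha : 0 < a) (ha1 : a ≤ 1) (hK : 1 ≤ K) (h0 : 0 < σ) (h1 : σ < 1)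
    {τ : ℝ} (hτ : τ ∈ Set.Icc (tB K) (tB (K + 1))) {B : ℝ → ℂ}
    (hB : ContinuousOn B (Set.Icc (tB K) τ)) :
    ∫ t in tB K..τ, B t * starRingEnd ℂ (rMain a (σ + t * I) K) =
      -∫ u in Set.Ioi (0 : ℝ), ∫ t in tB K..τ, B t * starRingEnd ℂ (rI a K (σ + t * I) u) := by
  simp_rw [rMain_eq_rI, map_neg, ← integral_conj, mul_neg, intervalIntegral.integral_neg,
    ← integral_const_mul, intervalIntegral.integral_of_le hτ.1]
  congr 1
  refine integral_integral_swap ?_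
  have hc := cPh_pos
  obtain ⟨b, hb⟩ := isCompact_Icc.exists_bound_of_continuousOn hB
  have hint : Integrable (fun p : ℝ × ℝ => b * (2 * cPh * mpt a K ^ (-σ) *
      Real.exp (-|p.2 - mpt a K / 2|)))
      ((volume.restrict (Set.Ioc (tB K) τ)).prod (volume.restrict (Set.Ioi 0))) :=
    Integrable.mul_prod (f := fun _ : ℝ => b) (g := fun u => 2 * cPh * mpt a K ^ (-σ) *
      Real.exp (-|u - mpt a K / 2|)) (by simp)
      ((integrable_exp_neg_abs _).const_mul _).integrableOn
  refine hint.mono' ?_ ?_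
  · rw [Measure.prod_restrict]
    refine ContinuousOn.aestronglyMeasurable ?_ (measurableSet_Ioc.prod measurableSet_Ioi)
    refine ContinuousOn.mul (hB.comp continuousOn_fst fun p hp => Set.Ioc_subset_Icc_self hp.1) ?_
    exact continuous_conj.comp_continuousOn ((continuousOn_rI (σ := σ) ha hK).mono
      fun p hp => ⟨Set.mem_univ _, le_of_lt (Set.mem_Ioi.mp hp.2)⟩)
  · rw [Measure.prod_restrict]
    refine ae_restrict_of_forall_mem (measurableSet_Ioc.prod measurableSet_Ioi) fun p hp => ?_
    have hp1 : p.1 ∈ Set.Icc (tB K) τ := Set.Ioc_subset_Icc_self hp.1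
    simp only [Function.uncurry]
    rw [norm_mul, norm_conj]
    have h3 := hb _ hp1
    exact mul_le_mul h3 (norm_rI_le ha ha1 hK h0 h1 ⟨hp1.1, hp1.2.trans hτ.2⟩
      (le_of_lt (Set.mem_Ioi.mp hp.2))) (norm_nonneg _) ((norm_nonneg _).trans h3)

/-- The interaction of a function with `rMain` on a block is controlled by the interaction
with the pure powers. -/
lemma norm_integral_mul_conj_rMain_le (ha : 0 < a) (ha1 : a ≤ 1) (hK : 1 ≤ K) (h0 : 0 < σ)
    (h1 : σ < 1) {τ : ℝ} (hτ : τ ∈ Set.Icc (tB K) (tB (K + 1))) {B : ℝ → ℂ}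
    (hB : ContinuousOn B (Set.Icc (tB K) τ)) {M : ℝ}
    (hM : ∀ u, 0 ≤ u → ‖∫ t in tB K..τ, B t * starRingEnd ℂ (wL (mpt a K) u ^ (-(σ + t * I : ℂ)))‖ *
      ‖phiK a K (wL (mpt a K) u)‖ ≤ M * Real.exp (-(1 / 2 * |u - mpt a K / 2|))) :
    ‖∫ t in tB K..τ, B t * starRingEnd ℂ (rMain a (σ + t * I) K)‖ ≤ 8 * M := by
  rw [integral_mul_conj_rMain ha ha1 hK h0 h1 hτ hB, norm_neg]
  have hM0 : 0 ≤ M := by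
    have h := hM 0 le_rfl
    have h2 : 0 ≤ M * Real.exp (-(1 / 2 * |0 - mpt a K / 2|)) := le_trans (by positivity) h
    exact nonneg_of_mul_nonneg_left h2 (Real.exp_pos _)
  calc _ ≤ ∫ u in Set.Ioi (0 : ℝ), (2 * M) * Real.exp (-(1 / 2 * |u - mpt a K / 2|)) := by
        refine norm_integral_le_of_norm_le
          (((integrable_exp_neg_mul_abs (by norm_num) _).const_mul _).integrableOn)
          (ae_restrict_of_forall_mem measurableSet_Ioi fun u hu => ?_)
        have e : ∀ t : ℝ, B t * starRingEnd ℂ (rI a K (σ + t * I) u) =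
            (B t * starRingEnd ℂ (wL (mpt a K) u ^ (-(σ + t * I : ℂ)))) *
            starRingEnd ℂ (phiK a K (wL (mpt a K) u) * (1 + I)) := fun t => by
          rw [rI, mul_assoc, map_mul]; ring
        simp_rw [e]
        rw [intervalIntegral.integral_mul_const, norm_mul, norm_conj, norm_mul, ← mul_assoc]
        have h3 := hM u (le_of_lt hu)
        calc _ ≤ (M * Real.exp (-(1 / 2 * |u - mpt a K / 2|))) * 2 :=
              mul_le_mul h3 norm_one_add_I_le (norm_nonneg _) (by positivity)
          _ = _ := by ring
    _ ≤ ∫ u : ℝ, (2 * M) * Real.exp (-(1 / 2 * |u - mpt a K / 2|)) := by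
        refine setIntegral_le_integral ((integrable_exp_neg_mul_abs (by norm_num) _).const_mul _)
          (Eventually.of_forall fun u => by positivity)
    _ = _ := by rw [integral_const_mul, integral_exp_neg_mul_abs (by norm_num)]; ring

end

lemma norm_integral_cpow_mul_conj_cpow_le {x : ℝ} (hx : 0 < x) {w : ℂ} (hw : w ≠ 0)
    (hl : Complex.log w ≠ Real.log x) (σ τ₁ τ₂ : ℝ) :
    ‖∫ t in τ₁..τ₂, (x : ℂ) ^ (-(σ + t * I : ℂ)) * starRingEnd ℂ (w ^ (-(σ + t * I : ℂ)))‖ ≤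
      x ^ (-σ) * (‖w ^ (-(σ + τ₁ * I : ℂ))‖ + ‖w ^ (-(σ + τ₂ * I : ℂ))‖) *
        ‖Complex.log w - Real.log x‖⁻¹ := by
  have hx' : (x : ℂ) ≠ 0 := by exact_mod_cast hx.ne'
  set l : ℂ := starRingEnd ℂ (Complex.log w) - Real.log x with hldef
  have hln : ‖l‖ = ‖Complex.log w - Real.log x‖ := by
    rw [hldef, ← norm_conj, map_sub, conj_conj, conj_ofReal]
  have hl0 : l ≠ 0 := by
    rw [← norm_ne_zero_iff, hln, norm_ne_zero_iff]
    exact sub_ne_zero.mpr hl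
  set g : ℝ → ℂ := fun t =>
    (x : ℂ) ^ (-(σ + t * I : ℂ)) * starRingEnd ℂ (w ^ (-(σ + t * I : ℂ))) with hg
  have e : ∀ t, g t = cexp (-(2 * σ) * starRingEnd ℂ (Complex.log w) + σ * l) * cexp (I * l * t) := by
    intro t
    simp only [hg]
    rw [cpow_def_of_ne_zero hx', cpow_def_of_ne_zero hw, ← exp_conj, map_mul, map_neg, conj_line,
      ← exp_add, ← exp_add, ← ofReal_log hx.le, hldef]
    congr 1; ring
  have hgn : ∀ t, ‖g t‖ = x ^ (-σ) * ‖w ^ (-(σ + t * I : ℂ))‖ := fun t => by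
    simp only [hg]
    rw [norm_mul, norm_conj, norm_cpow_eq_rpow_re_of_pos hx]; simp
  have hIl : I * l ≠ 0 := mul_ne_zero I_ne_zero hl0
  have hi : ∫ t in τ₁..τ₂, g t = (g τ₂ - g τ₁) / (I * l) := by
    simp_rw [e]
    rw [intervalIntegral.integral_const_mul, integral_exp_mul_complex hIl]
    ring
  change ‖∫ t in τ₁..τ₂, g t‖ ≤ _
  rw [hi, norm_div, norm_mul, norm_I, one_mul, hln, div_eq_mul_inv]
  refine mul_le_mul_of_nonneg_right ((norm_sub_le _ _).trans ?_) (by positivity)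
  rw [hgn, hgn]; linarith

lemma le_norm_log_wL_sub {X x u : ℝ} (hx : 0 < x) (hxX : x ≤ X) (hu : 0 ≤ u) :
    (X - x) / (2 * X) ≤ ‖Complex.log (wL X u) - Real.log x‖ := by
  have hX : 0 < X := hx.trans_le hxX
  have hw0 : wL X u ≠ 0 := slitPlane_ne_zero (wL_mem_slitPlane hX hu)
  have hxX1 : x / X ≤ 1 := (div_le_one hX).mpr hxX
  have e0 : (X - x) / (2 * X) = (1 - x / X) / 2 := by field_simp
  have hn : ‖wL X u‖ ^ 2 = (u + X / 2) ^ 2 + (u - X / 2) ^ 2 := by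
    rw [← normSq_eq_norm_sq, normSq_apply, wL_re, wL_im]; ring
  rcases le_total (X / 2) u with h | h
  · have h1 : X ≤ ‖wL X u‖ := by
      refine le_trans ?_ (re_le_norm _)
      rw [wL_re]; linarith
    have h2 : 1 - x / X ≤ Real.log ‖wL X u‖ - Real.log x := by
      have h3 := Real.one_sub_inv_le_log_of_pos (x := X / x) (by positivity)
      rw [inv_div, Real.log_div hX.ne' hx.ne'] at h3
      have := Real.log_le_log hX h1
      linarith
    have h3 := re_le_norm (Complex.log (wL X u) - Real.log x)
    rw [sub_re, log_re, ofReal_re] at h3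
    rw [e0]; linarith
  · have h1 : ‖wL X u‖ ≤ X := by
      refine le_of_sq_le_sq ?_ hX.le
      rw [hn]; nlinarith
    have h2 : ‖wL X u - x‖ ≤ X * ‖Complex.log (wL X u) - Real.log x‖ := by
      have h3 := Convex.norm_image_sub_le_of_norm_deriv_le (𝕜 := ℂ) (f := cexp) (C := X)
        (s := {z | z.re ≤ Real.log X}) (x := (Real.log x : ℂ)) (y := Complex.log (wL X u))
        (fun z _ => differentiable_exp z) (fun z hz => by
          rw [Complex.deriv_exp, norm_exp]
          exact (Real.exp_le_exp.mpr hz).trans (Real.exp_log hX).le)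
        (convex_halfSpace_re_le _) (by
          show (Real.log x : ℂ).re ≤ _
          rw [ofReal_re]; exact Real.log_le_log hx hxX)
        (by
          show (Complex.log (wL X u)).re ≤ _
          rw [log_re]; exact Real.log_le_log (norm_pos_iff.mpr hw0) h1)
      rwa [exp_log hw0, ← ofReal_exp, Real.exp_log hx] at h3
    have h4 : (X - x) / 2 ≤ ‖wL X u - x‖ := by
      refine le_of_sq_le_sq ?_ (norm_nonneg _)
      rw [← normSq_eq_norm_sq, normSq_apply, sub_re, sub_im, ofReal_re, ofReal_im, wL_re, wL_im]
      nlinarith [sq_nonneg (2 * (u - X / 2) + (X - x)), sq_nonneg (X - x)]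
    rw [div_le_iff₀ (by positivity)]
    linarith

/-- The interaction of the first sum with the remainder. -/
lemma ngl_dir_rMain {a : ℝ} (ha : 0 < a) (ha1 : a ≤ 1) {σ : ℝ} (h0 : 0 < σ) (h1 : σ < 1) :
    Ngl σ fun K t => dirSum a (σ + t * I) K * starRingEnd ℂ (rMain a (σ + t * I) K) := by
  obtain ⟨C₂, hC₂, h₂⟩ := sum_xpt_le' ha ha1 h0 h1
  have hcp := cPh_pos
  set D : ℝ := 8 * (8 * cPh * 2 ^ |1 - σ|) with hD
  have hD0 : 0 ≤ D := by positivity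
  refine ngl_of_le h1.le (C := D * (C₂ * 4)) (by positivity) fun N T hN hT1 hT2 => ?_
  have hNp : (0 : ℝ) < N := by exact_mod_cast hN
  have hblock : ∀ K, 1 ≤ K → ∀ τ ∈ Set.Icc (tB K) (tB (K + 1)),
      ‖∫ t in tB K..τ, dirSum a (σ + t * I) K * starRingEnd ℂ (rMain a (σ + t * I) K)‖ ≤
      D * (K : ℝ) ^ (1 - σ) * ∑ m ∈ range K, xpt a m ^ (-σ) * ((K : ℝ) - m)⁻¹ := by
    intro K hK τ hτ
    have hX := mpt_pos ha hK
    have hX1 := mpt_ge ha K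
    have hcont : ∀ m, Continuous fun t : ℝ => (xpt a m : ℂ) ^ (-(σ + t * I : ℂ)) := fun m =>
      continuous_cpow_line (xpt_pos ha m) (by fun_prop)
    have hint : ∀ m ∈ range K, IntervalIntegrable (fun t : ℝ => (xpt a m : ℂ) ^ (-(σ + t * I : ℂ)) *
        starRingEnd ℂ (rMain a (σ + t * I) K)) volume (tB K) τ := fun m _ => by
      refine ContinuousOn.intervalIntegrable_of_Icc hτ.1 ((hcont m).continuousOn.mul ?_)
      exact continuous_conj.comp_continuousOn ((bc_rMain ha ha1 h0 h1 K hK).mono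
        (Set.Icc_subset_Icc_right hτ.2))
    simp only [dirSum, sum_mul]
    rw [intervalIntegral.integral_finsetSum hint, mul_sum]
    refine (norm_sum_le _ _).trans (sum_le_sum fun m hm => ?_)
    have hmK : (m : ℝ) + 1 ≤ K := by exact_mod_cast mem_range.mp hm
    have hxm := xpt_pos ha m
    have hKm : 0 < (K : ℝ) - m := by linarith
    have hXx : ((K : ℝ) - m) / 2 ≤ mpt a K - xpt a m := by unfold mpt xpt; linarith
    refine (norm_integral_mul_conj_rMain_le ha ha1 hK h0 h1 hτ (hcont m).continuousOn
      (M := 8 * cPh * xpt a m ^ (-σ) * mpt a K ^ (1 - σ) * ((K : ℝ) - m)⁻¹) fun u hu => ?_).trans ?_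
    · have hlow := le_norm_log_wL_sub (X := mpt a K) hxm (by linarith) hu
      have hlow2 : ((K : ℝ) - m) / (4 * mpt a K) ≤
          ‖Complex.log (wL (mpt a K) u) - Real.log (xpt a m)‖ := by
        refine le_trans ?_ hlow
        rw [div_le_div_iff₀ (by positivity) (by positivity)]
        nlinarith
      have hpos : 0 < ((K : ℝ) - m) / (4 * mpt a K) := by positivity
      have hne : Complex.log (wL (mpt a K) u) ≠ Real.log (xpt a m) := fun h => by
        rw [h, sub_self, norm_zero] at hlow2; linarith
      have hi := norm_integral_cpow_mul_conj_cpow_le hxm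
        (slitPlane_ne_zero (wL_mem_slitPlane hX hu)) hne σ (tB K) τ
      have hw1 := norm_wphi_le ha ha1 hK h0 h1 ⟨le_rfl, hτ.1.trans hτ.2⟩ hu
      have hw2 := norm_wphi_le ha ha1 hK h0 h1 hτ hu
      have hinv := inv_anti₀ hpos hlow2
      rw [inv_div] at hinv
      have hexp : Real.exp (-|u - mpt a K / 2|) ≤ Real.exp (-(1 / 2 * |u - mpt a K / 2|)) := by
        gcongr; linarith [abs_nonneg (u - mpt a K / 2)]
      calc _ ≤ xpt a m ^ (-σ) * (‖wL (mpt a K) u ^ (-(σ + tB K * I : ℂ))‖ +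
              ‖wL (mpt a K) u ^ (-(σ + τ * I : ℂ))‖) *
              ‖Complex.log (wL (mpt a K) u) - Real.log (xpt a m)‖⁻¹ *
              ‖phiK a K (wL (mpt a K) u)‖ := by gcongr
        _ = xpt a m ^ (-σ) * (‖wL (mpt a K) u ^ (-(σ + tB K * I : ℂ))‖ *
              ‖phiK a K (wL (mpt a K) u)‖ + ‖wL (mpt a K) u ^ (-(σ + τ * I : ℂ))‖ *
              ‖phiK a K (wL (mpt a K) u)‖) *
              ‖Complex.log (wL (mpt a K) u) - Real.log (xpt a m)‖⁻¹ := by ring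
        _ ≤ xpt a m ^ (-σ) * (cPh * mpt a K ^ (-σ) * Real.exp (-|u - mpt a K / 2|) +
              cPh * mpt a K ^ (-σ) * Real.exp (-|u - mpt a K / 2|)) *
              (4 * mpt a K / ((K : ℝ) - m)) := by gcongr
        _ = 8 * cPh * xpt a m ^ (-σ) * (mpt a K ^ (-σ) * mpt a K) * ((K : ℝ) - m)⁻¹ *
              Real.exp (-|u - mpt a K / 2|) := by field_simp; ring
        _ = 8 * cPh * xpt a m ^ (-σ) * mpt a K ^ (1 - σ) * ((K : ℝ) - m)⁻¹ *
              Real.exp (-|u - mpt a K / 2|) := by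
            rw [← Real.rpow_add_one hX.ne', show -σ + 1 = 1 - σ by ring]
        _ ≤ _ := by gcongr
    · have := mpt_rpow_le ha ha1 hK (1 - σ)
      calc _ ≤ 8 * (8 * cPh * xpt a m ^ (-σ) * (2 ^ |1 - σ| * (K : ℝ) ^ (1 - σ)) *
              ((K : ℝ) - m)⁻¹) := by gcongr
        _ = _ := by rw [hD]; ring
  refine (norm_bInt_le_sum hblock hN hT1 hT2).trans ?_
  have hL : 0 ≤ 1 + Real.log N := by have := Real.log_natCast_nonneg N; linarith
  have htri := sum_triangle_le hN (f := fun m => xpt a m ^ (-σ))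
    (fun m => Real.rpow_nonneg (xpt_pos ha m).le _)
  calc _ ≤ ∑ K ∈ Ico 1 (N + 1), D * (N : ℝ) ^ (1 - σ) *
          ∑ m ∈ range K, xpt a m ^ (-σ) * ((K : ℝ) - m)⁻¹ := by
        refine sum_le_sum fun K hK => ?_
        have hKN : (K : ℝ) ≤ N := by exact_mod_cast Nat.lt_succ_iff.mp (mem_Ico.mp hK).2
        refine mul_le_mul_of_nonneg_right ?_ (sum_nonneg fun m hm => ?_)
        · exact mul_le_mul_of_nonneg_left
            (Real.rpow_le_rpow (by positivity) hKN (by linarith)) hD0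
        · have hmK : (m : ℝ) + 1 ≤ K := by exact_mod_cast mem_range.mp hm
          have hKm : 0 < (K : ℝ) - m := by linarith
          have := xpt_pos ha m
          positivity
    _ ≤ D * (N : ℝ) ^ (1 - σ) * (C₂ * (N : ℝ) ^ (1 - σ) * (4 * (1 + Real.log N))) := by
        rw [← mul_sum]
        refine mul_le_mul_of_nonneg_left (htri.trans ?_) (by positivity)
        exact mul_le_mul_of_nonneg_right (h₂ N hN) (by positivity)
    _ = D * (C₂ * 4) * (((N : ℝ) ^ (1 - σ) * (N : ℝ) ^ (1 - σ)) * (1 + Real.log N)) := by ring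
    _ = _ := by rw [← Real.rpow_add hNp, show 1 - σ + (1 - σ) = 2 - 2 * σ by ring]

lemma conj_cpow_neg_line {w : ℂ} (hw : w ∈ slitPlane) (σ t : ℝ) :
    starRingEnd ℂ (w ^ (-(σ + t * I : ℂ))) =
      starRingEnd ℂ w ^ (-(2 * σ) : ℂ) * starRingEnd ℂ w ^ (σ + t * I : ℂ) := by
  have hv : starRingEnd ℂ w ≠ 0 := (map_ne_zero _).mpr (slitPlane_ne_zero hw)
  rw [← cpow_add _ _ hv, show (-(2 * σ) + (σ + t * I) : ℂ) = starRingEnd ℂ (-(σ + t * I : ℂ)) by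
    rw [map_neg, conj_line]; ring, conj_cpow _ _ (slitPlane_arg_ne_pi hw), conj_conj]

lemma norm_integral_gam_mul_conj_cpow_le {y : ℝ} (hy : 0 < y) {w : ℂ} (hw : w ∈ slitPlane) {σ : ℝ}
    (h0 : 0 ≤ σ) (h1 : σ ≤ 1 / 2) {τ₁ τ₂ q : ℝ} (ht1 : 1 ≤ τ₁) (ht12 : τ₁ ≤ τ₂) (hq1 : q < 1)
    (hq : 2 * Real.pi * (y * ‖w‖) ≤ q * τ₁) :
    ‖∫ t in τ₁..τ₂, gam (σ + t * I) * (y : ℂ) ^ (σ + t * I - 1 : ℂ) *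
      starRingEnd ℂ (w ^ (-(σ + t * I : ℂ)))‖ ≤
      cGa * y ^ (-(1 - σ)) * (‖w ^ (-(σ + τ₁ * I : ℂ))‖ * τ₁ ^ (1 / 2 - σ) +
        ‖w ^ (-(σ + τ₂ * I : ℂ))‖ * τ₂ ^ (1 / 2 - σ)) / (1 - q) := by
  have hw0 := slitPlane_ne_zero hw
  have hwp : 0 < ‖w‖ := norm_pos_iff.mpr hw0
  have hv : starRingEnd ℂ w ≠ 0 := (map_ne_zero _).mpr hw0
  have hy' : (y : ℂ) ≠ 0 := by exact_mod_cast hy.ne'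
  have hz : (y : ℂ) * starRingEnd ℂ w ≠ 0 := mul_ne_zero hy' hv
  have e : ∀ t : ℝ, gam (σ + t * I) * (y : ℂ) ^ (σ + t * I - 1 : ℂ) *
      starRingEnd ℂ (w ^ (-(σ + t * I : ℂ))) =
      ((y : ℂ)⁻¹ * starRingEnd ℂ w ^ (((-(2 * σ) : ℝ)) : ℂ)) *
        gz ((y : ℂ) * starRingEnd ℂ w) (σ + t * I) := fun t => by
    rw [conj_cpow_neg_line hw, gz, ofReal_mul_cpow hy hv, cpow_sub _ _ hy', cpow_one]
    push_cast
    field_simp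
  have hnz : ‖(y : ℂ) * starRingEnd ℂ w‖ = y * ‖w‖ := by
    rw [norm_mul, norm_conj, norm_real, Real.norm_of_nonneg hy.le]
  have harg : arg ((y : ℂ) * starRingEnd ℂ w) = -arg w := by
    rw [arg_real_mul _ hy, arg_conj, if_neg (slitPlane_arg_ne_pi hw)]
  have h := norm_integral_gz_le hz h0 h1 ht1 ht12 hq1 (by rwa [hnz])
  rw [hnz, harg] at h
  simp_rw [e]
  have hpre : ‖(y : ℂ)⁻¹ * starRingEnd ℂ w ^ (((-(2 * σ) : ℝ)) : ℂ)‖ = y⁻¹ * ‖w‖ ^ (-(2 * σ)) := by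
    rw [norm_mul, norm_inv, norm_real, Real.norm_of_nonneg hy.le, norm_cpow_real, norm_conj]
  have hterm : ∀ τ : ℝ, y⁻¹ * ‖w‖ ^ (-(2 * σ)) * ((y * ‖w‖) ^ σ * Real.exp (-(τ * -arg w))) =
      y ^ (-(1 - σ)) * ‖w ^ (-(σ + τ * I : ℂ))‖ := fun τ => by
    rw [norm_cpow_neg hw0, Real.mul_rpow hy.le hwp.le, ← Real.rpow_neg_one y]
    calc _ = (y ^ (-1 : ℝ) * y ^ σ) * (‖w‖ ^ (-(2 * σ)) * ‖w‖ ^ σ) * Real.exp (τ * arg w) := by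
          rw [mul_neg, neg_neg]; ring
      _ = _ := by
          have e1 : (σ + τ * I : ℂ).re = σ := by simp
          have e2 : (σ + τ * I : ℂ).im = τ := by simp
          rw [← Real.rpow_add hy, ← Real.rpow_add hwp, mul_assoc, e1, e2]
          congr 2
          · ring
          · congr 1; ring
  rw [intervalIntegral.integral_const_mul, norm_mul, hpre]
  calc _ ≤ y⁻¹ * ‖w‖ ^ (-(2 * σ)) * _ := mul_le_mul_of_nonneg_left h (by positivity)
    _ = cGa * ((y⁻¹ * ‖w‖ ^ (-(2 * σ)) * ((y * ‖w‖) ^ σ * Real.exp (-(τ₁ * -arg w)))) *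
          τ₁ ^ (1 / 2 - σ) + (y⁻¹ * ‖w‖ ^ (-(2 * σ)) * ((y * ‖w‖) ^ σ * Real.exp (-(τ₂ * -arg w)))) *
          τ₂ ^ (1 / 2 - σ)) / (1 - q) := by ring
    _ = _ := by rw [hterm, hterm]; ring

lemma norm_wL_le {X u : ℝ} (hX : 0 ≤ X) : ‖wL X u‖ ≤ X + 2 * |u - X / 2| := by
  refine (norm_le_abs_re_add_abs_im _).trans ?_
  rw [wL_re, wL_im, show u + X / 2 = X + (u - X / 2) by ring]
  have := abs_add_le X (u - X / 2)
  rw [abs_of_nonneg hX] at this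
  linarith

/-- The interaction of the second sum with the remainder. -/
lemma ngl_dual_rMain {a : ℝ} (ha : 0 < a) (ha1 : a ≤ 1) {σ : ℝ} (h0 : 0 < σ) (h1 : σ < 1 / 2) :
    Ngl σ fun K t => dualSum a (σ + t * I) K * starRingEnd ℂ (rMain a (σ + t * I) K) := by
  obtain ⟨C₁, hC₁, h₁⟩ := sum_xpt_le' one_pos le_rfl (β := 1 - σ) (by linarith) (by linarith)
  have hcp := cPh_pos
  have hca := cGa_pos
  have hpi := Real.pi_pos
  set E : ℝ := 8 * (160 * (cGa * cPh)) * (2 ^ |-σ| * 57 ^ (1 / 2 - σ) * 2) with hE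
  have hE0 : 0 ≤ E := by positivity
  refine ngl_of_le (by linarith) (C := E * (C₁ * 4)) (by positivity) fun N T hN hT1 hT2 => ?_
  have hNp : (0 : ℝ) < N := by exact_mod_cast hN
  have hblock : ∀ K, 1 ≤ K → ∀ τ ∈ Set.Icc (tB K) (tB (K + 1)),
      ‖∫ t in tB K..τ, dualSum a (σ + t * I) K * starRingEnd ℂ (rMain a (σ + t * I) K)‖ ≤
      E * (K : ℝ) ^ (2 - 3 * σ) * ∑ n ∈ range K, xpt 1 n ^ (-(1 - σ)) * ((K : ℝ) - n)⁻¹ := by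
    intro K hK τ hτ
    have hKp : (0 : ℝ) < K := by exact_mod_cast hK
    have hK1 : (1 : ℝ) ≤ K := by exact_mod_cast hK
    have hX := mpt_pos ha hK
    have hXK := mpt_le ha1 K
    have hB0 := one_le_tB K
    have hBB : tB K ≤ tB (K + 1) := hτ.1.trans hτ.2
    have hB1 : 0 < tB (K + 1) := by linarith
    have hsub : Set.Icc (tB K) τ ⊆ Set.Ioi 0 := fun t ht => by
      have : tB K ≤ t := ht.1
      show 0 < t
      linarith
    set c : ℕ → ℝ → ℂ := fun n t => gam (σ + t * I) * (xpt 1 n : ℂ) ^ (σ + t * I - 1 : ℂ) with hc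
    have hcont : ∀ n, ContinuousOn (c n) (Set.Icc (tB K) τ) := fun n =>
      ((continuousOn_gam σ).mono hsub).mul
        (continuous_cpow_line (xpt_pos one_pos n) (by fun_prop)).continuousOn
    have hrc : ContinuousOn (fun t : ℝ => starRingEnd ℂ (rMain a (σ + t * I) K))
        (Set.Icc (tB K) τ) :=
      continuous_conj.comp_continuousOn ((bc_rMain ha ha1 h0 (by linarith) K hK).mono
        (Set.Icc_subset_Icc_right hτ.2))
    have e : ∀ t : ℝ, dualSum a (σ + t * I) K * starRingEnd ℂ (rMain a (σ + t * I) K) =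
        ∑ n ∈ range K, ex (-(((n : ℂ) + 1) * a)) *
          (c n t * starRingEnd ℂ (rMain a (σ + t * I) K)) := fun t => by
      rw [dualSum, sum_mul]
      refine sum_congr rfl fun n _ => ?_
      simp only [hc, xpt]
      ring
    simp_rw [e]
    have hint : ∀ n ∈ range K, IntervalIntegrable (fun t => ex (-(((n : ℂ) + 1) * a)) *
        (c n t * starRingEnd ℂ (rMain a (σ + t * I) K))) volume (tB K) τ := fun n _ =>
      (continuousOn_const.mul ((hcont n).mul hrc)).intervalIntegrable_of_Icc hτ.1
    rw [intervalIntegral.integral_finsetSum hint, mul_sum]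
    refine (norm_sum_le _ _).trans (sum_le_sum fun n hn => ?_)
    rw [intervalIntegral.integral_const_mul, norm_mul, norm_ex_neg_natCast_mul, one_mul]
    have hnK : (n : ℝ) + 1 ≤ K := by exact_mod_cast mem_range.mp hn
    have hn0 : (0 : ℝ) ≤ n := n.cast_nonneg
    have hy := xpt_pos one_pos n
    have hKn : 0 < (K : ℝ) - n := by linarith
    set W : ℝ := cGa * cPh * xpt 1 n ^ (-(1 - σ)) *
      (mpt a K ^ (-σ) * tB (K + 1) ^ (1 / 2 - σ) * (K + 1)) * ((K : ℝ) - n)⁻¹ with hW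
    have hW0 : 0 ≤ W := by positivity
    refine (norm_integral_mul_conj_rMain_le ha ha1 hK h0 (by linarith) hτ (hcont n)
      (M := 160 * W) fun u hu => ?_).trans ?_
    · set d : ℝ := |u - mpt a K / 2| with hd
      have hd0 : 0 ≤ d := abs_nonneg _
      have hwS := wL_mem_slitPlane hX hu
      have hexp2 : Real.exp (-d) * Real.exp (1 / 2 * d) = Real.exp (-(1 / 2 * d)) := by
        rw [← Real.exp_add]; congr 1; ring
      have hexp1 : 1 / 2 * d + 1 ≤ Real.exp (1 / 2 * d) := Real.add_one_le_exp _
      have hpow : ∀ t ∈ Set.Icc (tB K) (tB (K + 1)), t ^ (1 / 2 - σ) ≤ tB (K + 1) ^ (1 / 2 - σ) :=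
        fun t ht => Real.rpow_le_rpow (by have := ht.1; linarith) ht.2 (by linarith)
      have hterm : ∀ t ∈ Set.Icc (tB K) (tB (K + 1)),
          ‖wL (mpt a K) u ^ (-(σ + t * I : ℂ))‖ * ‖phiK a K (wL (mpt a K) u)‖ * t ^ (1 / 2 - σ) ≤
          cPh * mpt a K ^ (-σ) * Real.exp (-d) * tB (K + 1) ^ (1 / 2 - σ) := fun t ht =>
        mul_le_mul (norm_wphi_le ha ha1 hK h0 (by linarith) ht hu) (hpow t ht)
          (Real.rpow_nonneg (by have := ht.1; linarith) _) (by positivity)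
      rcases le_total d (((K : ℝ) - n) / 4) with hcase | hcase
      · set q : ℝ := (n + 1) * (K + 1 / 2 + (K - n) / 2) / ((K : ℝ) + 1) ^ 2 with hq
        have hq2 : ((K : ℝ) - n) / (K + 1) / 2 ≤ 1 - q := by
          rw [hq, le_sub_iff_add_le, div_div, div_add_div _ _ (by positivity) (by positivity),
            div_le_one (by positivity)]
          nlinarith [mul_nonneg (mul_nonneg hKp.le hKp.le) hn0, mul_nonneg hKn.le hn0,
            mul_nonneg hKp.le hKn.le, mul_nonneg (mul_nonneg hKp.le hKn.le) hn0]
        have hq3 : 0 < ((K : ℝ) - n) / (K + 1) / 2 := by positivity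
        have hi := norm_integral_gam_mul_conj_cpow_le hy hwS h0.le h1.le hB0 hτ.1 (q := q)
          (by linarith) (by
            have hn1 : ‖wL (mpt a K) u‖ ≤ K + 1 / 2 + (K - n) / 2 := by
              have := norm_wL_le (u := u) hX.le
              rw [← hd] at this
              linarith
            have e1 : q * tB K = 2 * Real.pi * ((n + 1) * (K + 1 / 2 + (K - n) / 2)) := by
              rw [hq, tB]; field_simp
            rw [e1, xpt]
            gcongr)
        have t1 := hterm _ ⟨le_rfl, hBB⟩
        have t2 := hterm _ hτ
        have hA : 0 ≤ ‖wL (mpt a K) u ^ (-(σ + tB K * I : ℂ))‖ * tB K ^ (1 / 2 - σ) +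
            ‖wL (mpt a K) u ^ (-(σ + τ * I : ℂ))‖ * τ ^ (1 / 2 - σ) := by
          have : 0 ≤ τ := by linarith [hτ.1]
          have : 0 ≤ tB K := by linarith
          positivity
        have hA2 : 0 ≤ ‖wL (mpt a K) u ^ (-(σ + tB K * I : ℂ))‖ * ‖phiK a K (wL (mpt a K) u)‖ *
              tB K ^ (1 / 2 - σ) + ‖wL (mpt a K) u ^ (-(σ + τ * I : ℂ))‖ *
              ‖phiK a K (wL (mpt a K) u)‖ * τ ^ (1 / 2 - σ) := by
          have : 0 ≤ τ := by linarith [hτ.1]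
          have : 0 ≤ tB K := by linarith
          positivity
        calc _ ≤ cGa * xpt 1 n ^ (-(1 - σ)) * (‖wL (mpt a K) u ^ (-(σ + tB K * I : ℂ))‖ *
                tB K ^ (1 / 2 - σ) + ‖wL (mpt a K) u ^ (-(σ + τ * I : ℂ))‖ * τ ^ (1 / 2 - σ)) /
                (1 - q) * ‖phiK a K (wL (mpt a K) u)‖ :=
              mul_le_mul_of_nonneg_right hi (norm_nonneg _)
          _ = cGa * xpt 1 n ^ (-(1 - σ)) * (‖wL (mpt a K) u ^ (-(σ + tB K * I : ℂ))‖ *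
                ‖phiK a K (wL (mpt a K) u)‖ * tB K ^ (1 / 2 - σ) +
                ‖wL (mpt a K) u ^ (-(σ + τ * I : ℂ))‖ *
                ‖phiK a K (wL (mpt a K) u)‖ * τ ^ (1 / 2 - σ)) / (1 - q) := by ring
          _ ≤ cGa * xpt 1 n ^ (-(1 - σ)) *
                (cPh * mpt a K ^ (-σ) * Real.exp (-d) * tB (K + 1) ^ (1 / 2 - σ) +
                cPh * mpt a K ^ (-σ) * Real.exp (-d) * tB (K + 1) ^ (1 / 2 - σ)) /
                (((K : ℝ) - n) / (K + 1) / 2) := by gcongr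
          _ = 4 * W * Real.exp (-d) := by rw [hW]; field_simp; ring
          _ ≤ 4 * W * Real.exp (-(1 / 2 * d)) := by gcongr; linarith
          _ ≤ 160 * W * Real.exp (-(1 / 2 * d)) := by gcongr; norm_num
      · have hlen : |τ - tB K| ≤ 20 * ((K : ℝ) + 1) := by
          rw [abs_of_nonneg (by linarith [hτ.1])]
          have := tB_succ_sub K
          linarith [hτ.2]
        have hb := intervalIntegral.norm_integral_le_of_norm_le_const (a := tB K) (b := τ)
          (C := cGa * xpt 1 n ^ (-(1 - σ)) *
            (cPh * mpt a K ^ (-σ) * Real.exp (-d) * tB (K + 1) ^ (1 / 2 - σ)))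
          (f := fun t : ℝ => c n t * starRingEnd ℂ (wL (mpt a K) u ^ (-(σ + t * I : ℂ))) *
            (‖phiK a K (wL (mpt a K) u)‖ : ℂ)) (fun t ht => by
              rw [Set.uIoc_of_le hτ.1] at ht
              have ht' : t ∈ Set.Icc (tB K) (tB (K + 1)) := ⟨ht.1.le, ht.2.trans hτ.2⟩
              have htp : 1 ≤ t := hB0.trans ht'.1
              have hg := norm_gam_le (s := σ + t * I) (by simp; linarith) (by simp; linarith)
                (by simpa using htp)
              simp only [add_re, ofReal_re, mul_re, I_re, mul_zero, ofReal_im, I_im, mul_one,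
                sub_self, add_zero, add_im, mul_im, zero_add] at hg
              have hyn : ‖(xpt 1 n : ℂ) ^ (σ + t * I - 1 : ℂ)‖ = xpt 1 n ^ (-(1 - σ)) := by
                rw [norm_cpow_eq_rpow_re_of_pos hy]; simp
              simp only [hc]
              rw [norm_mul, norm_mul, norm_mul, norm_conj, hyn, norm_real, norm_norm]
              calc _ ≤ cGa * t ^ (1 / 2 - σ) * xpt 1 n ^ (-(1 - σ)) *
                    ‖wL (mpt a K) u ^ (-(σ + t * I : ℂ))‖ * ‖phiK a K (wL (mpt a K) u)‖ := by gcongr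
                _ = cGa * xpt 1 n ^ (-(1 - σ)) * (‖wL (mpt a K) u ^ (-(σ + t * I : ℂ))‖ *
                    ‖phiK a K (wL (mpt a K) u)‖ * t ^ (1 / 2 - σ)) := by ring
                _ ≤ _ := mul_le_mul_of_nonneg_left (hterm t ht') (by positivity))
        rw [intervalIntegral.integral_mul_const, norm_mul, norm_real, norm_norm] at hb
        refine hb.trans ?_
        calc _ ≤ cGa * xpt 1 n ^ (-(1 - σ)) *
                (cPh * mpt a K ^ (-σ) * Real.exp (-d) * tB (K + 1) ^ (1 / 2 - σ)) *
                (20 * ((K : ℝ) + 1)) := mul_le_mul_of_nonneg_left hlen (by positivity)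
          _ = 20 * W * ((K - n) * Real.exp (-d)) := by rw [hW]; field_simp
          _ ≤ 20 * W * (8 * Real.exp (1 / 2 * d) * Real.exp (-d)) := by gcongr; linarith
          _ = 160 * W * (Real.exp (-d) * Real.exp (1 / 2 * d)) := by ring
          _ = _ := by rw [hexp2]
    · have h3 := mpt_rpow_le ha ha1 hK (-σ)
      have h4 := rpow_le_natCast (N := K) hK (T := tB (K + 1)) hB1.le le_rfl (p := 1 / 2 - σ)
        (by linarith)
      have h5 : (K : ℝ) + 1 ≤ 2 * K := by linarith
      have e3 : (K : ℝ) ^ (-σ) * (K : ℝ) ^ (2 * (1 / 2 - σ)) * K = (K : ℝ) ^ (2 - 3 * σ) := by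
        rw [← Real.rpow_add hKp, ← Real.rpow_add_one hKp.ne']; congr 1; ring
      have h6 : mpt a K ^ (-σ) * tB (K + 1) ^ (1 / 2 - σ) * (K + 1) ≤
          2 ^ |-σ| * 57 ^ (1 / 2 - σ) * 2 * (K : ℝ) ^ (2 - 3 * σ) := by
        calc _ ≤ (2 ^ |-σ| * (K : ℝ) ^ (-σ)) * (57 ^ (1 / 2 - σ) * (K : ℝ) ^ (2 * (1 / 2 - σ))) *
              (2 * K) := by gcongr
          _ = 2 ^ |-σ| * 57 ^ (1 / 2 - σ) * 2 *
              ((K : ℝ) ^ (-σ) * (K : ℝ) ^ (2 * (1 / 2 - σ)) * K) := by ring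
          _ = _ := by rw [e3]
      calc _ ≤ 8 * (160 * (cGa * cPh * xpt 1 n ^ (-(1 - σ)) *
            (2 ^ |-σ| * 57 ^ (1 / 2 - σ) * 2 * (K : ℝ) ^ (2 - 3 * σ)) * ((K : ℝ) - n)⁻¹)) := by
            rw [hW]; gcongr
        _ = _ := by rw [hE]; ring
  refine (norm_bInt_le_sum hblock hN hT1 hT2).trans ?_
  have hL : 0 ≤ 1 + Real.log N := by have := Real.log_natCast_nonneg N; linarith
  have htri := sum_triangle_le hN (f := fun m => xpt 1 m ^ (-(1 - σ)))
    (fun m => Real.rpow_nonneg (xpt_pos one_pos m).le _)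
  have h7 := h₁ N hN
  rw [sub_sub_cancel] at h7
  calc _ ≤ ∑ K ∈ Ico 1 (N + 1), E * (N : ℝ) ^ (2 - 3 * σ) *
          ∑ m ∈ range K, xpt 1 m ^ (-(1 - σ)) * ((K : ℝ) - m)⁻¹ := by
        refine sum_le_sum fun K hK => ?_
        have hKN : (K : ℝ) ≤ N := by exact_mod_cast Nat.lt_succ_iff.mp (mem_Ico.mp hK).2
        refine mul_le_mul_of_nonneg_right ?_ (sum_nonneg fun m hm => ?_)
        · exact mul_le_mul_of_nonneg_left
            (Real.rpow_le_rpow (by positivity) hKN (by linarith)) hE0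
        · have hmK : (m : ℝ) + 1 ≤ K := by exact_mod_cast mem_range.mp hm
          have hKm : 0 < (K : ℝ) - m := by linarith
          have := xpt_pos one_pos m
          positivity
    _ ≤ E * (N : ℝ) ^ (2 - 3 * σ) * (C₁ * (N : ℝ) ^ σ * (4 * (1 + Real.log N))) := by
        rw [← mul_sum]
        refine mul_le_mul_of_nonneg_left (htri.trans ?_) (by positivity)
        exact mul_le_mul_of_nonneg_right h7 (by positivity)
    _ = E * (C₁ * 4) * (((N : ℝ) ^ (2 - 3 * σ) * (N : ℝ) ^ σ) * (1 + Real.log N)) := by ring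
    _ = _ := by rw [← Real.rpow_add hNp, show 2 - 3 * σ + σ = 2 - 2 * σ by ring]

/-- The error in `afe`. -/
noncomputable def afeErr (a : ℝ) (s : ℂ) (K : ℕ) : ℂ :=
  hzeta a s - dirSum a s K - dualSum a s K - rMain a s K

lemma natCast_le_of_tB_le {K : ℕ} {t : ℝ} (hK : 1 ≤ K) (h : tB K ≤ t) : (K : ℝ) ≤ t := by
  have := sq_le_of_tB_le h
  have : (1 : ℝ) ≤ K := by exact_mod_cast hK
  nlinarith

lemma mpt_rpow_neg_le {a : ℝ} (ha : 0 < a) (ha1 : a ≤ 1) {K : ℕ} (hK : 1 ≤ K) {t : ℝ}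
    (ht : t ∈ Set.Icc (tB K) (tB (K + 1))) {σ : ℝ} (h0 : 0 < σ) :
    mpt a K ^ (-(2 * σ)) ≤ 2 ^ |-(2 * σ)| * 57 ^ σ * t ^ (-σ) := by
  have hKp : (0 : ℝ) < K := by exact_mod_cast hK
  have htp : 0 < t := by have := one_le_tB K; linarith [ht.1]
  have h1 := mpt_rpow_le ha ha1 hK (-(2 * σ))
  have h2 := rpow_le_natCast hK htp.le ht.2 h0.le
  have h3 : (K : ℝ) ^ (-(2 * σ)) ≤ 57 ^ σ * t ^ (-σ) := by
    rw [Real.rpow_neg hKp.le, Real.rpow_neg htp.le, ← div_eq_mul_inv, inv_eq_one_div,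
      div_le_div_iff₀ (by positivity) (by positivity)]
    linarith
  calc _ ≤ 2 ^ |-(2 * σ)| * (K : ℝ) ^ (-(2 * σ)) := h1
    _ ≤ 2 ^ |-(2 * σ)| * (57 ^ σ * t ^ (-σ)) := by gcongr
    _ = _ := by ring

lemma pow_four_mul_exp_le {t : ℝ} (ht : 0 ≤ t) : t ^ 4 * Real.exp (-(t / 4)) ≤ 6144 := by
  have h := Real.pow_div_factorial_le_exp (x := t / 4) (by positivity) 4
  have e : ((Nat.factorial 4 : ℕ) : ℝ) = 24 := by norm_num [Nat.factorial]
  rw [e, div_le_iff₀ (by norm_num)] at h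
  rw [Real.exp_neg, ← div_eq_mul_inv, div_le_iff₀ (Real.exp_pos _)]
  linarith

lemma norm_dirSum_add_le {a : ℝ} (ha : 0 < a) (ha1 : a ≤ 1) {σ : ℝ} (h0 : 0 < σ) (h1 : σ < 1 / 2) :
    ∃ C, 0 ≤ C ∧ ∀ K, 1 ≤ K → ∀ t ∈ Set.Icc (tB K) (tB (K + 1)),
      ‖dirSum a (σ + t * I) K + dualSum a (σ + t * I) K + rMain a (σ + t * I) K‖ ≤ C * t ^ 2 := by
  obtain ⟨C₁, hC₁, hs₁⟩ := sum_xpt_le' ha ha1 h0 (by linarith)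
  obtain ⟨C₂, hC₂, hs₂⟩ := sum_xpt_le' one_pos le_rfl (β := 1 - σ) (by linarith) (by linarith)
  have hcp := cPh_pos
  have hca := cGa_pos
  refine ⟨C₁ + cGa * C₂ + 4 * cPh * (2 ^ |-σ|), by positivity, fun K hK t ht => ?_⟩
  have hK1 : (1 : ℝ) ≤ K := by exact_mod_cast hK
  have hKt := natCast_le_of_tB_le hK ht.1
  have ht1 : 1 ≤ t := hK1.trans hKt
  have htt : t ≤ t ^ 2 := by nlinarith
  have hKp : ∀ p : ℝ, p ≤ 1 → (K : ℝ) ^ p ≤ t := fun p hp =>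
    (Real.rpow_le_rpow_of_exponent_le hK1 hp).trans (by rwa [Real.rpow_one])
  have b1 : ‖dirSum a (σ + t * I) K‖ ≤ C₁ * t ^ 2 := by
    refine (norm_sum_le _ _).trans ?_
    simp_rw [norm_xpt_cpow ha]
    exact (hs₁ K hK).trans (mul_le_mul_of_nonneg_left ((hKp _ (by linarith)).trans htt) hC₁)
  have b2 : ‖dualSum a (σ + t * I) K‖ ≤ cGa * C₂ * t ^ 2 := by
    rw [dualSum_eq, norm_mul]
    have hg := norm_gam_le (s := σ + t * I) (by simp; linarith) (by simp; linarith) (by simpa using ht1)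
    have e1 : (σ + t * I : ℂ).re = σ := by simp
    have e2 : (σ + t * I : ℂ).im = t := by simp
    rw [e1, e2] at hg
    have ht2 : t ^ (1 / 2 - σ) ≤ t :=
      (Real.rpow_le_rpow_of_exponent_le ht1 (by linarith)).trans (Real.rpow_one t).le
    have hsum : ‖∑ n ∈ range K, dTerm a σ t n‖ ≤ C₂ * t := by
      refine (norm_sum_le _ _).trans ?_
      simp_rw [norm_dTerm]
      exact (hs₂ K hK).trans (mul_le_mul_of_nonneg_left (hKp _ (by linarith)) hC₂)
    calc _ ≤ (cGa * t) * (C₂ * t) := by gcongr; exact hg.trans (by gcongr)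
      _ = _ := by ring
  have b3 : ‖rMain a (σ + t * I) K‖ ≤ 4 * cPh * (2 ^ |-σ|) * t ^ 2 := by
    have h := norm_rMain_le ha ha1 hK (s := σ + t * I) (by simp; linarith) (by simp; linarith)
      (by simpa [tB] using ht.1) (by simpa [tB_succ] using ht.2)
    have e1 : (σ + t * I : ℂ).re = σ := by simp
    rw [e1] at h
    have h2 := mpt_rpow_le ha ha1 hK (-σ)
    have h3 : (K : ℝ) ^ (-σ) ≤ t ^ 2 := (hKp _ (by linarith)).trans htt
    calc _ ≤ 4 * cPh * (2 ^ |-σ| * t ^ 2) := h.trans (by gcongr; exact h2.trans (by gcongr))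
      _ = _ := by ring
  refine (norm_add₃_le).trans ?_
  linarith

/-- The contribution of the remainder terms other than the cross terms. -/
lemma norm_rem_le {a : ℝ} (ha : 0 < a) (ha1 : a ≤ 1) {σ : ℝ} (h0 : 0 < σ) (h1 : σ < 1 / 2) :
    ∃ C, 0 ≤ C ∧ ∀ K, 1 ≤ K → ∀ t ∈ Set.Icc (tB K) (tB (K + 1)), ∀ P R e : ℂ,
      P = dirSum a (σ + t * I) K + dualSum a (σ + t * I) K + rMain a (σ + t * I) K →
      R = rMain a (σ + t * I) K → e = afeErr a (σ + t * I) K →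
      ‖R * starRingEnd ℂ R + (P * starRingEnd ℂ e + e * starRingEnd ℂ P + e * starRingEnd ℂ e)‖ ≤
        C * t ^ (-σ) := by
  obtain ⟨C₁, hC₁, hP⟩ := norm_dirSum_add_le ha ha1 h0 h1
  have hcp := cPh_pos
  set D : ℝ := 11 / (1 - σ) with hD
  have hD0 : 0 ≤ D := by have : 0 < 1 - σ := by linarith
                         positivity
  refine ⟨(4 * cPh) ^ 2 * (2 ^ |-(2 * σ)| * 57 ^ σ) + (2 * (C₁ * D) + D * D) * 6144, by positivity,
    fun K hK t ht P R e hPe hRe hee => ?_⟩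
  have hX := mpt_pos ha hK
  have ht1 : 1 ≤ t := (one_le_tB K).trans ht.1
  have e1 : (σ + t * I : ℂ).re = σ := by simp
  have e2 : (σ + t * I : ℂ).im = t := by simp
  have hR : ‖R * starRingEnd ℂ R‖ ≤ (4 * cPh) ^ 2 * (2 ^ |-(2 * σ)| * 57 ^ σ) * t ^ (-σ) := by
    have h := norm_rMain_le ha ha1 hK (s := σ + t * I) (by simp; linarith) (by simp; linarith)
      (by simpa [tB] using ht.1) (by simpa [tB_succ] using ht.2)
    rw [e1, ← hRe] at h
    rw [norm_mul, norm_conj]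
    calc _ ≤ (4 * cPh * mpt a K ^ (-σ)) * (4 * cPh * mpt a K ^ (-σ)) := by gcongr
      _ = (4 * cPh) ^ 2 * (mpt a K ^ (-σ) * mpt a K ^ (-σ)) := by ring
      _ = (4 * cPh) ^ 2 * mpt a K ^ (-(2 * σ)) := by
          rw [← Real.rpow_add hX]; congr 2; ring
      _ ≤ (4 * cPh) ^ 2 * (2 ^ |-(2 * σ)| * 57 ^ σ * t ^ (-σ)) := by
          gcongr; exact mpt_rpow_neg_le ha ha1 hK ht h0
      _ = _ := by ring
  have hp := hP K hK t ht
  rw [← hPe] at hp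
  have he : ‖e‖ ≤ D * t * Real.exp (-(t / 4)) := by
    have h := afe ha ha1 (s := σ + t * I) (by simpa using h0) (by simp; linarith) hK
      (by simpa [tB] using ht.1)
    rw [e1, e2] at h
    rw [hee]; exact h
  have hexp1 : Real.exp (-(t / 4)) ≤ 1 := Real.exp_le_one_iff.mpr (by linarith)
  have hkey : t ^ 3 * Real.exp (-(t / 4)) ≤ 6144 * t ^ (-σ) := by
    have h3 := pow_four_mul_exp_le (t := t) (by linarith)
    have h4 : t ^ (-1 : ℝ) ≤ t ^ (-σ) := Real.rpow_le_rpow_of_exponent_le ht1 (by linarith)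
    rw [Real.rpow_neg_one] at h4
    have ht0 : 0 < t := by linarith
    calc _ = (t ^ 4 * Real.exp (-(t / 4))) * t⁻¹ := by field_simp
      _ ≤ 6144 * t ^ (-σ) := by gcongr
  have hPE : ‖P‖ * ‖e‖ ≤ C₁ * D * (t ^ 3 * Real.exp (-(t / 4))) := by
    calc _ ≤ C₁ * t ^ 2 * (D * t * Real.exp (-(t / 4))) := by gcongr
      _ = _ := by ring
  have hEE : ‖e‖ * ‖e‖ ≤ D * D * (t ^ 3 * Real.exp (-(t / 4))) := by
    calc _ ≤ (D * t * Real.exp (-(t / 4))) * (D * t * 1) := by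
          refine mul_le_mul he (he.trans (by gcongr)) (norm_nonneg _) (by positivity)
      _ = D * D * (t ^ 2 * Real.exp (-(t / 4))) := by ring
      _ ≤ _ := by gcongr; linarith
  have hrest : ‖P * starRingEnd ℂ e + e * starRingEnd ℂ P + e * starRingEnd ℂ e‖ ≤
      (2 * (C₁ * D) + D * D) * (6144 * t ^ (-σ)) := by
    refine norm_add₃_le.trans ?_
    simp only [norm_mul, norm_conj]
    calc _ ≤ (2 * (C₁ * D) + D * D) * (t ^ 3 * Real.exp (-(t / 4))) := by linarith
      _ ≤ _ := by gcongr
  refine (norm_add_le _ _).trans ?_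
  linarith

lemma hzeta_approx_of_one_le {a : ℝ} (ha : 0 < a) (ha1 : a ≤ 1) {β : ℝ} (hβ : 0 < β) (hβ1 : β ≠ 1) :
    ∃ C : ℝ, 0 ≤ C ∧ ∀ N : ℕ, 1 ≤ N → ‖hzeta a (β : ℂ) - ((∑ m ∈ range N, xpt a m ^ (-β) : ℝ) : ℂ) -
      ((mpt a N ^ (1 - β) / (β - 1) : ℝ) : ℂ)‖ ≤ C * mpt a N ^ (-β) := by
  obtain ⟨C, hC, h⟩ := hzeta_approx ha ha1 (s := (β : ℂ)) (by simpa using hβ) (by exact_mod_cast hβ1)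
  set f : ℕ → ℝ := fun N => ‖hzeta a (β : ℂ) - ((∑ m ∈ range N, xpt a m ^ (-β) : ℝ) : ℂ) -
      ((mpt a N ^ (1 - β) / (β - 1) : ℝ) : ℂ)‖ with hf
  have hX1 := mpt_pos ha le_rfl
  refine ⟨C + f 1 / mpt a 1 ^ (-β), by positivity, fun N hN => ?_⟩
  have hX := mpt_pos ha hN
  rcases hN.eq_or_lt with rfl | hN2
  · change f 1 ≤ _
    rw [add_mul, div_mul_cancel₀ _ (by positivity)]
    have : 0 ≤ C * mpt a 1 ^ (-β) := by positivity
    linarith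
  · have h2 := h N hN2
    rw [ofReal_re] at h2
    refine le_trans (le_of_eq_of_le ?_ h2) ?_
    · rw [ofReal_sum_xpt ha, ofReal_div, ofReal_cpow hX.le]
      push_cast; rfl
    · gcongr
      have : 0 ≤ f 1 / mpt a 1 ^ (-β) := by positivity
      linarith

/-- The diagonal terms, approximately independent of the block. -/
lemma norm_diag_sub_le {a : ℝ} (ha : 0 < a) (ha1 : a ≤ 1) {σ : ℝ} (h0 : 0 < σ) (h1 : σ < 1 / 2) :
    ∃ C, 0 ≤ C ∧ ∀ K, 1 ≤ K → ∀ t ∈ Set.Icc (tB K) (tB (K + 1)),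
      ‖((∑ m ∈ range K, xpt a m ^ (-(2 * σ)) : ℝ) : ℂ) +
        (((t / (2 * Real.pi)) ^ (1 - 2 * σ) * ∑ n ∈ range K, xpt 1 n ^ (-(2 - 2 * σ)) : ℝ) : ℂ) -
        (hzeta a ((2 * σ : ℝ) : ℂ) +
          (((t / (2 * Real.pi)) ^ (1 - 2 * σ) : ℝ) : ℂ) * hzeta 1 ((2 - 2 * σ : ℝ) : ℂ))‖ ≤
        C * t ^ (-σ) := by
  obtain ⟨C₁, hC₁, hA⟩ := hzeta_approx_of_one_le ha ha1 (β := 2 * σ) (by linarith) (by linarith)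
  obtain ⟨C₂, hC₂, hG⟩ := hzeta_approx_of_one_le one_pos le_rfl (β := 2 - 2 * σ) (by linarith)
    (by linarith)
  set p : ℝ := 1 - 2 * σ with hp
  have hp0 : 0 < p := by linarith
  have hp1 : p ≤ 1 := by linarith
  have hpi := Real.pi_pos
  set c : ℝ := 2 ^ |-(2 * σ)| * 57 ^ σ with hc
  have hc0 : 0 ≤ c := by positivity
  refine ⟨(C₁ + 16 ^ p * C₂ + 8 / p) * c, by positivity, fun K hK t ht => ?_⟩
  have hK1 : (1 : ℝ) ≤ K := by exact_mod_cast hK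
  have hX := mpt_pos ha hK
  have hY := mpt_pos one_pos hK
  have hXK := mpt_le ha1 K
  have hXK' := mpt_ge ha K
  set X := mpt a K with hXd
  set Y := mpt 1 K with hYd
  have hYK : Y = K + 1 / 2 := by rw [hYd, mpt]; ring
  set V : ℝ := t / (2 * Real.pi) / Y with hV
  have htV : t / (2 * Real.pi) = V * Y := by rw [hV]; field_simp
  have ht1 : ((K : ℝ) + 1) ^ 2 ≤ V * Y := by
    rw [← htV, le_div_iff₀ (by positivity)]
    have := ht.1; rw [tB] at this; linarith
  have ht2 : V * Y ≤ ((K : ℝ) + 2) ^ 2 := by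
    rw [← htV, div_le_iff₀ (by positivity)]
    have := ht.2; rw [tB_succ] at this; linarith
  have hVl : X ≤ V := by
    by_contra h
    push Not at h
    nlinarith
  have hVu : V - X ≤ 8 := by
    have : V ≤ K + 5 := by
      by_contra h
      push Not at h
      nlinarith
    linarith
  have hVY : V ≤ 16 * Y := by linarith
  have hV0 : 0 < V := hX.trans_le hVl
  have hpow : |X ^ p - V ^ p| ≤ 8 * X ^ (-(2 * σ)) := by
    have h3 := Real.rpow_le_rpow hX.le hVl hp0.le
    rw [abs_sub_comm, abs_of_nonneg (by linarith)]
    have h4 := rpow_one_add_le_one_add_mul_self (s := (V - X) / X) (p := p)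
      (by have : 0 ≤ (V - X) / X := div_nonneg (by linarith) hX.le
          linarith) hp0.le hp1
    have e1 : V = X * (1 + (V - X) / X) := by field_simp; ring
    have e2 : V ^ p = X ^ p * (1 + (V - X) / X) ^ p := by
      conv_lhs => rw [e1]
      rw [Real.mul_rpow hX.le]
      have : 0 ≤ (V - X) / X := div_nonneg (by linarith) hX.le
      linarith
    have e3 : X ^ (-(2 * σ)) * X = X ^ p := by
      rw [← Real.rpow_add_one hX.ne']; congr 1; rw [hp]; ring
    calc V ^ p - X ^ p ≤ X ^ p * (1 + p * ((V - X) / X)) - X ^ p := by rw [e2]; gcongr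
      _ = X ^ p * p * ((V - X) / X) := by ring
      _ = p * (V - X) * X ^ (-(2 * σ)) := by rw [← e3]; field_simp
      _ ≤ 8 * X ^ (-(2 * σ)) := by
          gcongr
          nlinarith
  have hYp : Y ^ (1 - (2 - 2 * σ)) = Y ^ (-p) := by congr 1; rw [hp]; ring
  have e0 : (V * Y) ^ p * Y ^ (-p) = V ^ p := by
    rw [Real.mul_rpow hV0.le hY.le, mul_assoc, ← Real.rpow_add hY]; simp
  have hA' := hA K hK
  have hG' := hG K hK
  rw [← hXd] at hA'
  rw [← hYd, hYp] at hG'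
  rw [htV]
  set Sa : ℝ := ∑ m ∈ range K, xpt a m ^ (-(2 * σ)) with hSa
  set Sg : ℝ := ∑ n ∈ range K, xpt 1 n ^ (-(2 - 2 * σ)) with hSg
  set H := hzeta a ((2 * σ : ℝ) : ℂ) with hH
  set Z := hzeta 1 ((2 - 2 * σ : ℝ) : ℂ) with hZ
  have hdec : (Sa : ℂ) + (((V * Y) ^ p * Sg : ℝ) : ℂ) - (H + (((V * Y) ^ p : ℝ) : ℂ) * Z) =
      -(H - Sa - ((X ^ p / (2 * σ - 1) : ℝ) : ℂ)) -
      (((V * Y) ^ p : ℝ) : ℂ) * (Z - Sg - ((Y ^ (-p) / (2 - 2 * σ - 1) : ℝ) : ℂ)) +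
      (((X ^ p - V ^ p) / p : ℝ) : ℂ) := by
    have e4 : (X ^ p - V ^ p) / p = -(X ^ p / (2 * σ - 1)) -
        (V * Y) ^ p * (Y ^ (-p) / (2 - 2 * σ - 1)) := by
      rw [← mul_div_assoc, e0, show 2 * σ - 1 = -p by rw [hp]; ring,
        show 2 - 2 * σ - 1 = p by rw [hp]; ring]
      field_simp
    rw [e4]; push_cast; ring
  rw [hdec]
  have hn1 : ‖(((V * Y) ^ p : ℝ) : ℂ) * (Z - Sg - ((Y ^ (-p) / (2 - 2 * σ - 1) : ℝ) : ℂ))‖ ≤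
      16 ^ p * C₂ * Y ^ (-(2 * σ)) := by
    rw [norm_mul, norm_real, Real.norm_of_nonneg (by positivity)]
    have h5 : (V * Y) ^ p ≤ 16 ^ p * Y ^ (2 * p) := by
      rw [Real.rpow_mul hY.le, ← Real.mul_rpow (by norm_num) (by positivity), Real.rpow_two]
      exact Real.rpow_le_rpow (by positivity) (by nlinarith) hp0.le
    calc _ ≤ (16 ^ p * Y ^ (2 * p)) * (C₂ * Y ^ (-(2 - 2 * σ))) := by gcongr
      _ = 16 ^ p * C₂ * (Y ^ (2 * p) * Y ^ (-(2 - 2 * σ))) := by ring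
      _ = _ := by rw [← Real.rpow_add hY]; congr 2; rw [hp]; ring
  have hn2 : ‖(((X ^ p - V ^ p) / p : ℝ) : ℂ)‖ ≤ 8 / p * X ^ (-(2 * σ)) := by
    rw [norm_real, Real.norm_eq_abs, abs_div, abs_of_pos hp0, div_mul_eq_mul_div]
    gcongr
  have hx := mpt_rpow_neg_le ha ha1 hK ht h0
  have hy := mpt_rpow_neg_le one_pos le_rfl hK ht h0
  rw [← hXd, ← hc] at hx
  rw [← hYd, ← hc] at hy
  refine (norm_add_le _ _).trans ((add_le_add (norm_sub_le _ _) le_rfl).trans ?_)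
  rw [norm_neg]
  calc _ ≤ C₁ * X ^ (-(2 * σ)) + 16 ^ p * C₂ * Y ^ (-(2 * σ)) + 8 / p * X ^ (-(2 * σ)) := by
        gcongr
    _ ≤ C₁ * (c * t ^ (-σ)) + 16 ^ p * C₂ * (c * t ^ (-σ)) + 8 / p * (c * t ^ (-σ)) := by gcongr
    _ = _ := by ring

lemma continuousOn_hzeta_line (a σ : ℝ) :
    ContinuousOn (fun t : ℝ => hzeta a (σ + t * I)) (Set.Ioi 0) := fun t ht => by
  have hne : (σ + t * I : ℂ) ≠ 1 := fun h => by
    have := congrArg Complex.im h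
    simp at this
    exact (ne_of_gt (Set.mem_Ioi.mp ht)) this
  have hd : DifferentiableAt ℂ (hzeta a) (σ + t * I) :=
    HurwitzZeta.differentiableAt_hurwitzZeta _ hne
  exact (ContinuousAt.comp (f := fun t : ℝ => (σ + t * I : ℂ)) hd.continuousAt
    (by fun_prop)).continuousWithinAt

/-- The density of the mean square. -/
noncomputable def msDensity (a σ t : ℝ) : ℂ :=
  hzeta a ((2 * σ : ℝ) : ℂ) +
    (((t / (2 * Real.pi)) ^ (1 - 2 * σ) : ℝ) : ℂ) * hzeta 1 ((2 - 2 * σ : ℝ) : ℂ)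

lemma continuous_msDensity (a : ℝ) {σ : ℝ} (h1 : σ < 1 / 2) : Continuous (msDensity a σ) := by
  unfold msDensity
  have : Continuous fun t : ℝ => (t / (2 * Real.pi)) ^ (1 - 2 * σ) :=
    (continuous_id.div_const _).rpow_const fun _ => Or.inr (by linarith)
  fun_prop

lemma ngl_mean_square {a : ℝ} (ha : 0 < a) (ha1 : a ≤ 1) {σ : ℝ} (h0 : 0 < σ) (h1 : σ < 1 / 2) :
    Ngl σ fun _ t => hzeta a (σ + t * I) * starRingEnd ℂ (hzeta a (σ + t * I)) -
      msDensity a σ t := by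
  set A : ℕ → ℝ → ℂ := fun K t => dirSum a (σ + t * I) K with hA
  set G : ℕ → ℝ → ℂ := fun K t => dualSum a (σ + t * I) K with hG
  set R : ℕ → ℝ → ℂ := fun K t => rMain a (σ + t * I) K with hR
  set S : ℕ → ℝ → ℂ := fun K _ => ((∑ m ∈ range K, xpt a m ^ (-(2 * σ)) : ℝ) : ℂ) with hS
  set U : ℕ → ℝ → ℂ := fun K t => (((t / (2 * Real.pi)) ^ (1 - 2 * σ) *
    ∑ n ∈ range K, xpt 1 n ^ (-(2 - 2 * σ)) : ℝ) : ℂ) with hU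
  set Z : ℕ → ℝ → ℂ := fun _ t => hzeta a (σ + t * I) * starRingEnd ℂ (hzeta a (σ + t * I)) -
      msDensity a σ t with hZ
  have bA : BC A := bc_dirSum ha σ
  have bG : BC G := bc_dualSum a σ
  have bR : BC R := bc_rMain ha ha1 h0 (by linarith)
  have bS : BC S := fun K _ => continuousOn_const
  have bU : BC U := fun K _ => by
    have : Continuous fun t : ℝ => (t / (2 * Real.pi)) ^ (1 - 2 * σ) :=
      (continuous_id.div_const _).rpow_const fun _ => Or.inr (by linarith)
    simp only [hU]
    exact Continuous.continuousOn (by fun_prop)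
  have bz : BC fun _ t => hzeta a (σ + t * I) := fun K _ =>
    (continuousOn_hzeta_line a σ).mono (Icc_tB_subset K)
  have bZ : BC Z := (bz.mul bz.conj).sub fun K _ => (continuous_msDensity a h1).continuousOn
  have bGA := bG.mul bA.conj
  have bAR := bA.mul bR.conj
  have bGR := bG.mul bR.conj
  have nGA := ngl_dual_dir ha ha1 h0 h1
  have nAR := ngl_dir_rMain ha ha1 h0 (by linarith : σ < 1)
  have nGR := ngl_dual_rMain ha ha1 h0 h1
  have b1 := ((bA.mul bA.conj).sub bS).add ((bG.mul bG.conj).sub bU)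
  have n1 := Ngl.add ((bA.mul bA.conj).sub bS) ((bG.mul bG.conj).sub bU)
    (ngl_dir_dir ha ha1 h0 (by linarith : σ < 1)) (ngl_dual_dual a h0 h1)
  have b2 := b1.add (bGA.add bGA.conj)
  have n2 := Ngl.add b1 (bGA.add bGA.conj) n1 (nGA.add bGA bGA.conj nGA.conj)
  have b3 := b2.add (bAR.add bAR.conj)
  have n3 := Ngl.add b2 (bAR.add bAR.conj) n2 (nAR.add bAR bAR.conj nAR.conj)
  have b4 := b3.add (bGR.add bGR.conj)
  have n4 := Ngl.add b3 (bGR.add bGR.conj) n3 (nGR.add bGR bGR.conj nGR.conj)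
  obtain ⟨C₁, hC₁, hrem⟩ := norm_rem_le ha ha1 h0 h1
  obtain ⟨C₂, hC₂, hdiag⟩ := norm_diag_sub_le ha ha1 h0 h1
  have n5 := Ngl.of_pointwise h0 (by linarith : σ < 1) (add_nonneg hC₁ hC₂)
    (f := fun K t => Z K t - (A K t * starRingEnd ℂ (A K t) - S K t +
      (G K t * starRingEnd ℂ (G K t) - U K t) +
      (G K t * starRingEnd ℂ (A K t) + starRingEnd ℂ (G K t * starRingEnd ℂ (A K t))) +
      (A K t * starRingEnd ℂ (R K t) + starRingEnd ℂ (A K t * starRingEnd ℂ (R K t))) +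
      (G K t * starRingEnd ℂ (R K t) + starRingEnd ℂ (G K t * starRingEnd ℂ (R K t)))))
    fun K hK t ht => by
      have h3 := hrem K hK t ht _ _ _ rfl rfl rfl
      have h4 := hdiag K hK t ht
      rw [add_mul]
      refine le_trans (le_of_eq ?_) ((norm_add_le _ _).trans (add_le_add h3 h4))
      congr 1
      have e : hzeta a (σ + t * I) = A K t + G K t + R K t + afeErr a (σ + t * I) K := by
        simp only [hA, hG, hR, afeErr]; ring
      simp only [hZ, msDensity]
      rw [e]
      change _ = R K t * starRingEnd ℂ (R K t) + ((A K t + G K t + R K t) *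
        starRingEnd ℂ (afeErr a (σ + t * I) K) + afeErr a (σ + t * I) K *
        starRingEnd ℂ (A K t + G K t + R K t) + afeErr a (σ + t * I) K *
        starRingEnd ℂ (afeErr a (σ + t * I) K)) + (S K t + U K t - _)
      simp only [map_add, map_mul, conj_conj]
      ring
  refine (Ngl.add b4 (bZ.sub b4) n4 n5).congr fun K _ t _ => ?_
  simp only [hZ]
  ring

lemma exists_tB_block {T : ℝ} (hT : tB 1 ≤ T) : ∃ N, 1 ≤ N ∧ tB N ≤ T ∧ T ≤ tB (N + 1) := by
  by_contra! h
  have : ∀ N : ℕ, tB (N + 1) ≤ T := fun N => by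
    induction N with
    | zero => simpa using hT
    | succ n ih => exact (h (n + 1) (by omega) ih).le
  obtain ⟨n, hn⟩ := exists_nat_gt T
  have h2 := natCast_le_of_tB_le (by omega) (this n)
  push_cast at h2
  linarith

lemma integral_msDensity (a : ℝ) {σ : ℝ} (h1 : σ < 1 / 2) {T₁ T : ℝ} (hT₁ : 0 < T₁) (hT : T₁ ≤ T) :
    ∫ t in T₁..T, msDensity a σ t = hzeta a ((2 * σ : ℝ) : ℂ) * (T - T₁) +
      hzeta 1 ((2 - 2 * σ : ℝ) : ℂ) * (((2 * Real.pi) ^ (2 * σ - 1) *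
        ((T ^ (2 - 2 * σ) - T₁ ^ (2 - 2 * σ)) / (2 - 2 * σ)) : ℝ) : ℂ) := by
  have hpi := Real.pi_pos
  have e : Set.EqOn (msDensity a σ) (fun t => hzeta a ((2 * σ : ℝ) : ℂ) +
      hzeta 1 ((2 - 2 * σ : ℝ) : ℂ) * (((2 * Real.pi) ^ (2 * σ - 1) * t ^ (1 - 2 * σ) : ℝ) : ℂ))
      (Set.uIcc T₁ T) := fun t ht => by
    rw [Set.uIcc_of_le hT] at ht
    have ht0 : 0 ≤ t := hT₁.le.trans ht.1
    simp only [msDensity]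
    rw [Real.div_rpow ht0 (by positivity), div_eq_mul_inv, ← Real.rpow_neg (by positivity),
      show -(1 - 2 * σ) = 2 * σ - 1 by ring]
    push_cast; ring
  have hc : Continuous fun t : ℝ => (2 * Real.pi) ^ (2 * σ - 1) * t ^ (1 - 2 * σ) :=
    continuous_const.mul (continuous_id.rpow_const fun _ => Or.inr (by linarith))
  rw [intervalIntegral.integral_congr e, intervalIntegral.integral_add (by simp)
    (by apply Continuous.intervalIntegrable; fun_prop), intervalIntegral.integral_const,
    intervalIntegral.integral_const_mul, intervalIntegral.integral_ofReal,
    intervalIntegral.integral_const_mul, integral_rpow (Or.inl (by linarith)),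
    show 1 - 2 * σ + 1 = 2 - 2 * σ by ring, real_smul]
  push_cast; ring

/-- The mean square of the Hurwitz zeta function to the left of the critical line. -/
theorem hzeta_mean_square {a : ℝ} (ha : 0 < a) (ha1 : a ≤ 1) {σ : ℝ} (h0 : 0 < σ) (h1 : σ < 1 / 2) :
    (fun T : ℝ => (∫ t in (1 : ℝ)..T,
        hzeta a (σ + t * I) * starRingEnd ℂ (hzeta a (σ + t * I))) -
      (hzeta a ((2 * σ : ℝ) : ℂ) * T + hzeta 1 ((2 - 2 * σ : ℝ) : ℂ) *
        (((2 * Real.pi) ^ (2 * σ - 1) * (T ^ (2 - 2 * σ) / (2 - 2 * σ)) : ℝ) : ℂ)))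
      =O[atTop] fun T : ℝ => T ^ (1 - σ) * Real.log T := by
  obtain ⟨C, hC, h⟩ := ngl_mean_square ha ha1 h0 h1
  have hB := one_le_tB 1
  set f : ℝ → ℂ := fun t => hzeta a (σ + t * I) * starRingEnd ℂ (hzeta a (σ + t * I)) with hf
  have hfc : ContinuousOn f (Set.Ioi 0) := (continuousOn_hzeta_line a σ).mul
    (continuous_conj.comp_continuousOn (continuousOn_hzeta_line a σ))
  set D : ℂ := (∫ t in (1 : ℝ)..tB 1, f t) - hzeta a ((2 * σ : ℝ) : ℂ) * tB 1 -
    hzeta 1 ((2 - 2 * σ : ℝ) : ℂ) * (((2 * Real.pi) ^ (2 * σ - 1) *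
      (tB 1 ^ (2 - 2 * σ) / (2 - 2 * σ)) : ℝ) : ℂ) with hD
  refine Asymptotics.IsBigO.of_bound (C + ‖D‖) ?_
  filter_upwards [eventually_ge_atTop (tB 1)] with T hT
  obtain ⟨N, hN, hT1, hT2⟩ := exists_tB_block hT
  have h2 := h N T hN hT1 hT2
  have hsub : Set.Ici (tB 1) ⊆ Set.Ioi 0 := fun t ht => by
    have : tB 1 ≤ t := ht
    show 0 < t
    linarith
  have hmc := continuous_msDensity a h1
  have hcd : ContinuousOn (fun t => f t - msDensity a σ t) (Set.Ici (tB 1)) :=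
    (hfc.mono hsub).sub hmc.continuousOn
  change ‖bInt (fun _ t => f t - msDensity a σ t) N T‖ ≤ _ at h2
  rw [bInt_const hcd hN hT1,
    intervalIntegral.integral_sub (((hfc.mono hsub).mono Set.Icc_subset_Ici_self).intervalIntegrable_of_Icc hT)
      (hmc.intervalIntegrable _ _), integral_msDensity a h1 (by linarith) hT] at h2
  have hT6 : (Real.exp 1) ≤ T := by
    have := six_le_tB 1
    have := Real.exp_one_lt_d9
    norm_num at *
    linarith
  have hT1' : 1 ≤ T := hB.trans hT
  have hlog : 1 ≤ Real.log T := by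
    rw [Real.le_log_iff_exp_le (by linarith)]; exact hT6
  have hg : 1 ≤ T ^ (1 - σ) * Real.log T := by
    have := Real.one_le_rpow hT1' (by linarith : 0 ≤ 1 - σ)
    nlinarith
  rw [Real.norm_of_nonneg (by linarith), add_mul]
  have hsplit : ∫ t in (1 : ℝ)..T, f t = (∫ t in (1 : ℝ)..tB 1, f t) + ∫ t in tB 1..T, f t :=
    (intervalIntegral.integral_add_adjacent_intervals
      ((hfc.mono fun t ht => lt_of_lt_of_le one_pos ht.1).intervalIntegrable_of_Icc hB)
      (((hfc.mono hsub).mono Set.Icc_subset_Ici_self).intervalIntegrable_of_Icc hT)).symm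
  rw [hsplit]
  have e3 : (∫ t in (1 : ℝ)..tB 1, f t) + (∫ t in tB 1..T, f t) -
      (hzeta a ((2 * σ : ℝ) : ℂ) * T + hzeta 1 ((2 - 2 * σ : ℝ) : ℂ) *
        (((2 * Real.pi) ^ (2 * σ - 1) * (T ^ (2 - 2 * σ) / (2 - 2 * σ)) : ℝ) : ℂ)) =
      ((∫ t in tB 1..T, f t) - (hzeta a ((2 * σ : ℝ) : ℂ) * (T - tB 1) +
      hzeta 1 ((2 - 2 * σ : ℝ) : ℂ) * (((2 * Real.pi) ^ (2 * σ - 1) *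
        ((T ^ (2 - 2 * σ) - tB 1 ^ (2 - 2 * σ)) / (2 - 2 * σ)) : ℝ) : ℂ))) + D := by
    rw [hD]; push_cast; ring
  rw [e3]
  refine (norm_add_le _ _).trans (add_le_add h2 ?_)
  exact le_mul_of_one_le_right (norm_nonneg _) hg

/-- Approximation of the Hurwitz zeta function by a Dirichlet polynomial of length at least `t`. -/
lemma hzeta_sub_dirSum_le {a : ℝ} (ha : 0 < a) (ha1 : a ≤ 1) {β : ℝ} (hβ : 0 < β) :
    ∃ C, 0 ≤ C ∧ ∀ N : ℕ, 1 ≤ N → ∀ t : ℝ, 1 ≤ t → t ≤ N →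
      ‖hzeta a (β + t * I) - dirSum a (β + t * I) N‖ ≤ C * (N : ℝ) ^ (1 - β) * t⁻¹ := by
  refine ⟨4 * 4 ^ β + 2 ^ |1 - β|, by positivity, fun N hN t ht htN => ?_⟩
  have hNp : (0 : ℝ) < N := by exact_mod_cast hN
  have ht0 : 0 < t := by linarith
  have hm := mpt_half_le ha hN
  have hpi := Real.pi_gt_three
  have hre : (β + t * I : ℂ).re = β := by simp
  have him : (β + t * I : ℂ).im = t := by simp
  have h := hzeta_crude ha ha1 (s := (β + t * I : ℂ)) (by rw [hre]; exact hβ)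
    (by rw [him]; exact ht0) hN (by rw [him]; nlinarith)
  rw [hre, him] at h
  have h1 : (mpt a N / 2) ^ (-β) ≤ 4 ^ β * ((N : ℝ) ^ (1 - β) * t⁻¹) := by
    calc _ ≤ ((N : ℝ) / 4) ^ (-β) :=
          Real.rpow_le_rpow_of_nonpos (by positivity) (by linarith) (by linarith)
      _ = 4 ^ β * ((N : ℝ) ^ (1 - β) * (N : ℝ)⁻¹) := by
          rw [Real.div_rpow hNp.le (by norm_num), Real.rpow_neg (by norm_num : (0 : ℝ) ≤ 4), div_inv_eq_mul,
            mul_comm, ← Real.rpow_neg_one (N : ℝ), ← Real.rpow_add hNp]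
          congr 2; ring
      _ ≤ _ := by gcongr
  have h2 : mpt a N ^ (1 - β) / t ≤ 2 ^ |1 - β| * ((N : ℝ) ^ (1 - β) * t⁻¹) := by
    rw [div_eq_mul_inv, ← mul_assoc]
    exact mul_le_mul_of_nonneg_right (mpt_rpow_le ha ha1 hN _) (by positivity)
  refine h.trans ?_
  linarith

/-- The correlation of two Dirichlet polynomials with different abscissae. -/
lemma integral_dirSum_mul_conj_le {a : ℝ} (ha : 0 < a) (ha1 : a ≤ 1) {β γ : ℝ} (hβ : 0 < β)
    (hβ1 : β ≠ 1) (hγ : 0 < γ) (hγ1 : γ ≠ 1) :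
    ∃ C, 0 ≤ C ∧ ∀ N : ℕ, 1 ≤ N → ∀ T : ℝ, 1 ≤ T →
      ‖(∫ t in (1 : ℝ)..T, dirSum a (β + t * I) N * starRingEnd ℂ (dirSum a (γ + t * I) N)) -
        ((∑ m ∈ range N, xpt a m ^ (-(β + γ)) : ℝ) : ℂ) * (T - 1)‖ ≤
      C * (((N : ℝ) ^ (1 - β) + 1) * ((N : ℝ) ^ (1 - γ) + 1) * (1 + Real.log N)) := by
  obtain ⟨C, hC, h⟩ := sum_offdiag_le ha ha1 hβ hβ1 hγ hγ1
  refine ⟨2 * C, by positivity, fun N hN T hT => ?_⟩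
  set c : ℕ → ℕ → ℝ → ℂ := fun i j t =>
    (xpt a i : ℂ) ^ (-(β + t * I : ℂ)) * starRingEnd ℂ ((xpt a j : ℂ) ^ (-(γ + t * I : ℂ))) with hc
  have hcc : ∀ i j, Continuous (c i j) := fun i j =>
    (continuous_cpow_line (xpt_pos ha i) (by fun_prop)).mul
        (continuous_conj.comp (continuous_cpow_line (xpt_pos ha j) (by fun_prop)))
  have hexp : ∀ i j t, c i j t = ((xpt a i ^ (-β) * xpt a j ^ (-γ) : ℝ) : ℂ) *
      cexp (I * ((Real.log (xpt a j) - Real.log (xpt a i) : ℝ) * t)) := fun i j t => by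
    rw [hc]; exact cpow_mul_conj_cpow (xpt_pos ha i) (xpt_pos ha j) _ _ _
  have hdiag : ∀ i, ∫ t in (1 : ℝ)..T, c i i t = ((xpt a i ^ (-(β + γ)) : ℝ) : ℂ) * (T - 1) := by
    intro i
    simp_rw [hexp]
    rw [show -(β + γ) = -β + -γ by ring, Real.rpow_add (xpt_pos ha i)]
    simp only [sub_self, ofReal_zero, zero_mul, mul_zero, exp_zero, mul_one]
    rw [intervalIntegral.integral_const, real_smul]
    push_cast; ring
  have hoff : ∀ i j, i ≠ j → ‖∫ t in (1 : ℝ)..T, c i j t‖ ≤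
        2 * (xpt a i ^ (-β) * xpt a j ^ (-γ) * |Real.log (xpt a i) - Real.log (xpt a j)|⁻¹) := by
    intro i j hij
    have hl : Real.log (xpt a j) - Real.log (xpt a i) ≠ 0 := log_xpt_ne ha (Ne.symm hij)
    have hx := mul_nonneg (Real.rpow_nonneg (xpt_pos ha i).le (-β))
      (Real.rpow_nonneg (xpt_pos ha j).le (-γ))
    simp_rw [hexp]
    rw [intervalIntegral.integral_const_mul, norm_mul, norm_real, Real.norm_of_nonneg hx]
    have h3 := norm_integral_cexp_le hl one_pos hT
    rw [abs_sub_comm] at h3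
    calc _ ≤ xpt a i ^ (-β) * xpt a j ^ (-γ) *
          (2 * |Real.log (xpt a i) - Real.log (xpt a j)|⁻¹) := mul_le_mul_of_nonneg_left h3 hx
      _ = _ := by ring
  have hint : ∫ t in (1 : ℝ)..T, dirSum a (β + t * I) N * starRingEnd ℂ (dirSum a (γ + t * I) N) =
      ∑ i ∈ range N, ∑ j ∈ range N, ∫ t in (1 : ℝ)..T, c i j t := by
    simp_rw [dirSum, map_sum, sum_mul_sum]
    rw [intervalIntegral.integral_finsetSum fun i _ =>
      (continuous_finsetSum _ fun j _ => hcc i j).intervalIntegrable _ _]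
    refine sum_congr rfl fun i _ => ?_
    rw [intervalIntegral.integral_finsetSum fun j _ => (hcc i j).intervalIntegrable _ _]
  have hsplit : (∑ i ∈ range N, ∑ j ∈ range N, ∫ t in (1 : ℝ)..T, c i j t) -
      ((∑ m ∈ range N, xpt a m ^ (-(β + γ)) : ℝ) : ℂ) * (T - 1) =
      ∑ i ∈ range N, ∑ j ∈ range N, if i = j then 0 else ∫ t in (1 : ℝ)..T, c i j t := by
    rw [ofReal_sum, sum_mul, ← sum_sub_distrib]
    refine sum_congr rfl fun i hi => ?_
    rw [← hdiag, ← add_sum_erase _ _ hi, ← add_sum_erase (range N) (fun j => if i = j then _ else _) hi,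
      if_pos rfl, zero_add, add_sub_cancel_left]
    exact sum_congr rfl fun j hj => (if_neg (ne_of_mem_erase hj).symm).symm
  rw [hint, hsplit]
  have hb : ∀ i j, ‖if i = j then 0 else ∫ t in (1 : ℝ)..T, c i j t‖ ≤
        2 * (xpt a i ^ (-β) * xpt a j ^ (-γ) * |Real.log (xpt a i) - Real.log (xpt a j)|⁻¹) := by
    intro i j
    by_cases hij : i = j
    · simp [hij]
    · rw [if_neg hij]; exact hoff i j hij
  refine (norm_sum_le _ _).trans ((sum_le_sum fun i _ => (norm_sum_le _ _).trans
      (sum_le_sum fun j _ => hb i j)).trans ?_)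
  simp_rw [← mul_sum]
  rw [mul_assoc]
  exact mul_le_mul_of_nonneg_left (h N hN) (by norm_num)

/-- Replacing two Hurwitz zeta factors by Dirichlet polynomials in a mean value. -/
lemma integral_hzeta_sub_dirSum_le {a : ℝ} (ha : 0 < a) (ha1 : a ≤ 1) {β γ : ℝ} (hβ : 0 < β)
    (hβ1 : β ≠ 1) (hγ : 0 < γ) (hγ1 : γ ≠ 1) :
    ∃ C, 0 ≤ C ∧ ∀ N : ℕ, 1 ≤ N → ∀ T : ℝ, 1 ≤ T → T ≤ N →
      ‖(∫ t in (1 : ℝ)..T, hzeta a (β + t * I) * starRingEnd ℂ (hzeta a (γ + t * I))) -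
        ∫ t in (1 : ℝ)..T, dirSum a (β + t * I) N * starRingEnd ℂ (dirSum a (γ + t * I) N)‖ ≤
      C * (((N : ℝ) ^ (1 - β) + 1) * ((N : ℝ) ^ (1 - γ) + 1) * Real.log T) := by
  obtain ⟨C₁, hC₁, h₁⟩ := hzeta_sub_dirSum_le ha ha1 hβ
  obtain ⟨C₂, hC₂, h₂⟩ := hzeta_sub_dirSum_le ha ha1 hγ
  obtain ⟨D₁, hD₁, g₁⟩ := sum_xpt_le ha ha1 hβ hβ1
  obtain ⟨D₂, hD₂, g₂⟩ := sum_xpt_le ha ha1 hγ hγ1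
  refine ⟨D₁ * C₂ + C₁ * D₂ + C₁ * C₂, by positivity, fun N hN T hT hTN => ?_⟩
  set P := (N : ℝ) ^ (1 - β) with hP
  set Q := (N : ℝ) ^ (1 - γ) with hQ
  have hP0 : 0 ≤ P := by positivity
  have hQ0 : 0 ≤ Q := by positivity
  have hd : ∀ σ t : ℝ, ‖dirSum a (σ + t * I) N‖ ≤ ∑ m ∈ range N, xpt a m ^ (-σ) := fun σ t => by
    refine (norm_sum_le _ _).trans (sum_le_sum fun m _ => ?_)
    rw [norm_xpt_cpow ha]
  have hs : Set.Icc 1 T ⊆ Set.Ioi 0 := fun t ht => lt_of_lt_of_le one_pos ht.1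
  have hi₁ : IntervalIntegrable (fun t : ℝ => hzeta a (β + t * I) *
      starRingEnd ℂ (hzeta a (γ + t * I))) volume 1 T :=
    (((continuousOn_hzeta_line a β).mul (continuous_conj.comp_continuousOn
      (continuousOn_hzeta_line a γ))).mono hs).intervalIntegrable_of_Icc hT
  have hi₂ : IntervalIntegrable (fun t : ℝ => dirSum a (β + t * I) N *
      starRingEnd ℂ (dirSum a (γ + t * I) N)) volume 1 T :=
    ((continuous_dirSum ha β N).mul (continuous_conj.comp
      (continuous_dirSum ha γ N))).intervalIntegrable _ _
  rw [← intervalIntegral.integral_sub hi₁ hi₂]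
  set M := (D₁ * C₂ + C₁ * D₂ + C₁ * C₂) * ((P + 1) * (Q + 1)) with hM
  have hb : ∀ t : ℝ, t ∈ Set.Ioc 1 T → ‖hzeta a (β + t * I) * starRingEnd ℂ (hzeta a (γ + t * I)) -
      dirSum a (β + t * I) N * starRingEnd ℂ (dirSum a (γ + t * I) N)‖ ≤ M * t⁻¹ := by
    intro t ht
    have ht1 : 1 ≤ t := ht.1.le
    have ht0 : 0 ≤ t⁻¹ := by positivity
    have htt : t⁻¹ ≤ 1 := inv_le_one_of_one_le₀ ht1
    have e₁ := h₁ N hN t ht1 (ht.2.trans hTN)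
    have e₂ := h₂ N hN t ht1 (ht.2.trans hTN)
    have f₁ := (hd β t).trans (g₁ N hN)
    have f₂ := (hd γ t).trans (g₂ N hN)
    set z := hzeta a (β + t * I)
    set w := hzeta a (γ + t * I)
    set A := dirSum a (β + t * I) N
    set B := dirSum a (γ + t * I) N
    have e₁' : ‖z - A‖ ≤ C₁ * (P + 1) * t⁻¹ := e₁.trans (by gcongr; linarith)
    have e₂' : ‖w - B‖ ≤ C₂ * (Q + 1) * t⁻¹ := e₂.trans (by gcongr; linarith)
    have e₃ : ‖z - A‖ ≤ C₁ * (P + 1) := e₁'.trans (mul_le_of_le_one_right (by positivity) htt)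
    have key : z * starRingEnd ℂ w - A * starRingEnd ℂ B = A * starRingEnd ℂ (w - B) +
        (z - A) * starRingEnd ℂ B + (z - A) * starRingEnd ℂ (w - B) := by
      rw [map_sub]; ring
    rw [key]
    refine (norm_add₃_le ..).trans ?_
    simp only [norm_mul, norm_conj]
    have k1 := mul_le_mul f₁ e₂' (norm_nonneg _) (by positivity)
    have k2 := mul_le_mul e₁' f₂ (norm_nonneg _) (by positivity)
    have k3 := mul_le_mul e₃ e₂' (norm_nonneg _) (by positivity)
    rw [hM]
    linarith
  have hii : IntervalIntegrable (fun t : ℝ => M * t⁻¹) volume 1 T :=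
    (ContinuousOn.mono (continuousOn_const.mul (continuousOn_inv₀))
      fun t ht => (lt_of_lt_of_le one_pos ht.1).ne').intervalIntegrable_of_Icc hT
  refine (intervalIntegral.norm_integral_le_of_norm_le hT (Eventually.of_forall hb) hii).trans ?_
  rw [intervalIntegral.integral_const_mul, integral_inv_of_pos one_pos (by linarith), div_one, hM]
  linarith

/-- Mean values of `ζ_H(β + it) conj ζ_H(γ + it)` dominated by the diagonal. -/
theorem hzeta_mul_conj_mean {a : ℝ} (ha : 0 < a) (ha1 : a ≤ 1) {β γ δ : ℝ} (hδ : 0 < δ)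
    (hδ1 : δ < 1 / 2) (hβ : δ ≤ β) (hβ1 : β ≠ 1) (hγ : δ ≤ γ) (hγ1 : γ ≠ 1)
    (hβγ : 1 + 2 * δ ≤ β + γ) :
    (fun T : ℝ => (∫ t in (1 : ℝ)..T, hzeta a (β + t * I) * starRingEnd ℂ (hzeta a (γ + t * I))) -
      hzeta a ((β + γ : ℝ) : ℂ) * T) =O[atTop] fun T : ℝ => T ^ (1 - δ) * Real.log T := by
  obtain ⟨C₁, hC₁, h₁⟩ := integral_hzeta_sub_dirSum_le ha ha1 (hδ.trans_le hβ) hβ1 (hδ.trans_le hγ) hγ1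
  obtain ⟨C₂, hC₂, h₂⟩ := integral_dirSum_mul_conj_le ha ha1 (hδ.trans_le hβ) hβ1 (hδ.trans_le hγ) hγ1
  have hs0 : 0 < β + γ := by linarith
  have hs1 : β + γ ≠ 1 := by linarith
  obtain ⟨C₃, hC₃, h₃⟩ := hzeta_approx_of_one_le ha ha1 hs0 hs1
  obtain ⟨C₄, hC₄, h₄⟩ := sum_xpt_le ha ha1 hs0 hs1
  set B := β + γ - 1 with hB
  have hB0 : 0 < B := by linarith
  set E := C₃ * 2 ^ |-(β + γ)| + 2 ^ |1 - (β + γ)| / B with hE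
  refine Asymptotics.IsBigO.of_bound (8 * C₁ + 24 * C₂ + 2 * E + 2 * C₄) ?_
  filter_upwards [eventually_ge_atTop (Real.exp 1)] with T hT
  have hT1 : 1 ≤ T := (Real.one_le_exp zero_le_one).trans hT
  have hT0 : 0 < T := by linarith
  have hlog : 1 ≤ Real.log T := by rwa [Real.le_log_iff_exp_le hT0]
  set N := ⌈T⌉₊ with hN
  have hTN : T ≤ N := Nat.le_ceil T
  have hN1 : 1 ≤ N := Nat.one_le_ceil_iff.mpr hT0
  have hNR : (1 : ℝ) ≤ N := by exact_mod_cast hN1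
  have hN2 : (N : ℝ) ≤ 2 * T := by
    have := Nat.ceil_lt_add_one hT0.le
    linarith
  have hNp : (0 : ℝ) < N := by linarith
  set P := (N : ℝ) ^ (1 - β) + 1 with hP
  set Q := (N : ℝ) ^ (1 - γ) + 1 with hQ
  set U := T ^ (1 - δ) with hU
  have hU1 : 1 ≤ U := Real.one_le_rpow hT1 (by linarith)
  have hlN : 1 + Real.log N ≤ 3 * Real.log T := by
    have k1 : Real.log N ≤ Real.log (2 * T) := Real.log_le_log hNp hN2
    rw [Real.log_mul (by norm_num) hT0.ne'] at k1
    have := Real.log_two_lt_d9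
    linarith
  have hNU : (N : ℝ) ^ (1 - δ) ≤ 2 * U := by
    calc (N : ℝ) ^ (1 - δ) ≤ (2 * T) ^ (1 - δ) := Real.rpow_le_rpow hNp.le hN2 (by linarith)
      _ = 2 ^ (1 - δ) * U := Real.mul_rpow (by norm_num) hT0.le
      _ ≤ 2 ^ (1 : ℝ) * U := by
          gcongr
          · norm_num
          · linarith
      _ = 2 * U := by rw [Real.rpow_one]
  have hle : ∀ p, p ≤ 1 - δ → (N : ℝ) ^ p ≤ 2 * U := fun p hp =>
    (Real.rpow_le_rpow_of_exponent_le hNR hp).trans hNU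
  have hPQ : P * Q ≤ 8 * U := by
    have k1 := hle (1 - β) (by linarith)
    have k2 := hle (1 - γ) (by linarith)
    have k3 : (N : ℝ) ^ (1 - β) * (N : ℝ) ^ (1 - γ) ≤ 2 * U := by
      rw [← Real.rpow_add hNp]; exact hle _ (by linarith)
    rw [hP, hQ]
    nlinarith
  have hPQ0 : 0 ≤ P * Q := by positivity
  have e1 := h₁ N hN1 T hT1 hTN
  have e2 := h₂ N hN1 T hT1
  have e4 := h₄ N hN1
  set S := ∑ m ∈ range N, xpt a m ^ (-(β + γ)) with hS
  have hS0 : 0 ≤ S := sum_nonneg fun m _ => Real.rpow_nonneg (xpt_pos ha m).le _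
  have hS2 : S ≤ 2 * C₄ * U := by
    have : (N : ℝ) ^ (1 - (β + γ)) ≤ 1 := Real.rpow_le_one_of_one_le_of_nonpos hNR (by linarith)
    nlinarith
  have e3 : ‖hzeta a ((β + γ : ℝ) : ℂ) - (S : ℂ)‖ ≤ E * (N : ℝ) ^ (1 - (β + γ)) := by
    have k := h₃ N hN1
    have m0 := mpt_pos ha hN1
    have k1 := mpt_rpow_le ha ha1 hN1 (-(β + γ))
    have k2 := mpt_rpow_le ha ha1 hN1 (1 - (β + γ))
    have k3 : ‖((mpt a N ^ (1 - (β + γ)) / (β + γ - 1) : ℝ) : ℂ)‖ ≤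
        2 ^ |1 - (β + γ)| / B * (N : ℝ) ^ (1 - (β + γ)) := by
      rw [norm_real, Real.norm_of_nonneg (by rw [← hB]; positivity), div_mul_eq_mul_div]
      exact div_le_div_of_nonneg_right k2 hB0.le
    have k4 : (N : ℝ) ^ (-(β + γ)) ≤ (N : ℝ) ^ (1 - (β + γ)) :=
      Real.rpow_le_rpow_of_exponent_le hNR (by linarith)
    have k5 : C₃ * mpt a N ^ (-(β + γ)) ≤ C₃ * 2 ^ |-(β + γ)| * (N : ℝ) ^ (1 - (β + γ)) := by
      rw [mul_assoc]
      exact mul_le_mul_of_nonneg_left (k1.trans (mul_le_mul_of_nonneg_left k4 (by positivity))) hC₃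
    have k6 := norm_le_norm_sub_add (hzeta a ((β + γ : ℝ) : ℂ) - (S : ℂ))
      ((mpt a N ^ (1 - (β + γ)) / (β + γ - 1) : ℝ) : ℂ)
    rw [hE, add_mul]
    linarith
  have e3' : ‖hzeta a ((β + γ : ℝ) : ℂ) - (S : ℂ)‖ * T ≤ 2 * E * U := by
    have hE0 : 0 ≤ E := by positivity
    have : (N : ℝ) ^ (1 - (β + γ)) * T ≤ 2 * U := by
      calc _ ≤ (N : ℝ) ^ (1 - (β + γ)) * N := by gcongr
        _ = (N : ℝ) ^ (2 - (β + γ)) := by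
          rw [← Real.rpow_add_one hNp.ne']; congr 1; ring
        _ ≤ _ := hle _ (by linarith)
    calc _ ≤ E * (N : ℝ) ^ (1 - (β + γ)) * T := by gcongr
      _ = E * ((N : ℝ) ^ (1 - (β + γ)) * T) := by ring
      _ ≤ E * (2 * U) := by gcongr
      _ = _ := by ring
  set F := ∫ t in (1 : ℝ)..T, hzeta a (β + t * I) * starRingEnd ℂ (hzeta a (γ + t * I))
  set G := ∫ t in (1 : ℝ)..T, dirSum a (β + t * I) N * starRingEnd ℂ (dirSum a (γ + t * I) N)
  have key : F - hzeta a ((β + γ : ℝ) : ℂ) * T = (F - G) + (G - (S : ℂ) * (T - 1)) -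
      (hzeta a ((β + γ : ℝ) : ℂ) - (S : ℂ)) * T - (S : ℂ) := by ring
  have e1' : ‖F - G‖ ≤ 8 * C₁ * (U * Real.log T) := by
    refine e1.trans ?_
    calc _ ≤ C₁ * (8 * U * Real.log T) := by gcongr
      _ = _ := by ring
  have e2' : ‖G - (S : ℂ) * (T - 1)‖ ≤ 24 * C₂ * (U * Real.log T) := by
    refine e2.trans ?_
    calc _ ≤ C₂ * (8 * U * (3 * Real.log T)) := by
          have : 0 ≤ 1 + Real.log N := by have := Real.log_natCast_nonneg N; linarith
          gcongr
      _ = _ := by ring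
  have hUl : U ≤ U * Real.log T := le_mul_of_one_le_right (by linarith) hlog
  rw [key, Real.norm_of_nonneg (by positivity)]
  refine (norm_sub_le _ _).trans (le_trans (add_le_add ((norm_sub_le _ _).trans
    (add_le_add (norm_add_le _ _) le_rfl)) le_rfl) ?_)
  rw [norm_mul, norm_real, norm_real, Real.norm_of_nonneg hT0.le, Real.norm_of_nonneg hS0]
  have hE0 : 0 ≤ E := by positivity
  have t1 : 2 * E * U ≤ 2 * E * (U * Real.log T) := by gcongr
  have t2 : 2 * C₄ * U ≤ 2 * C₄ * (U * Real.log T) := by gcongr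
  linarith

lemma pCoeff_top (r : ℕ) (a : ℝ) : pCoeff r a (r - 1) = ((Nat.factorial (r - 1) : ℝ))⁻¹ := by
  have hm : ∀ i ∈ range (r - 1), (Polynomial.X + Polynomial.C ((i : ℝ) + 1 - a)).Monic :=
    fun i _ => Polynomial.monic_X_add_C _
  have hd : (∏ i ∈ range (r - 1), (Polynomial.X + Polynomial.C ((i : ℝ) + 1 - a))).natDegree =
      r - 1 := by
    rw [Polynomial.natDegree_prod_of_monic _ _ hm, sum_congr rfl fun _ _ => Polynomial.natDegree_X_add_C _]
    simp
  have hc := (Polynomial.monic_prod_of_monic _ _ hm).coeff_natDegree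
  rw [hd] at hc
  rw [pCoeff, Polynomial.coeff_smul, hc, smul_eq_mul, mul_one]

lemma hzeta_one_eq (s : ℂ) : hzeta 1 s = riemannZeta s := by
  rw [hzeta, AddCircle.coe_period, HurwitzZeta.hurwitzZeta_zero]

/-- The mean square of `ζ_r` as a double sum of correlations of Hurwitz zeta functions. -/
lemma integral_norm_zetaR_sq (r : ℕ) (a σ : ℝ) {T : ℝ} (hT : 1 ≤ T) :
    ((∫ t in (1 : ℝ)..T, ‖zetaR r a (σ + t * I)‖ ^ 2 : ℝ) : ℂ) =
      ∑ k ∈ range r, ∑ l ∈ range r, (pCoeff r a k : ℂ) * (pCoeff r a l : ℂ) *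
        ∫ t in (1 : ℝ)..T, hzeta a ((σ - k : ℝ) + t * I) *
          starRingEnd ℂ (hzeta a ((σ - l : ℝ) + t * I)) := by
  have hs : Set.Icc 1 T ⊆ Set.Ioi 0 := fun t ht => lt_of_lt_of_le one_pos ht.1
  have hi : ∀ k l : ℕ, IntervalIntegrable (fun t : ℝ => (pCoeff r a k : ℂ) * (pCoeff r a l : ℂ) *
      (hzeta a ((σ - k : ℝ) + t * I) * starRingEnd ℂ (hzeta a ((σ - l : ℝ) + t * I))))
      volume 1 T := fun k l =>
    (continuousOn_const.mul (((continuousOn_hzeta_line a _).mul (continuous_conj.comp_continuousOn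
      (continuousOn_hzeta_line a _))).mono hs)).intervalIntegrable_of_Icc hT
  have hpt : ∀ t : ℝ, ((‖zetaR r a (σ + t * I)‖ ^ 2 : ℝ) : ℂ) = ∑ k ∈ range r, ∑ l ∈ range r,
      (pCoeff r a k : ℂ) * (pCoeff r a l : ℂ) *
        (hzeta a ((σ - k : ℝ) + t * I) * starRingEnd ℂ (hzeta a ((σ - l : ℝ) + t * I))) := by
    intro t
    rw [ofReal_pow, ← mul_conj', zetaR, map_sum, sum_mul_sum]
    refine sum_congr rfl fun k _ => sum_congr rfl fun l _ => ?_
    have e : ∀ j : ℕ, (σ + t * I - j : ℂ) = (σ - j : ℝ) + t * I := fun j => by push_cast; ring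
    rw [e, e, map_mul, conj_ofReal]
    ring
  have hik : ∀ k : ℕ, IntervalIntegrable (fun t : ℝ => ∑ l ∈ range r,
      (pCoeff r a k : ℂ) * (pCoeff r a l : ℂ) *
      (hzeta a ((σ - k : ℝ) + t * I) * starRingEnd ℂ (hzeta a ((σ - l : ℝ) + t * I))))
      volume 1 T := fun k => by
    simpa only [sum_fn] using IntervalIntegrable.sum (range r) fun l _ => hi k l
  rw [← intervalIntegral.integral_ofReal, intervalIntegral.integral_congr fun t _ => hpt t,
    intervalIntegral.integral_finsetSum fun k _ => hik k]
  refine sum_congr rfl fun k _ => ?_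
  rw [intervalIntegral.integral_finsetSum fun l _ => hi k l]
  refine sum_congr rfl fun l _ => ?_
  rw [intervalIntegral.integral_const_mul]

theorem stmt3 (r : ℕ) (hr : 1 ≤ r) (a : ℝ) (ha : 0 < a) (ha1 : a ≤ 1)
    (σ : ℝ) (h1 : (r : ℝ) - 1 < σ) (h2 : σ < (r : ℝ) - 1 / 2) :
    (fun T : ℝ =>
        ((∫ t in (1 : ℝ)..T, ‖zetaR r a (σ + t * I)‖ ^ 2 : ℝ) : ℂ)
        - ((Nat.factorial (r - 1) : ℂ) ^ 2)⁻¹ *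
            (((2 * Real.pi : ℝ) : ℂ) ^ ((2 * σ - 2 * r + 1 : ℝ) : ℂ) / ((2 * r - 2 * σ : ℝ) : ℂ)) *
            riemannZeta ((2 * r - 2 * σ : ℝ) : ℂ) * (T : ℂ) ^ ((2 * r - 2 * σ : ℝ) : ℂ)
        - (∑ k ∈ Finset.range r, ∑ l ∈ Finset.range r,
            (pCoeff r a k : ℂ) * (pCoeff r a l : ℂ) *
              hzeta a ((2 * σ - k - l : ℝ) : ℂ)) * (T : ℂ))
      =O[atTop] fun T : ℝ => T ^ ((r : ℝ) - σ) * Real.log T := by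
  set δ := σ - r + 1 with hδ
  have hδ0 : 0 < δ := by linarith
  have hδ1 : δ < 1 / 2 := by linarith
  set Y : ℂ := hzeta 1 ((2 - 2 * δ : ℝ) : ℂ) with hY
  set m : ℝ → ℂ := fun T => (((2 * Real.pi) ^ (2 * δ - 1) * (T ^ (2 - 2 * δ) / (2 - 2 * δ)) : ℝ) : ℂ)
    with hm
  set f : ℕ → ℕ → ℝ → ℂ := fun k l T => (∫ t in (1 : ℝ)..T, hzeta a ((σ - k : ℝ) + t * I) *
    starRingEnd ℂ (hzeta a ((σ - l : ℝ) + t * I))) - (hzeta a ((2 * σ - k - l : ℝ) : ℂ) * T +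
      if k = r - 1 ∧ l = r - 1 then Y * m T else 0) with hf
  have hr1 : ((r - 1 : ℕ) : ℝ) = r - 1 := by rw [Nat.cast_sub hr, Nat.cast_one]
  have hcast : ∀ k ∈ range r, σ - k = δ + ((r - 1 - k : ℕ) : ℝ) := fun k hk => by
    rw [mem_range] at hk
    rw [Nat.cast_sub (by omega), hr1, hδ]; ring
  have hne : ∀ n : ℕ, δ + n ≠ 1 := fun n hn => by
    rcases Nat.eq_zero_or_pos n with rfl | hn'
    · rw [Nat.cast_zero] at hn; linarith
    · have : (1 : ℝ) ≤ n := by exact_mod_cast hn'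
      linarith
  have hO : ∀ k ∈ range r, ∀ l ∈ range r,
      f k l =O[atTop] fun T : ℝ => T ^ (1 - δ) * Real.log T := by
    intro k hk l hl
    by_cases hkl : k = r - 1 ∧ l = r - 1
    · obtain ⟨rfl, rfl⟩ := hkl
      simp only [hf, and_self, if_true]
      rw [hr1, show σ - ((r : ℝ) - 1) = δ by rw [hδ]; ring,
        show 2 * σ - ((r : ℝ) - 1) - ((r : ℝ) - 1) = 2 * δ by rw [hδ]; ring]
      exact hzeta_mean_square ha ha1 hδ0 hδ1
    · simp only [hf, hkl, if_false, add_zero]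
      rw [hcast k hk, hcast l hl, show 2 * σ - (k : ℝ) - l = (σ - k) + (σ - l) by ring,
        hcast k hk, hcast l hl]
      rw [mem_range] at hk hl
      refine hzeta_mul_conj_mean ha ha1 hδ0 hδ1 (by simp) (hne _) (by simp) (hne _) ?_
      have : (1 : ℝ) ≤ ((r - 1 - k : ℕ) : ℝ) + ((r - 1 - l : ℕ) : ℝ) := by
        exact_mod_cast (by omega : 1 ≤ (r - 1 - k) + (r - 1 - l))
      linarith
  rw [show (r : ℝ) - σ = 1 - δ by rw [hδ]; ring]
  refine Asymptotics.IsBigO.congr' (f₁ := fun T => ∑ k ∈ range r, ∑ l ∈ range r,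
    (pCoeff r a k : ℂ) * (pCoeff r a l : ℂ) * f k l T) ?_ ?_ EventuallyEq.rfl
  · exact Asymptotics.IsBigO.fun_sum fun k hk => Asymptotics.IsBigO.fun_sum fun l hl =>
      (hO k hk l hl).const_mul_left _
  · filter_upwards [eventually_ge_atTop 1] with T hT
    have hT0 : 0 ≤ T := by linarith
    rw [integral_norm_zetaR_sq r a σ hT]
    have hmem : r - 1 ∈ range r := mem_range.mpr (by omega)
    have hsing : ∑ k ∈ range r, ∑ l ∈ range r, (pCoeff r a k : ℂ) * (pCoeff r a l : ℂ) *
        (if k = r - 1 ∧ l = r - 1 then Y * m T else 0) =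
        ((Nat.factorial (r - 1) : ℂ) ^ 2)⁻¹ * (Y * m T) := by
      rw [sum_eq_single_of_mem _ hmem fun k _ hk => sum_eq_zero fun l _ => by simp [hk],
        sum_eq_single_of_mem _ hmem fun l _ hl => by simp [hl], pCoeff_top]
      simp only [and_self, if_true]
      push_cast
      ring
    have hYm : (((2 * Real.pi : ℝ) : ℂ) ^ ((2 * σ - 2 * r + 1 : ℝ) : ℂ) / ((2 * r - 2 * σ : ℝ) : ℂ)) *
        riemannZeta ((2 * r - 2 * σ : ℝ) : ℂ) * (T : ℂ) ^ ((2 * r - 2 * σ : ℝ) : ℂ) = Y * m T := by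
      rw [show 2 * σ - 2 * r + 1 = 2 * δ - 1 by rw [hδ]; ring,
        show 2 * r - 2 * σ = 2 - 2 * δ by rw [hδ]; ring, ← ofReal_cpow (by positivity),
        ← ofReal_cpow hT0, hY, hm, hzeta_one_eq]
      push_cast
      ring
    rw [mul_assoc, mul_assoc, ← mul_assoc (_ / _), hYm, ← hsing, sum_mul]
    simp_rw [sum_mul]
    simp_rw [← sum_sub_distrib]
    refine sum_congr rfl fun k _ => sum_congr rfl fun l _ => ?_
    rw [hf]
    ring
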